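/- arXiv:2209.08201 — 3 statements merged into one kernel-verified Lean document; each statement's English description precedes it below -/
import Mathlib

section
/- For all integers a ≥ 2, b ≥ 2 and i ≥ 1, the set Skyt(a,i,b) of skew standard Young tableaux of shape [(i+1)^b, 1^(a−2)] / [(i−1)^(b−2)] and the set Dyck(a+b+2i−2, i+1, b−2) of Dyck paths have the same cardinality; that is, there is a bijection between Skyt(a,i,b) and Dyck(a+b+2i−2, i+1, b−2). -/
/-! ## Skew Young tableaux -/

/-- Cells (row, col), 0-indexed, of the skew diagram with `b-2` single cells in
column `i` on top, two full rows of length `i+1`, and `a-2` single cells in column `0` below. -/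
def skytCells (a i b : ℕ) : Finset (ℕ × ℕ) :=
  (Finset.range (a + b - 2) ×ˢ Finset.range (i + 1)).filter fun c =>
    (c.1 + 2 < b → c.2 = i) ∧ (b ≤ c.1 → c.2 = 0)

/-- Skew standard Young tableaux of shape `[(i+1)^b, 1^(a-2)] / [(i-1)^(b-2)]`,
modelled as fillings of `skytCells a i b` by `1, …, a+b+2i-2`, increasing along
rows and columns, and vanishing outside the diagram. -/
def SkytSet (a i b : ℕ) : Set ((ℕ × ℕ) → ℕ) :=
  {f | (∀ c, c ∉ skytCells a i b → f c = 0) ∧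
    Set.BijOn f (skytCells a i b : Set (ℕ × ℕ)) (Finset.Icc 1 (a + b + 2 * i - 2) : Set ℕ) ∧
    (∀ c ∈ skytCells a i b, ∀ d ∈ skytCells a i b, c.1 = d.1 → c.2 < d.2 → f c < f d) ∧
    (∀ c ∈ skytCells a i b, ∀ d ∈ skytCells a i b, c.2 = d.2 → c.1 < d.1 → f c < f d)}

/-! ## Dyck paths -/

/-- Lengths of the maximal ascents (runs of `true`) of a word. -/
def ascentLengths (w : List Bool) : List ℕ :=
  ((w.splitBy (· == ·)).filter fun r => r.headD false).map List.length

/-- `DyckSet n l s`: Dyck paths (`true` = up-step) of semilength `n` with exactly `l`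
long ascents, exactly `s` singletons, and no singleton after the last long ascent. -/
def DyckSet (n l s : ℕ) : Set (List Bool) :=
  {w | w.length = 2 * n ∧ w.count true = w.count false ∧
    (∀ p, p <+: w → p.count false ≤ p.count true) ∧
    ((ascentLengths w).filter fun x => decide (2 ≤ x)).length = l ∧
    ((ascentLengths w).filter fun x => decide (x = 1)).length = s ∧
    ∀ j, (ascentLengths w).getD j 0 = 1 → ∃ k, j < k ∧ 2 ≤ (ascentLengths w).getD k 0}

/-! ## Dissections and triangulations -/

/-- A chord of the convex `n`-gon (vertices `1, …, n` counterclockwise): a pair of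
non-adjacent vertices, recorded with the smaller endpoint first. -/
def IsChord (n : ℕ) (c : ℕ × ℕ) : Prop :=
  1 ≤ c.1 ∧ c.1 + 1 < c.2 ∧ c.2 ≤ n ∧ ¬(c.1 = 1 ∧ c.2 = n)

/-- Two chords cross in the interior of the polygon. -/
def Crosses (c d : ℕ × ℕ) : Prop :=
  (c.1 < d.1 ∧ d.1 < c.2 ∧ c.2 < d.2) ∨ (d.1 < c.1 ∧ c.1 < d.2 ∧ d.2 < c.2)

/-- A dissection of the `n`-gon: a set of pairwise non-crossing chords. -/
def IsDissection (n : ℕ) (S : Finset (ℕ × ℕ)) : Prop :=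
  (∀ c ∈ S, IsChord n c) ∧ (∀ c ∈ S, ∀ d ∈ S, c ≠ d → ¬Crosses c d)

/-- `DisSet n k`: dissections of the `n`-gon with exactly `k` chords. -/
def DisSet (n k : ℕ) : Set (Finset (ℕ × ℕ)) :=
  {S | IsDissection n S ∧ S.card = k}

/-- A triangulation of the `n`-gon: a maximal set of pairwise non-crossing chords. -/
def IsTriangulation (n : ℕ) (S : Finset (ℕ × ℕ)) : Prop :=
  IsDissection n S ∧ ∀ c, IsChord n c → (∀ d ∈ S, ¬Crosses c d) → c ∈ S

/-- Fuelled recursive computation of the fan decomposition of the triangulation induced by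
the chord set `S` on the vertex interval `[p, r]`: returns the list of pairs
(origin of fan, number of triangles of the fan), in the order of the recursive
fan decomposition (fan at the smallest vertex first, then the decompositions of the
sub-polygons in counterclockwise order). -/
def fanListAux (S : Finset (ℕ × ℕ)) : ℕ → ℕ → ℕ → List (ℕ × ℕ)
  | 0, _, _ => []
  | fuel + 1, p, r =>
    if r ≤ p + 1 then []
    else
      let ws := ((S.filter fun c => c.1 = p ∧ p + 1 < c.2 ∧ c.2 < r).image Prod.snd).sort (· ≤ ·)
      let link := (p + 1) :: (ws ++ [r])
      (p, ws.length + 1) :: (link.zip link.tail).flatMap fun q => fanListAux S fuel q.1 q.2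

/-- The fan decomposition `F(T)` of the triangulation `S` of the polygon on the vertex
interval `[p, r]`, as a list of (origin, fan size) pairs. -/
def fanList (S : Finset (ℕ × ℕ)) (p r : ℕ) : List (ℕ × ℕ) :=
  fanListAux S (r - p) p r

/-- The sequence `δ(T) = (d_1, …, d_{k-1})` of differences of consecutive fan origins. -/
def deltaList (L : List (ℕ × ℕ)) : List ℕ :=
  ((L.map Prod.fst).zip (L.map Prod.fst).tail).map fun q => q.2 - q.1

/-- `TriSet n t s`: triangulations of the `n`-gon whose fan decomposition has `t + s` fans,
exactly `s` of them singular, the last one not singular. -/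
def TriSet (n t s : ℕ) : Set (Finset (ℕ × ℕ)) :=
  {S | IsTriangulation n S ∧
    (fanList S 1 n).length = t + s ∧
    ((fanList S 1 n).filter fun fan => decide (fan.2 = 1)).length = s ∧
    ((fanList S 1 n).getLastD (0, 0)).2 ≠ 1}

/-! ## Ordered set partitions -/

/-- The minimum of a finite set of naturals (0 by convention for `∅`). -/
def blockMin (A : Finset ℕ) : ℕ := (A.sort (· ≤ ·)).getD 0 0

/-- The second-smallest element of a finite set of naturals. -/
def blockSndMin (A : Finset ℕ) : ℕ := (A.sort (· ≤ ·)).getD 1 0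

/-- An ordered set partition of `{1, …, n}` : a list of nonempty pairwise disjoint
blocks whose union is `{1, …, n}`. -/
def IsOSP (n : ℕ) (L : List (Finset ℕ)) : Prop :=
  (∀ A ∈ L, A.Nonempty) ∧ List.Pairwise Disjoint L ∧
    L.foldr (· ∪ ·) ∅ = Finset.Icc 1 n

/-- Nomincreasing: the blocks' minima strictly increase, and the second-smallest elements
of the blocks of size at least 2 strictly increase (in the order the blocks appear). -/
def Nomincreasing (L : List (Finset ℕ)) : Prop :=
  (L.map blockMin).Chain' (· < ·) ∧
    ((L.filter fun A => decide (2 ≤ A.card)).map blockSndMin).Chain' (· < ·)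

/-- The word `U^{a_1} D^{x_2-x_1} ⋯ U^{a_t} D^{n-x_t+x_1}` attached to an ordered set
partition of `{1, …, n}` with minima `x_j` and block sizes `a_j`. -/
def ospWord (n : ℕ) (L : List (Finset ℕ)) : List Bool :=
  let xs := L.map blockMin
  let ds := ((xs.zip xs.tail).map fun q => q.2 - q.1) ++ [n - xs.getLastD 0 + xs.headD 0]
  ((L.map Finset.card).zip ds).flatMap fun q =>
    List.replicate q.1 true ++ List.replicate q.2 false

/-! ## The map `Nom` -/

/-- The `j`-th block (0-indexed) of `Nom(λ)` for a tableau `f ∈ SkytSet a i b`. -/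
def nomBlock (a i b : ℕ) (f : ℕ × ℕ → ℕ) (j : ℕ) : Finset ℕ :=
  let N := a + b + 2 * i - 2
  let X := ((skytCells a i b).filter fun c => c.1 + 1 < b).image f
  let x := (X.sort (· ≤ ·)).getD j 0
  let row := (Finset.range (i + 1)).filter fun c => f (b - 2, c) = x
  if row.Nonempty then
    let col := (row.sort (· ≤ ·)).getD 0 0
    if col = i then insert x (Finset.Icc (f (b - 1, col)) N \ X)
    else insert x (Finset.Icc (f (b - 1, col)) (f (b - 1, col + 1) - 1) \ X)
  else {x}

/-- The nomincreasing ordered set partition `Nom(λ)` of a tableau `λ ∈ SkytSet a i b`. -/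
def Nom (a i b : ℕ) (f : ℕ × ℕ → ℕ) : List (Finset ℕ) :=
  (List.range (i + b - 1)).map (nomBlock a i b f)

/-- The Dyck word `U^{u_1} D^{d_1} ⋯ U^{u_{t+s}} D^{d_{t+s}}` attached to a triangulation. -/
def triWord (n : ℕ) (S : Finset (ℕ × ℕ)) : List Bool :=
  let L := fanList S 1 n
  let xs := L.map Prod.fst
  let ds := deltaList L ++ [n - xs.getLastD 0 + xs.headD 0 - 2]
  ((L.map Prod.snd).zip ds).flatMap fun q =>
    List.replicate q.1 true ++ List.replicate q.2 false

/-! ### Dyck words as sequences of ascents before each down-step -/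

/-- The word whose `k`-th down-step is immediately preceded by exactly `u[k]` up-steps. -/
def stepWord : List ℕ → List Bool
  | [] => []
  | a :: u => List.replicate a true ++ false :: stepWord u

/-- Started at height `h`, the path `stepWord u` stays nonnegative and ends at height `0`. -/
def StepsBalanced : ℕ → List ℕ → Prop
  | h, [] => h = 0
  | h, a :: u => 1 ≤ h + a ∧ StepsBalanced (h + a - 1) u

/-- Every entry `1` is followed by some entry at least `2`. -/
def OnesFollowed : List ℕ → Prop
  | [] => True
  | a :: u => (a = 1 → ∃ x ∈ u, 2 ≤ x) ∧ OnesFollowed u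

theorem onesFollowed_iff_getD (l : List ℕ) :
    OnesFollowed l ↔ ∀ j, l.getD j 0 = 1 → ∃ k, j < k ∧ 2 ≤ l.getD k 0 := by
  induction l with
  | nil => simp [OnesFollowed]
  | cons a u ih =>
    rw [OnesFollowed, ih]
    constructor
    · rintro ⟨h1, h2⟩ (_ | j) hj
      · obtain ⟨x, hx, hx2⟩ := h1 (by simpa using hj)
        obtain ⟨k, hk, rfl⟩ := List.getElem_of_mem hx
        exact ⟨k + 1, by omega, by simpa [hk] using hx2⟩
      · obtain ⟨k, hk, hk2⟩ := h2 j (by simpa using hj)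
        exact ⟨k + 1, by omega, by simpa using hk2⟩
    · intro h
      constructor
      · rintro rfl
        obtain ⟨k, hk, hk2⟩ := h 0 (by simp)
        obtain ⟨k, rfl⟩ : ∃ k', k = k' + 1 := ⟨k - 1, by omega⟩
        have hlt : k < u.length := by
          by_contra hc
          simp [List.getElem?_eq_none (not_lt.mp hc)] at hk2
        exact ⟨u[k], List.getElem_mem hlt, by simpa [hlt] using hk2⟩
      · intro j hj
        obtain ⟨k, hk, hk2⟩ := h (j + 1) (by simpa using hj)
        obtain ⟨k, rfl⟩ : ∃ k', k = k' + 1 := ⟨k - 1, by omega⟩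
        exact ⟨k, by omega, by simpa using hk2⟩

theorem onesFollowed_filter_ne_zero (u : List ℕ) :
    OnesFollowed (u.filter (· ≠ 0)) ↔ OnesFollowed u := by
  induction u with
  | nil => simp
  | cons a u ih =>
    rcases eq_or_ne a 0 with rfl | ha
    · simpa [OnesFollowed] using ih
    · have h : (∃ x ∈ u.filter (· ≠ 0), 2 ≤ x) ↔ ∃ x ∈ u, 2 ≤ x :=
        ⟨fun ⟨x, hx, h2⟩ => ⟨x, List.mem_of_mem_filter hx, h2⟩,
          fun ⟨x, hx, h2⟩ => ⟨x, List.mem_filter.2 ⟨hx, by simpa using by omega⟩, h2⟩⟩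
      rw [List.filter_cons_of_pos (by simpa using ha), OnesFollowed, OnesFollowed, h, ih]

theorem ascentLengths_append {v w : List Bool}
    (h : ∀ x ∈ v.getLast?, ∀ y ∈ w.head?, (x == y) = false) :
    ascentLengths (v ++ w) = ascentLengths v ++ ascentLengths w := by
  simp [ascentLengths, List.splitBy_append h]

theorem isChain_replicate_beq (n : ℕ) (x : Bool) :
    (List.replicate n x).IsChain fun a b => (a == b) = true := by
  induction n with
  | zero => simp
  | succ n ih => cases n <;> simp_all [List.replicate_succ]

theorem ascentLengths_replicate_false (n : ℕ) :
    ascentLengths (List.replicate n false) = [] := by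
  cases n with
  | zero => simp [ascentLengths]
  | succ n =>
    rw [ascentLengths, List.splitBy_of_isChain (r := (· == ·)) (l := List.replicate (n + 1) false)
      (by simp) (isChain_replicate_beq _ _), List.filter_cons_of_neg (by simp [List.replicate_succ])]
    rfl

theorem ascentLengths_replicate_true (n : ℕ) :
    ascentLengths (List.replicate (n + 1) true) = [n + 1] := by
  rw [ascentLengths, List.splitBy_of_isChain (r := (· == ·)) (l := List.replicate (n + 1) true)
      (by simp) (isChain_replicate_beq _ _),
    List.filter_cons_of_pos (by simp [List.replicate_succ])]
  simp

theorem ascentLengths_stepWord (u : List ℕ) :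
    ascentLengths (stepWord u) = u.filter (· ≠ 0) := by
  suffices h : ∀ k, ascentLengths (List.replicate k false ++ stepWord u) = u.filter (· ≠ 0) by
    simpa using h 0
  induction u with
  | nil => simp [stepWord, ascentLengths_replicate_false]
  | cons a u ih =>
    intro k
    rcases a with _ | a
    · have h := ih (k + 1)
      rw [List.replicate_succ', List.append_assoc] at h
      simpa [stepWord] using h
    · have h := ih 1
      simp only [List.replicate_one, List.singleton_append] at h
      rw [stepWord, ascentLengths_append, ascentLengths_append, h, ascentLengths_replicate_false,
        ascentLengths_replicate_true]
      · simp
      · intro x hx y hy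
        have hx' := List.mem_of_mem_getLast? hx
        simp only [List.head?_cons, Option.mem_def, Option.some.injEq] at hy
        rw [List.eq_of_mem_replicate hx', ← hy]
        rfl
      · intro x hx y hy
        have hx' := List.mem_of_mem_getLast? hx
        simp only [List.replicate_succ, List.cons_append, List.head?_cons, Option.mem_def,
          Option.some.injEq] at hy
        rw [List.eq_of_mem_replicate hx', ← hy]
        rfl

theorem count_true_stepWord (u : List ℕ) : (stepWord u).count true = u.sum := by
  induction u with
  | nil => simp [stepWord]
  | cons a u ih => simp [stepWord, ih]

theorem count_false_stepWord (u : List ℕ) : (stepWord u).count false = u.length := by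
  induction u with
  | nil => simp [stepWord]
  | cons a u ih => simp [stepWord, ih, List.count_replicate]

theorem length_stepWord (u : List ℕ) : (stepWord u).length = u.sum + u.length := by
  induction u with
  | nil => simp [stepWord]
  | cons a u ih => simp [stepWord, ih]; omega

theorem stepWord_injective : Function.Injective stepWord := by
  intro u
  induction u with
  | nil => rintro (_ | ⟨a, u⟩) h <;> simp_all [stepWord]
  | cons a u ih =>
    rintro (_ | ⟨b, v⟩) h
    · simp [stepWord] at h
    · have key : ∀ a b : ℕ, List.replicate a true ++ false :: stepWord u =
          List.replicate b true ++ false :: stepWord v → a = b ∧ stepWord u = stepWord v := by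
        intro a
        induction a with
        | zero => rintro (_ | b) h <;> simp_all [List.replicate_succ]
        | succ a iha =>
          rintro (_ | b) h
          · simp [List.replicate_succ] at h
          · simpa using iha b (by simpa [List.replicate_succ] using h)
      obtain ⟨rfl, h2⟩ := key a b h
      rw [ih h2]

theorem exists_eq_stepWord_append (w : List Bool) :
    ∃ u r, w = stepWord u ++ List.replicate r true := by
  induction w with
  | nil => exact ⟨[], 0, by simp [stepWord]⟩
  | cons x w ih =>
    obtain ⟨u, r, rfl⟩ := ih
    cases x with
    | false => exact ⟨0 :: u, r, by simp [stepWord]⟩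
    | true =>
      rcases u with _ | ⟨a, u⟩
      · exact ⟨[], r + 1, by simp [stepWord, List.replicate_succ]⟩
      · exact ⟨(a + 1) :: u, r, by simp [stepWord, List.replicate_succ]⟩

theorem forall_prefix_cons_iff {α : Type*} {P : List α → Prop} (x : α) (w : List α) :
    (∀ p, p <+: x :: w → P p) ↔ P [] ∧ ∀ p, p <+: w → P (x :: p) := by
  constructor
  · intro h
    exact ⟨h _ List.nil_prefix, fun p hp => h _ (by simpa using hp)⟩
  · rintro ⟨h1, h2⟩ (_ | ⟨y, p⟩) hp
    · exact h1
    · rw [List.cons_prefix_cons] at hp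
      obtain ⟨rfl, hp⟩ := hp
      exact h2 p hp

theorem forall_prefix_replicate_iff (a h : ℕ) (w : List Bool) :
    (∀ p, p <+: List.replicate a true ++ w → p.count false ≤ h + p.count true) ↔
      ∀ p, p <+: w → p.count false ≤ h + a + p.count true := by
  induction a generalizing h with
  | zero => simp
  | succ a ih =>
    rw [List.replicate_succ, List.cons_append, forall_prefix_cons_iff]
    have := ih (h + 1)
    simp only [List.count_nil, List.count_cons] at this ⊢
    simp only [show h + (a + 1) = h + 1 + a by omega, ← this]
    simp [add_assoc, add_comm 1]

theorem stepsBalanced_iff (h : ℕ) (u : List ℕ) :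
    StepsBalanced h u ↔ h + u.sum = u.length ∧
      ∀ p, p <+: stepWord u → p.count false ≤ h + p.count true := by
  induction u generalizing h with
  | nil => simp [StepsBalanced, stepWord]
  | cons a u ih =>
    rw [StepsBalanced, stepWord, forall_prefix_replicate_iff, forall_prefix_cons_iff, ih]
    simp only [List.count_nil, List.count_cons, List.sum_cons, List.length_cons]
    constructor
    · rintro ⟨h1, h2, h3⟩
      refine ⟨by omega, by simp, fun p hp => ?_⟩
      have := h3 p hp
      simp
      omega
    · rintro ⟨h1, -, h3⟩
      have h0 := h3 [] List.nil_prefix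
      simp at h0
      refine ⟨by omega, by omega, fun p hp => ?_⟩
      have := h3 p hp
      simp at this
      omega

/-- Step sequences of the Dyck paths in `DyckSet n l s`. -/
def StepSet (n l s : ℕ) : Set (List ℕ) :=
  {u | u.length = n ∧ StepsBalanced 0 u ∧ u.countP (2 ≤ ·) = l ∧ u.count 1 = s ∧ OnesFollowed u}

theorem stepWord_mem_dyckSet_iff (n l s : ℕ) (u : List ℕ) :
    stepWord u ∈ DyckSet n l s ↔ u ∈ StepSet n l s := by
  have hl : ((u.filter (· ≠ 0)).filter fun x => decide (2 ≤ x)).length = u.countP (2 ≤ ·) := by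
    rw [← List.countP_eq_length_filter, List.countP_filter]
    exact List.countP_congr fun x _ => by
      simp only [decide_not, Bool.and_eq_true, decide_eq_true_eq, Bool.not_eq_true',
        decide_eq_false_iff_not]
      omega
  have hs : ((u.filter (· ≠ 0)).filter fun x => decide (x = 1)).length = u.count 1 := by
    rw [← List.countP_eq_length_filter, List.countP_filter]
    exact List.countP_congr fun x _ => by
      simp only [decide_not, Bool.and_eq_true, decide_eq_true_eq, Bool.not_eq_true',
        decide_eq_false_iff_not, beq_iff_eq]
      omega
  simp only [DyckSet, StepSet, Set.mem_ofPred_eq, ascentLengths_stepWord, hl, hs,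
    ← onesFollowed_iff_getD, onesFollowed_filter_ne_zero, stepsBalanced_iff, length_stepWord,
    count_true_stepWord, count_false_stepWord, zero_add]
  constructor
  · rintro ⟨h1, h2, h3⟩
    exact ⟨by omega, ⟨h2, h3.1⟩, h3.2⟩
  · rintro ⟨h1, ⟨h2, h3⟩, h4⟩
    exact ⟨by omega, h2, h3, h4⟩

theorem bijOn_stepWord (n l s : ℕ) : Set.BijOn stepWord (StepSet n l s) (DyckSet n l s) := by
  refine ⟨fun u hu => (stepWord_mem_dyckSet_iff n l s u).2 hu, stepWord_injective.injOn, ?_⟩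
  intro w hw
  obtain ⟨u, r, rfl⟩ := exists_eq_stepWord_append w
  have hr : r = 0 := by
    have h1 := hw.2.1
    have h2 := hw.2.2.1 (stepWord u) (List.prefix_append _ _)
    simp [List.count_replicate] at h1 h2
    omega
  subst hr
  simp only [List.replicate_zero, List.append_nil] at hw ⊢
  exact ⟨u, (stepWord_mem_dyckSet_iff n l s u).1 hw, rfl⟩

/-! ### Lattice words in the four parts of the skew shape -/

/-- The four parts of the shape: the two full rows, the column above and the column below. -/
inductive SkytPart
  | top
  | bottom
  | upper
  | lower
  deriving DecidableEq

namespace SkytPart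

/-- `2` for the upper full row, `1` for the upper column, `0` for the rest. -/
def rank : SkytPart → ℕ
  | top => 2
  | upper => 1
  | bottom => 0
  | lower => 0

end SkytPart

open SkytPart

/-- `Distributes u q v`: reading `u` with initial queue `q` emits `v` and empties the queue, where
an entry `0` emits the head of the queue, an entry `1` emits `upper`, and an entry `m + 2` emits
`top` and enqueues `bottom` followed by `m` copies of `lower`. -/
inductive Distributes : List ℕ → List SkytPart → List SkytPart → Prop
  | nil : Distributes [] [] []
  | pop {u q v} (y : SkytPart) (hy : y.rank = 0) (h : Distributes u q v) :
      Distributes (0 :: u) (y :: q) (y :: v)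
  | upper {u q v} (h : Distributes u q v) : Distributes (1 :: u) q (upper :: v)
  | top {u q v} (m : ℕ) (h : Distributes u (q ++ bottom :: List.replicate m lower) v) :
      Distributes ((m + 2) :: u) q (top :: v)

namespace Distributes

variable {u u' : List ℕ} {q q' v v' : List SkytPart}

theorem rank_eq_zero (h : Distributes u q v) : ∀ y ∈ q, y.rank = 0 := by
  induction h with
  | nil => simp
  | pop y hy _ ih => simpa using ⟨hy, ih⟩
  | upper _ ih => exact ih
  | top m _ ih => exact fun y hy => ih y (List.mem_append_left _ hy)

theorem stepsBalanced (h : Distributes u q v) : StepsBalanced q.length u := by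
  induction h with
  | nil => simp [StepsBalanced]
  | pop y _ _ ih => simpa [StepsBalanced] using ih
  | upper _ ih => simpa [StepsBalanced] using ih
  | top m _ ih =>
    refine ⟨by omega, ?_⟩
    simpa [Nat.add_assoc] using ih

theorem map_rank (h : Distributes u q v) : v.map rank = u.map (min 2) := by
  induction h with
  | nil => simp
  | pop y hy _ ih => simp [hy, ih]
  | upper _ ih => simp [rank, ih]
  | top m _ ih => simp [rank, ih]

theorem count_bottom (h : Distributes u q v) :
    v.count bottom = q.count bottom + v.count SkytPart.top := by
  induction h with
  | nil => simp
  | pop y hy _ ih =>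
    cases y <;> simp_all [rank]
    omega
  | upper _ ih => simp [ih]
  | top m _ ih => simp [List.count_replicate] at ih ⊢; omega

theorem count_bottom_take (h : Distributes u q v) (k : ℕ) :
    (v.take k).count bottom ≤ q.count bottom + (v.take k).count SkytPart.top := by
  induction h generalizing k with
  | nil => simp
  | pop y hy _ ih =>
    rcases k with _ | k
    · simp
    · have := ih k
      clear ih
      cases y <;> simp [rank] at hy ⊢ <;> omega
  | upper _ ih =>
    rcases k with _ | k
    · simp
    · simpa using ih k
  | top m _ ih =>
    rcases k with _ | k
    · simp
    · have := ih k
      simp [List.count_replicate] at this ⊢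
      omega

theorem exists_bottom_before_lower (h : Distributes u q v) (hq : q.head? ≠ some lower) (k : ℕ)
    (hk : v[k]? = some lower) : ∃ k' < k, v[k']? = some bottom := by
  induction h generalizing k with
  | nil => simp at hk
  | pop y hy _ ih =>
    rcases k with _ | k
    · simp_all
    · cases y <;> simp_all [rank]
      exact ⟨0, by omega, by simp⟩
  | upper _ ih =>
    rcases k with _ | k
    · simp at hk
    · obtain ⟨k', h1, h2⟩ := ih hq k (by simpa using hk)
      exact ⟨k' + 1, by omega, by simpa using h2⟩
  | @top u q v m _ ih =>
    rcases k with _ | k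
    · simp at hk
    · obtain ⟨k', h1, h2⟩ := ih (by cases q <;> simp_all) k (by simpa using hk)
      exact ⟨k' + 1, by omega, by simpa using h2⟩

theorem exists_lower_before_bottom (h : Distributes u q v) (hq : q.head? = some lower) :
    ∃ k : ℕ, v[k]? = some lower ∧ ∀ k' < k, v[k']? ≠ some bottom := by
  induction h with
  | nil => simp at hq
  | pop y hy _ ih => exact ⟨0, by simpa using hq, by simp⟩
  | upper _ ih =>
    obtain ⟨k, h1, h2⟩ := ih hq
    refine ⟨k + 1, by simpa using h1, ?_⟩
    rintro (_ | k') hk'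
    · simp
    · simpa using h2 k' (by omega)
  | @top u q v m _ ih =>
    obtain ⟨k, h1, h2⟩ := ih (by cases q <;> simp_all)
    refine ⟨k + 1, by simpa using h1, ?_⟩
    rintro (_ | k') hk'
    · simp
    · simpa using h2 k' (by omega)

theorem right_unique (h : Distributes u q v) (h' : Distributes u q v') : v = v' := by
  induction h generalizing v' with
  | nil => cases h'; rfl
  | pop y hy _ ih => cases h' with | pop _ _ h' => rw [ih h']
  | upper _ ih => cases h' with | upper h' => rw [ih h']
  | top m _ ih => cases h' with | top _ h' => rw [ih h']

theorem append_replicate_injective {m m' : ℕ}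
    (h : q ++ bottom :: List.replicate m lower = q' ++ bottom :: List.replicate m' lower) :
    m = m' ∧ q = q' := by
  induction m generalizing m' with
  | zero =>
    rcases m' with _ | m'
    · simpa using h
    · simp only [List.replicate_zero, List.replicate_succ', ← List.cons_append,
        ← List.append_assoc] at h
      have := (List.append_inj' h rfl).2
      simp at this
  | succ m ih =>
    simp only [List.replicate_succ', ← List.cons_append, ← List.append_assoc] at h
    rcases m' with _ | m'
    · simp only [List.replicate_zero] at h
      have := (List.append_inj' h rfl).2
      simp at this
    · simp only [List.replicate_succ', ← List.cons_append, ← List.append_assoc] at h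
      obtain ⟨rfl, h2⟩ := ih (List.append_inj' h rfl).1
      exact ⟨rfl, h2⟩

theorem left_unique (h : Distributes u q v) (h' : Distributes u' q' v) : u = u' ∧ q = q' := by
  induction h generalizing u' q' with
  | nil => cases h'; simp
  | pop y hy _ ih =>
    cases h' with
    | pop _ _ h' => simpa using ih h'
    | upper h' => simp [rank] at hy
    | top _ h' => simp [rank] at hy
  | upper _ ih =>
    cases h' with
    | pop _ hy h' => simp [rank] at hy
    | upper h' => simpa using ih h'
  | top m _ ih =>
    cases h' with
    | pop _ hy h' => simp [rank] at hy
    | top m' h' =>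
      obtain ⟨rfl, h2⟩ := ih h'
      obtain ⟨rfl, rfl⟩ := append_replicate_injective h2
      simp

theorem exists_right (u : List ℕ) (q : List SkytPart) (hq : ∀ y ∈ q, y.rank = 0)
    (h : StepsBalanced q.length u) : ∃ v, Distributes u q v := by
  induction u generalizing q with
  | nil =>
    obtain rfl : q = [] := List.eq_nil_of_length_eq_zero h
    exact ⟨[], nil⟩
  | cons a u ih =>
    rcases a with _ | _ | m
    · rcases q with _ | ⟨y, q⟩
      · simp [StepsBalanced] at h
      · obtain ⟨v, hv⟩ := ih q (fun z hz => hq z (by simp [hz])) (by simpa [StepsBalanced] using h)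
        exact ⟨_, pop y (hq y (by simp)) hv⟩
    · obtain ⟨v, hv⟩ := ih q hq (by simpa [StepsBalanced] using h)
      exact ⟨_, upper hv⟩
    · obtain ⟨v, hv⟩ := ih (q ++ bottom :: List.replicate m lower)
        (by
          intro y hy
          simp only [List.mem_append, List.mem_cons, List.mem_replicate] at hy
          rcases hy with hy | rfl | ⟨-, rfl⟩
          exacts [hq y hy, rfl, rfl])
        (by simpa [Nat.add_assoc] using h.2)
      exact ⟨_, top m hv⟩

theorem exists_eq_append_replicate (hq : ∀ y ∈ q, y.rank = 0) (hb : bottom ∈ q) :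
    ∃ q' m, q = q' ++ bottom :: List.replicate m lower := by
  obtain ⟨r, s, h, hr⟩ := List.eq_append_cons_of_mem (List.mem_reverse.2 hb)
  have hqr : q = s.reverse ++ bottom :: r.reverse := by
    rw [← List.reverse_reverse q, h]
    simp
  refine ⟨s.reverse, r.length, ?_⟩
  have hrep : r.reverse = List.replicate r.length lower := by
    rw [List.eq_replicate_iff]
    refine ⟨by simp, fun y hy => ?_⟩
    have h0 := hq y (by rw [hqr]; simp at hy; simp [hy])
    cases y with
    | bottom => exact absurd (List.mem_reverse.1 hy) hr
    | lower => rfl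
    | top => simp [rank] at h0
    | upper => simp [rank] at h0
  rw [← hrep, ← hqr]

theorem exists_left (v : List SkytPart)
    (hv : ∀ k, (v.drop k).count SkytPart.top ≤ (v.drop k).count bottom) :
    ∃ u q, Distributes u q v := by
  induction v with
  | nil => exact ⟨[], [], nil⟩
  | cons y v ih =>
    obtain ⟨u, q, h⟩ := ih fun k => by simpa using hv (k + 1)
    cases y with
    | top =>
      have h0 := hv 0
      have hc := h.count_bottom
      simp at h0
      obtain ⟨q', m, rfl⟩ := exists_eq_append_replicate h.rank_eq_zero
        (List.count_pos_iff.1 (by omega : 0 < q.count bottom))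
      exact ⟨_, _, top m h⟩
    | bottom => exact ⟨_, _, pop _ rfl h⟩
    | lower => exact ⟨_, _, pop _ rfl h⟩
    | upper => exact ⟨_, _, upper h⟩

theorem onesFollowed_iff (h : Distributes u q v) : OnesFollowed (v.map rank) ↔ OnesFollowed u := by
  induction h with
  | nil => simp
  | pop y hy _ ih => simpa [OnesFollowed, hy] using ih
  | @upper u q v h ih =>
    have h2 : (∃ x ∈ v.map rank, 2 ≤ x) ↔ ∃ x ∈ u, 2 ≤ x := by simp [h.map_rank]
    simp only [List.map_cons, OnesFollowed, h2, ih, rank]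
  | top m _ ih => simp [OnesFollowed, rank, ih]

theorem length_eq (h : Distributes u q v) : v.length = u.length := by
  simpa using congrArg List.length h.map_rank

theorem count_top (h : Distributes u q v) : v.count SkytPart.top = u.countP (2 ≤ ·) := by
  induction h with
  | nil => simp
  | pop y hy _ ih => cases y <;> simp_all [rank]
  | upper _ ih => simp [ih]
  | top m _ ih => simp [ih]

theorem count_upper (h : Distributes u q v) : v.count SkytPart.upper = u.count 1 := by
  induction h with
  | nil => simp
  | pop y hy _ ih => cases y <;> simp_all [rank]
  | upper _ ih => simp [ih]
  | top m _ ih => simp [ih]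

end Distributes

/-- Words with `l` letters `top`, `l` letters `bottom` and `s` letters `upper` which describe the
position of the entries of a tableau in `SkytSet`. -/
def PartWordSet (n l s : ℕ) : Set (List SkytPart) :=
  {v | v.length = n ∧ v.count top = l ∧ v.count upper = s ∧ v.count bottom = l ∧
    (∀ k, (v.take k).count bottom ≤ (v.take k).count top) ∧
    OnesFollowed (v.map rank) ∧
    ∀ k : ℕ, v[k]? = some lower → ∃ k' < k, v[k']? = some bottom}

theorem nonempty_equiv_of_rel {α β : Type*} {s : Set α} {t : Set β} (R : α → β → Prop)
    (hs : ∀ a ∈ s, ∃ b ∈ t, R a b) (ht : ∀ b ∈ t, ∃ a ∈ s, R a b)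
    (hr : ∀ a b b', R a b → R a b' → b = b') (hl : ∀ a a' b, R a b → R a' b → a = a') :
    Nonempty (s ≃ t) := by
  choose f hf hR using hs
  refine ⟨Equiv.ofBijective (fun a => ⟨f a a.2, hf a a.2⟩) ⟨?_, ?_⟩⟩
  · rintro ⟨a, ha⟩ ⟨a', ha'⟩ h
    simp only [Subtype.mk.injEq] at h
    have h2 := hR a' ha'
    rw [← h] at h2
    exact Subtype.ext (hl _ _ _ (hR a ha) h2)
  · rintro ⟨b, hb⟩
    obtain ⟨a, ha, hab⟩ := ht b hb
    exact ⟨⟨a, ha⟩, Subtype.ext (hr _ _ _ (hR a ha) hab)⟩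

theorem nonempty_stepSet_equiv_partWordSet (n l s : ℕ) :
    Nonempty (StepSet n l s ≃ PartWordSet n l s) := by
  refine nonempty_equiv_of_rel (fun u v => Distributes u [] v) ?_ ?_
    (fun _ _ _ h h' => h.right_unique h') (fun _ _ _ h h' => (h.left_unique h').1)
  · rintro u ⟨h1, h2, h3, h4, h5⟩
    obtain ⟨v, h⟩ := Distributes.exists_right u [] (by simp) h2
    refine ⟨v, ⟨?_, ?_, ?_, ?_, ?_, ?_, ?_⟩, h⟩
    · rw [h.length_eq, h1]
    · rw [h.count_top, h3]
    · rw [h.count_upper, h4]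
    · rw [h.count_bottom, h.count_top, h3]
      simp
    · intro k
      simpa using h.count_bottom_take k
    · rwa [h.onesFollowed_iff]
    · exact h.exists_bottom_before_lower (by simp)
  · rintro v ⟨h1, h2, h3, h4, h5, h6, h7⟩
    obtain ⟨u, q, h⟩ := Distributes.exists_left v fun k => by
      have e1 := List.count_append (a := top) (l₁ := v.take k) (l₂ := v.drop k)
      have e2 := List.count_append (a := bottom) (l₁ := v.take k) (l₂ := v.drop k)
      rw [List.take_append_drop] at e1 e2
      have := h5 k
      omega
    obtain rfl : q = [] := by
      rcases q with _ | ⟨y, q⟩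
      · rfl
      · have hc := h.count_bottom
        have hy := h.rank_eq_zero y (by simp)
        cases y with
        | bottom => simp at hc; omega
        | lower =>
          obtain ⟨k, hk, hk'⟩ := h.exists_lower_before_bottom (by simp)
          obtain ⟨k', hlt, hb⟩ := h7 k hk
          exact absurd hb (hk' k' hlt)
        | top => simp [rank] at hy
        | upper => simp [rank] at hy
    refine ⟨u, ⟨?_, h.stepsBalanced, ?_, ?_, ?_⟩, h⟩
    · rw [← h.length_eq, h1]
    · rw [← h.count_top, h2]
    · rw [← h.count_upper, h3]
    · rwa [← h.onesFollowed_iff]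

/-! ### Tableaux as words -/

theorem onesFollowed_map_rank_iff (v : List SkytPart) :
    OnesFollowed (v.map rank) ↔
      ∀ k : ℕ, v[k]? = some upper → ∃ k' > k, v[k']? = some top := by
  have h1 (k : ℕ) : (v.map rank).getD k 0 = 1 ↔ v[k]? = some upper := by
    rcases h : v[k]? with _ | y
    · simp [h]
    · cases y <;> simp [h, rank]
  have h2 (k : ℕ) : 2 ≤ (v.map rank).getD k 0 ↔ v[k]? = some top := by
    rcases h : v[k]? with _ | y
    · simp [h]
    · cases y <;> simp [h, rank]
  simp only [onesFollowed_iff_getD, h1, h2, gt_iff_lt]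

theorem natCount_getElem?_eq (v : List SkytPart) (x : SkytPart) (n : ℕ) :
    Nat.count (fun k => v[k]? = some x) n = (v.take n).count x := by
  induction n with
  | zero => simp
  | succ n ih =>
    rw [Nat.count_succ, ih, List.take_add_one, List.count_append]
    rcases h : v[n]? with _ | y
    · simp
    · simp [List.count_singleton]

theorem sum_count_eq_length (v : List SkytPart) :
    v.count top + v.count bottom + v.count upper + v.count lower = v.length := by
  induction v with
  | nil => simp
  | cons y v ih => cases y <;> simp <;> omega

section Enumeration

variable {p : ℕ → Prop} {g : ℕ → ℕ} {m : ℕ}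

theorem count_eq_card_filter_lt [DecidablePred p] (hg : StrictMonoOn g (Set.Iio m))
    (hp : ∀ k, p k ↔ ∃ j < m, g j = k) (n : ℕ) :
    Nat.count p n = ((Finset.range m).filter fun j => g j < n).card := by
  have h : (Finset.range n).filter p = ((Finset.range m).filter fun j => g j < n).image g := by
    ext k
    simp only [Finset.mem_filter, Finset.mem_range, Finset.mem_image, hp]
    grind
  rw [Nat.count_eq_card_filter_range, h, Finset.card_image_of_injOn]
  exact hg.injOn.mono fun j hj => by simp at hj ⊢; exact hj.1

theorem eq_nth_of_strictMonoOn (hg : StrictMonoOn g (Set.Iio m))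
    (hp : ∀ k, p k ↔ ∃ j < m, g j = k) {j : ℕ} (hj : j < m) : g j = Nat.nth p j := by
  classical
  have hc : Nat.count p (g j) = j := by
    rw [count_eq_card_filter_lt hg hp]
    have : ((Finset.range m).filter fun k => g k < g j) = Finset.range j := by
      ext k
      simp only [Finset.mem_filter, Finset.mem_range]
      constructor
      · rintro ⟨hk, h⟩
        exact (hg.lt_iff_lt hk hj).1 h
      · intro h
        exact ⟨h.trans hj, hg (h.trans hj) hj h⟩
    rw [this, Finset.card_range]
  have := Nat.nth_count ((hp (g j)).2 ⟨j, hj, rfl⟩)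
  rw [hc] at this
  exact this.symm

end Enumeration

namespace SkytPart

/-- The number of cells in each part of the shape. -/
def size (a i b : ℕ) : SkytPart → ℕ
  | top => i + 1
  | bottom => i + 1
  | upper => b - 2
  | lower => a - 2

/-- The `j`-th cell of each part of the shape. -/
def cell (i b : ℕ) : SkytPart → ℕ → ℕ × ℕ
  | top, j => (b - 2, j)
  | bottom, j => (b - 1, j)
  | upper, j => (j, i)
  | lower, j => (b + j, 0)

variable {a i b : ℕ}

theorem mem_skytCells_iff (ha : 2 ≤ a) (hb : 2 ≤ b) (c : ℕ × ℕ) :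
    c ∈ skytCells a i b ↔ ∃ x j, j < size a i b x ∧ cell i b x j = c := by
  obtain ⟨r, c⟩ := c
  simp only [skytCells, Finset.mem_filter, Finset.mem_product, Finset.mem_range]
  constructor
  · rintro ⟨⟨h1, h2⟩, h3, h4⟩
    rcases lt_trichotomy (r + 2) b with h | h | h
    · exact ⟨upper, r, by simp only [size]; omega, by simp [cell, h3 h]⟩
    · exact ⟨top, c, h2, by simp only [cell, Prod.mk.injEq, and_true]; omega⟩
    · rcases Nat.lt_or_ge r b with h' | h'
      · exact ⟨bottom, c, h2, by simp only [cell, Prod.mk.injEq, and_true]; omega⟩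
      · exact ⟨lower, r - b, by simp only [size]; omega, by
          simp only [cell, Prod.mk.injEq]; omega⟩
  · rintro ⟨x, j, hj, h⟩
    cases x <;> simp only [size, cell, Prod.mk.injEq] at hj h <;> omega

theorem cell_inj (hb : 2 ≤ b) {x y : SkytPart} {j k : ℕ} (hj : j < size a i b x)
    (hk : k < size a i b y) (h : cell i b x j = cell i b y k) : x = y ∧ j = k := by
  cases x <;> cases y <;> simp only [size, cell, Prod.mk.injEq] at hj hk h <;>
    first
      | exact ⟨rfl, by omega⟩
      | omega

/-- A filling of the parts of the shape satisfying the conditions of a standard tableau. -/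
structure IsFilling (a i b : ℕ) (G : SkytPart → ℕ → ℕ) : Prop where
  pos : ∀ x, ∀ j < size a i b x, 1 ≤ G x j
  le : ∀ x, ∀ j < size a i b x, G x j ≤ a + b + 2 * i - 2
  inj : ∀ x, ∀ j < size a i b x, ∀ y, ∀ k < size a i b y, G x j = G y k → x = y
  surj : ∀ n, 1 ≤ n → n ≤ a + b + 2 * i - 2 → ∃ x, ∃ j < size a i b x, G x j = n
  mono : ∀ x, ∀ j < size a i b x, ∀ k < j, G x k < G x j
  top_lt_bottom : ∀ j ≤ i, G top j < G bottom j
  upper_lt_top : ∀ j < b - 2, G upper j < G top i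
  bottom_lt_lower : ∀ j < a - 2, G bottom 0 < G lower j

theorem isFilling_of_mem_skytSet (ha : 2 ≤ a) (hb : 2 ≤ b) {f : ℕ × ℕ → ℕ}
    (hf : f ∈ SkytSet a i b) : IsFilling a i b fun x j => f (cell i b x j) := by
  obtain ⟨-, hbij, hrow, hcol⟩ := hf
  have hmem (x j) (hj : j < size a i b x) : cell i b x j ∈ skytCells a i b :=
    (mem_skytCells_iff ha hb _).2 ⟨x, j, hj, rfl⟩
  have hmaps (x j) (hj : j < size a i b x) := Finset.mem_Icc.1 (hbij.mapsTo (hmem x j hj))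
  refine ⟨fun x j hj => (hmaps x j hj).1, fun x j hj => (hmaps x j hj).2, ?_, ?_, ?_, ?_, ?_, ?_⟩
  · intro x j hj y k hk h
    exact (cell_inj hb hj hk (hbij.injOn (hmem x j hj) (hmem y k hk) h)).1
  · intro n h1 h2
    obtain ⟨c, hc, rfl⟩ := hbij.surjOn (Finset.mem_coe.2 (Finset.mem_Icc.2 ⟨h1, h2⟩))
    obtain ⟨x, j, hj, rfl⟩ := (mem_skytCells_iff ha hb _).1 hc
    exact ⟨x, j, hj, rfl⟩
  · intro x j hj k hk
    have h1 := hmem x k (hk.trans hj)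
    have h2 := hmem x j hj
    cases x
    · exact hrow _ h1 _ h2 rfl hk
    · exact hrow _ h1 _ h2 rfl hk
    · exact hcol _ h1 _ h2 rfl hk
    · exact hcol _ h1 _ h2 rfl (by simp only [cell]; omega)
  · intro j hj
    exact hcol _ (hmem top j (by simp only [size]; omega)) _
      (hmem bottom j (by simp only [size]; omega)) rfl (by simp only [cell]; omega)
  · intro j hj
    exact hcol _ (hmem upper j hj) _ (hmem top i (by simp only [size]; omega)) rfl hj
  · intro j hj
    exact hcol _ (hmem bottom 0 (by simp only [size]; omega)) _ (hmem lower j hj) rfl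
      (by simp only [cell]; omega)

theorem IsFilling.mem_skytSet (ha : 2 ≤ a) (hb : 2 ≤ b) (hi : 1 ≤ i) {f : ℕ × ℕ → ℕ}
    {G : SkytPart → ℕ → ℕ} (hG : IsFilling a i b G) (h0 : ∀ c, c ∉ skytCells a i b → f c = 0)
    (hf : ∀ x, ∀ j < size a i b x, f (cell i b x j) = G x j) : f ∈ SkytSet a i b := by
  have htb : G top i < G bottom i := hG.top_lt_bottom i le_rfl
  have htb0 : G top 0 < G bottom 0 := hG.top_lt_bottom 0 (Nat.zero_le _)
  refine ⟨h0, ⟨?_, ?_, ?_⟩, ?_, ?_⟩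
  · intro c hc
    obtain ⟨x, j, hj, rfl⟩ := (mem_skytCells_iff ha hb _).1 hc
    rw [hf x j hj]
    exact Finset.mem_coe.2 (Finset.mem_Icc.2 ⟨hG.pos x j hj, hG.le x j hj⟩)
  · intro c hc d hd h
    obtain ⟨x, j, hj, rfl⟩ := (mem_skytCells_iff ha hb _).1 hc
    obtain ⟨y, k, hk, rfl⟩ := (mem_skytCells_iff ha hb _).1 hd
    rw [hf x j hj, hf y k hk] at h
    obtain rfl := hG.inj x j hj y k hk h
    rcases lt_trichotomy j k with hjk | rfl | hjk
    · exact absurd h (hG.mono x k hk j hjk).ne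
    · rfl
    · exact absurd h (hG.mono x j hj k hjk).ne'
  · intro n hn
    obtain ⟨h1, h2⟩ := Finset.mem_Icc.1 (Finset.mem_coe.1 hn)
    obtain ⟨x, j, hj, h⟩ := hG.surj n h1 h2
    exact ⟨cell i b x j, (mem_skytCells_iff ha hb _).2 ⟨x, j, hj, rfl⟩, by rw [hf x j hj, h]⟩
  · intro c hc d hd hr hlt
    obtain ⟨x, j, hj, rfl⟩ := (mem_skytCells_iff ha hb _).1 hc
    obtain ⟨y, k, hk, rfl⟩ := (mem_skytCells_iff ha hb _).1 hd
    rw [hf x j hj, hf y k hk]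
    cases x <;> cases y <;> simp only [cell, size] at hr hlt hj hk <;>
      first
        | omega
        | exact hG.mono _ _ hk _ hlt
  · intro c hc d hd hr hlt
    obtain ⟨x, j, hj, rfl⟩ := (mem_skytCells_iff ha hb _).1 hc
    obtain ⟨y, k, hk, rfl⟩ := (mem_skytCells_iff ha hb _).1 hd
    rw [hf x j hj, hf y k hk]
    cases x <;> cases y <;> simp only [cell, size] at hr hlt hj hk <;> try omega
    · obtain rfl := hr
      exact hG.top_lt_bottom j (by omega)
    · obtain rfl := hr
      exact htb0.trans (hG.bottom_lt_lower k hk)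
    · obtain rfl := hr
      exact hG.bottom_lt_lower k hk
    · obtain rfl := hr
      exact hG.upper_lt_top j hj
    · obtain rfl := hr
      exact (hG.upper_lt_top j hj).trans htb
    · exact hG.mono _ _ hk _ hlt
    · exact hG.mono _ _ hk _ (by omega)

theorem exists_eq_on_cells (ha : 2 ≤ a) (hb : 2 ≤ b) (G : SkytPart → ℕ → ℕ) :
    ∃ f : ℕ × ℕ → ℕ, (∀ c, c ∉ skytCells a i b → f c = 0) ∧
      ∀ x, ∀ j < size a i b x, f (cell i b x j) = G x j := by
  have h (c : ℕ × ℕ) : ∃ n, (c ∉ skytCells a i b → n = 0) ∧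
      ∀ x, ∀ j < size a i b x, cell i b x j = c → n = G x j := by
    by_cases hc : c ∈ skytCells a i b
    · obtain ⟨x, j, hj, rfl⟩ := (mem_skytCells_iff ha hb _).1 hc
      refine ⟨G x j, fun h => absurd hc h, fun y k hk h => ?_⟩
      obtain ⟨rfl, rfl⟩ := cell_inj hb hk hj h
      rfl
    · refine ⟨0, fun _ => rfl, fun y k hk h => absurd ?_ hc⟩
      exact (mem_skytCells_iff ha hb _).2 ⟨y, k, hk, h⟩
  choose f hf using h
  exact ⟨f, fun c => (hf c).1, fun x j hj => (hf _).2 x j hj rfl⟩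

/-- The word `v` records the part of the shape which contains each entry of the filling `G`. -/
def Records (a i b : ℕ) (G : SkytPart → ℕ → ℕ) (v : List SkytPart) : Prop :=
  ∀ x, ∀ j < size a i b x, v[G x j - 1]? = some x

variable {G : SkytPart → ℕ → ℕ} {v : List SkytPart}

theorem IsFilling.getElem?_eq_iff (hG : IsFilling a i b G) (hv : v.length = a + b + 2 * i - 2)
    (h : Records a i b G v) (x : SkytPart) (k : ℕ) :
    v[k]? = some x ↔ ∃ j < size a i b x, G x j - 1 = k := by
  constructor
  · intro hk
    have hlt : k < v.length := (List.getElem?_eq_some_iff.1 hk).1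
    obtain ⟨y, j, hj, hjk⟩ := hG.surj (k + 1) (by omega) (by omega)
    have h2 := h y j hj
    rw [hjk, Nat.add_sub_cancel, hk, Option.some.injEq] at h2
    subst h2
    exact ⟨j, hj, by omega⟩
  · rintro ⟨j, hj, rfl⟩
    exact h x j hj

theorem IsFilling.strictMonoOn (hG : IsFilling a i b G) (x : SkytPart) :
    StrictMonoOn (fun j => G x j - 1) (Set.Iio (size a i b x)) := by
  intro j hj k hk hjk
  have h1 := hG.mono x k hk j hjk
  have h2 := hG.pos x j hj
  simp only
  omega

theorem IsFilling.eq_nth (hG : IsFilling a i b G) (hv : v.length = a + b + 2 * i - 2)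
    (h : Records a i b G v) {x : SkytPart} {j : ℕ} (hj : j < size a i b x) :
    G x j = Nat.nth (fun k => v[k]? = some x) j + 1 := by
  have h1 := eq_nth_of_strictMonoOn (hG.strictMonoOn x) (hG.getElem?_eq_iff hv h x) hj
  have h2 := hG.pos x j hj
  omega

theorem IsFilling.count_take (hG : IsFilling a i b G) (hv : v.length = a + b + 2 * i - 2)
    (h : Records a i b G v) (x : SkytPart) (n : ℕ) :
    (v.take n).count x = ((Finset.range (size a i b x)).filter fun j => G x j - 1 < n).card := by
  rw [← natCount_getElem?_eq,
    count_eq_card_filter_lt (hG.strictMonoOn x) (hG.getElem?_eq_iff hv h x)]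

theorem IsFilling.count_eq (hG : IsFilling a i b G) (hv : v.length = a + b + 2 * i - 2)
    (h : Records a i b G v) (x : SkytPart) : v.count x = size a i b x := by
  have h1 := hG.count_take hv h x v.length
  rw [List.take_length, Finset.filter_true_of_mem, Finset.card_range] at h1
  · exact h1
  · intro j hj
    have h2 := hG.pos x j (Finset.mem_range.1 hj)
    have h3 := hG.le x j (Finset.mem_range.1 hj)
    omega

theorem IsFilling.mem_partWordSet (hG : IsFilling a i b G)
    (hv : v.length = a + b + 2 * i - 2) (h : Records a i b G v) :
    v ∈ PartWordSet (a + b + 2 * i - 2) (i + 1) (b - 2) := by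
  refine ⟨hv, hG.count_eq hv h top, hG.count_eq hv h upper, hG.count_eq hv h bottom, ?_, ?_, ?_⟩
  · intro k
    rw [hG.count_take hv h, hG.count_take hv h]
    refine Finset.card_le_card fun j hj => ?_
    simp only [size, Finset.mem_filter, Finset.mem_range] at hj ⊢
    have := hG.top_lt_bottom j (by omega)
    omega
  · rw [onesFollowed_map_rank_iff]
    intro k hk
    obtain ⟨j, hj, rfl⟩ := (hG.getElem?_eq_iff hv h _ _).1 hk
    have h1 := hG.upper_lt_top j hj
    have h2 := hG.pos upper j hj
    exact ⟨G top i - 1, by omega, h top i (Nat.lt_succ_self i)⟩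
  · intro k hk
    obtain ⟨j, hj, rfl⟩ := (hG.getElem?_eq_iff hv h _ _).1 hk
    have h1 := hG.bottom_lt_lower j hj
    have h2 := hG.pos bottom 0 (Nat.succ_pos i)
    exact ⟨G bottom 0 - 1, by omega, h bottom 0 (Nat.succ_pos i)⟩

theorem IsFilling.exists_records (hG : IsFilling a i b G) :
    ∃ v : List SkytPart, v.length = a + b + 2 * i - 2 ∧ Records a i b G v := by
  have hex (k : ℕ) : ∃ x, k < a + b + 2 * i - 2 → ∃ j < size a i b x, G x j = k + 1 := by
    by_cases hk : k < a + b + 2 * i - 2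
    · obtain ⟨x, hx⟩ := hG.surj (k + 1) (by omega) (by omega)
      exact ⟨x, fun _ => hx⟩
    · exact ⟨top, fun h => absurd h hk⟩
  choose P hP using hex
  refine ⟨(List.range (a + b + 2 * i - 2)).map P, by simp, fun x j hj => ?_⟩
  have h1 := hG.pos x j hj
  have h2 := hG.le x j hj
  have hlt : G x j - 1 < a + b + 2 * i - 2 := by omega
  obtain ⟨k, hk, hk2⟩ := hP _ hlt
  rw [List.getElem?_map, List.getElem?_range hlt, Option.map_some,
    hG.inj _ k hk x j hj (by omega)]

theorem isFilling_nth (ha : 2 ≤ a) (hb : 2 ≤ b)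
    (hv : v ∈ PartWordSet (a + b + 2 * i - 2) (i + 1) (b - 2)) :
    IsFilling a i b (fun x j => Nat.nth (fun k => v[k]? = some x) j + 1) ∧
      Records a i b (fun x j => Nat.nth (fun k => v[k]? = some x) j + 1) v := by
  obtain ⟨hlen, htop, hupper, hbottom, hballot, hones, hlower⟩ := hv
  rw [onesFollowed_map_rank_iff] at hones
  have hsize (x) : v.count x = size a i b x := by
    have := sum_count_eq_length v
    cases x <;> simp only [size] <;> omega
  have hcount (x) : Nat.count (fun k => v[k]? = some x) v.length = size a i b x := by
    rw [natCount_getElem?_eq, List.take_length, hsize]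
  have hcard (x : SkytPart) (j : ℕ) (hj : j < size a i b x)
      (hf : (Set.ofPred fun k : ℕ => v[k]? = some x).Finite) : j < hf.toFinset.card :=
    (hj.trans_eq (hcount x).symm).trans_le (Nat.count_le_card hf _)
  have hnth (x : SkytPart) (j : ℕ) (hj : j < size a i b x) :
      v[Nat.nth (fun k => v[k]? = some x) j]? = some x :=
    Nat.nth_mem (p := fun k => v[k]? = some x) j (hcard x j hj)
  have hlt (x : SkytPart) (k : ℕ) (hk : v[k]? = some x) :
      Nat.count (fun k => v[k]? = some x) k < size a i b x :=
    (Nat.count_strict_mono (p := fun k => v[k]? = some x) hk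
      (List.getElem?_eq_some_iff.1 hk).1).trans_eq (hcount x)
  refine ⟨⟨fun _ _ _ => by omega, ?_, ?_, ?_, ?_, ?_, ?_, ?_⟩, fun x j hj => hnth x j hj⟩
  · intro x j hj
    have := (List.getElem?_eq_some_iff.1 (hnth x j hj)).1
    omega
  · intro x j hj y k hk h
    have h1 := hnth x j hj
    rw [Nat.succ_injective h, hnth y k hk] at h1
    exact (Option.some.inj h1).symm
  · intro n h1 h2
    have hn : n - 1 < v.length := by omega
    have hx : v[n - 1]? = some v[n - 1] := List.getElem?_eq_getElem hn
    refine ⟨v[n - 1], _, hlt _ _ hx, ?_⟩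
    rw [Nat.nth_count (p := fun k => v[k]? = some v[n - 1]) hx]
    omega
  · intro x j hj k hk
    exact Nat.succ_lt_succ (Nat.nth_lt_nth' hk (hcard x j hj))
  · intro j hj
    have hj' : j < i + 1 := by omega
    have h1 := Nat.count_nth_succ (p := fun k => v[k]? = some bottom) (hcard bottom j hj')
    have h2 := hballot (Nat.nth (fun k => v[k]? = some bottom) j + 1)
    rw [← natCount_getElem?_eq, ← natCount_getElem?_eq, h1] at h2
    have h3 := Nat.nth_lt_of_lt_count h2
    have h4 : Nat.nth (fun k => v[k]? = some top) j ≠ Nat.nth (fun k => v[k]? = some bottom) j := by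
      intro h
      have h5 := hnth top j hj'
      rw [h, hnth bottom j hj'] at h5
      simp at h5
    omega
  · intro j hj
    obtain ⟨k, hk, hk2⟩ := hones _ (hnth upper j hj)
    have h1 := Nat.nth_le_nth' (p := fun k => v[k]? = some top)
      (Nat.le_of_lt_succ (hlt top k hk2)) (hcard top i (Nat.lt_succ_self i))
    rw [Nat.nth_count (p := fun k => v[k]? = some top) hk2] at h1
    omega
  · intro j hj
    obtain ⟨k, hk, hk2⟩ := hlower _ (hnth lower j hj)
    have h1 := Nat.nth_le_nth' (p := fun k => v[k]? = some bottom)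
      (Nat.zero_le (Nat.count (fun k => v[k]? = some bottom) k)) (hcard bottom _ (hlt bottom k hk2))
    rw [Nat.nth_count (p := fun k => v[k]? = some bottom) hk2] at h1
    omega

end SkytPart

theorem nonempty_skytSet_equiv_partWordSet {a b i : ℕ} (ha : 2 ≤ a) (hb : 2 ≤ b) (hi : 1 ≤ i) :
    Nonempty (SkytSet a i b ≃ PartWordSet (a + b + 2 * i - 2) (i + 1) (b - 2)) := by
  refine nonempty_equiv_of_rel (fun f v => f ∈ SkytSet a i b ∧ v.length = a + b + 2 * i - 2 ∧
    Records a i b (fun x j => f (cell i b x j)) v) ?_ ?_ ?_ ?_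
  · intro f hf
    have hG := isFilling_of_mem_skytSet ha hb hf
    obtain ⟨v, hv, h⟩ := hG.exists_records
    exact ⟨v, hG.mem_partWordSet hv h, hf, hv, h⟩
  · intro v hv
    obtain ⟨hG, h⟩ := isFilling_nth ha hb hv
    obtain ⟨f, h0, hf⟩ := exists_eq_on_cells (i := i) ha hb
      fun x j => Nat.nth (fun k => v[k]? = some x) j + 1
    have hmem := hG.mem_skytSet ha hb hi h0 hf
    refine ⟨f, hmem, hmem, hv.1, fun x j hj => ?_⟩
    simp only [hf x j hj]
    exact h x j hj
  · rintro f v v' ⟨hf, hv, h⟩ ⟨-, hv', h'⟩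
    have hG := isFilling_of_mem_skytSet ha hb hf
    refine List.ext_getElem? fun k => Option.ext fun x => ?_
    rw [hG.getElem?_eq_iff hv h, hG.getElem?_eq_iff hv' h']
  · rintro f f' v ⟨hf, hv, h⟩ ⟨hf', -, h'⟩
    funext c
    by_cases hc : c ∈ skytCells a i b
    · obtain ⟨x, j, hj, rfl⟩ := (mem_skytCells_iff ha hb _).1 hc
      exact ((isFilling_of_mem_skytSet ha hb hf).eq_nth hv h hj).trans
        ((isFilling_of_mem_skytSet ha hb hf').eq_nth hv h' hj).symm
    · rw [hf.1 c hc, hf'.1 c hc]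

/-- For all integers `a, b ≥ 2` and `i ≥ 1`, `Skyt(a,i,b)` is in bijection with
`Dyck(a+b+2i-2, i+1, b-2)`. -/
theorem skyt_equiv_dyck (a b i : ℕ) (ha : 2 ≤ a) (hb : 2 ≤ b) (hi : 1 ≤ i) :
    Nonempty (↥(SkytSet a i b) ≃ ↥(DyckSet (a + b + 2 * i - 2) (i + 1) (b - 2))) := by
  obtain ⟨e₁⟩ := nonempty_skytSet_equiv_partWordSet ha hb hi
  obtain ⟨e₂⟩ := nonempty_stepSet_equiv_partWordSet (a + b + 2 * i - 2) (i + 1) (b - 2)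
  exact ⟨e₁.trans (e₂.symm.trans
    ((bijOn_stepWord (a + b + 2 * i - 2) (i + 1) (b - 2)).equiv stepWord))⟩
end

section
/- For all integers a ≥ 2, b ≥ 2 and i ≥ 1, the set Skyt(a,i,b) of skew standard Young tableaux and the set Tri(a+b+2i, i+1, b−2) of triangulations have the same cardinality; that is, there is a bijection between Skyt(a,i,b) and Tri(a+b+2i, i+1, b−2). -/
namespace ArcTri

/-- A set of arcs `(p, q)` with `p + 1 < q` on the vertices `1, …, n` that is non-crossing and
maximal; the arc `(1, n)` closing the polygon is included. -/
def IsMaximalArcs (n : ℕ) (A : Finset (ℕ × ℕ)) : Prop :=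
  (∀ c ∈ A, 1 ≤ c.1 ∧ c.1 + 1 < c.2 ∧ c.2 ≤ n) ∧ (∀ c ∈ A, ∀ d ∈ A, ¬Crosses c d) ∧
    ∀ c : ℕ × ℕ, 1 ≤ c.1 → c.1 + 1 < c.2 → c.2 ≤ n → (∀ d ∈ A, ¬Crosses c d) → c ∈ A

lemma not_crosses_self (c : ℕ × ℕ) : ¬Crosses c c := by
  unfold Crosses; omega

lemma IsMaximalArcs.closing_mem {n : ℕ} {A : Finset (ℕ × ℕ)} (hA : IsMaximalArcs n A)
    (hn : 3 ≤ n) : (1, n) ∈ A := by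
  refine hA.2.2 _ le_rfl (by simp; omega) le_rfl fun d hd => ?_
  have := hA.1 d hd
  unfold Crosses; simp only; omega

lemma isMaximalArcs_insert {n : ℕ} {S : Finset (ℕ × ℕ)} (hn : 3 ≤ n)
    (hS : IsTriangulation n S) : IsMaximalArcs n (insert (1, n) S) := by
  obtain ⟨⟨h1, h2⟩, h3⟩ := hS
  have hb : ∀ c ∈ insert (1, n) S, 1 ≤ c.1 ∧ c.1 + 1 < c.2 ∧ c.2 ≤ n := by
    intro c hc
    rcases Finset.mem_insert.1 hc with rfl | hc
    · simp; omega
    · have := h1 c hc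
      exact ⟨this.1, this.2.1, this.2.2.1⟩
  refine ⟨hb, fun c hc d hd => ?_, fun c hc1 hc2 hc3 hc => ?_⟩
  · have hc' := hb c hc
    have hd' := hb d hd
    rcases Finset.mem_insert.1 hc with rfl | hcS
    · unfold Crosses; simp only; omega
    rcases Finset.mem_insert.1 hd with rfl | hdS
    · unfold Crosses; simp only; omega
    by_cases hcd : c = d
    · exact hcd ▸ not_crosses_self c
    · exact h2 c hcS d hdS hcd
  · by_cases h : c = (1, n)
    · simp [h]
    · refine Finset.mem_insert_of_mem (h3 c ⟨hc1, hc2, hc3, fun h' => h (Prod.ext h'.1 h'.2)⟩ ?_)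
      exact fun d hd => hc d (Finset.mem_insert_of_mem hd)

lemma isTriangulation_erase {n : ℕ} {A : Finset (ℕ × ℕ)} (hA : IsMaximalArcs n A) :
    IsTriangulation n (A.erase (1, n)) := by
  obtain ⟨h1, h2, h3⟩ := hA
  refine ⟨⟨fun c hc => ?_, fun c hc d hd _ => ?_⟩, fun c hc hcr => ?_⟩
  · rw [Finset.mem_erase] at hc
    obtain ⟨a, b, d⟩ := h1 c hc.2
    exact ⟨a, b, d, fun h => hc.1 (Prod.ext h.1 h.2)⟩
  · exact h2 c (Finset.mem_of_mem_erase hc) d (Finset.mem_of_mem_erase hd)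
  · obtain ⟨a, b, d, e⟩ := hc
    refine Finset.mem_erase.2 ⟨fun h => e (by simp [h]), h3 c a b d fun x hx => ?_⟩
    by_cases hx1 : x = (1, n)
    · subst hx1; unfold Crosses; simp only; omega
    · exact hcr x (Finset.mem_erase.2 ⟨hx1, hx⟩)

lemma closing_notMem {n : ℕ} {S : Finset (ℕ × ℕ)} (hS : IsTriangulation n S) : (1, n) ∉ S :=
  fun h => (hS.1.1 _ h).2.2.2 ⟨rfl, rfl⟩

/-- `Linked A p q`: `p < q` are joined by an arc of `A` or by a side. -/
def Linked (A : Finset (ℕ × ℕ)) (p q : ℕ) : Prop := q = p + 1 ∨ (p, q) ∈ A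

/-- The number of arcs of `A` that start at `p` and end at most at `w`. -/
def degUpTo (A : Finset (ℕ × ℕ)) (p w : ℕ) : ℕ := (A.filter fun c => c.1 = p ∧ c.2 ≤ w).card

/-- The number of arcs of `A` that start at `p`. -/
def outDeg (A : Finset (ℕ × ℕ)) (p : ℕ) : ℕ := (A.filter fun c => c.1 = p).card

lemma degUpTo_eq_outDeg {A : Finset (ℕ × ℕ)} {p w : ℕ} (h : ∀ y, (p, y) ∈ A → y ≤ w) :
    degUpTo A p w = outDeg A p := by
  unfold degUpTo outDeg
  congr 1
  ext ⟨x, y⟩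
  simp only [Finset.mem_filter]
  constructor
  · tauto
  · rintro ⟨h1, rfl⟩
    exact ⟨h1, rfl, h y h1⟩

lemma degUpTo_congr {A : Finset (ℕ × ℕ)} {p w w' : ℕ}
    (h : ∀ y, (p, y) ∈ A → (y ≤ w ↔ y ≤ w')) : degUpTo A p w = degUpTo A p w' := by
  unfold degUpTo
  congr 1
  ext ⟨x, y⟩
  simp only [Finset.mem_filter]
  constructor <;>
  · rintro ⟨h1, rfl, h2⟩
    have := h y h1
    tauto

namespace IsMaximalArcs

variable {n : ℕ} {A : Finset (ℕ × ℕ)}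

lemma le_of_mem_between (hA : IsMaximalArcs n A) {p w m y : ℕ} (hpw : (p, w) ∈ A) (hpm : p < m)
    (hmw : m < w) (hy : (m, y) ∈ A) : y ≤ w := by
  by_contra h
  refine hA.2.1 _ hpw _ hy ?_
  unfold Crosses; simp only; omega

lemma linked_consecutive (hA : IsMaximalArcs n A) {p m w : ℕ} (hpm : p < m) (hmw : m < w)
    (hm : Linked A p m) (hw : (p, w) ∈ A) (hgap : ∀ y, (p, y) ∈ A → ¬(m < y ∧ y < w)) :
    Linked A m w := by
  by_cases h : w = m + 1
  · exact Or.inl h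
  have hw' := hA.1 _ hw
  simp only at hw'
  refine Or.inr (hA.2.2 _ (by simp only; omega) (by simp only; omega) hw'.2.2 ?_)
  rintro ⟨x, y⟩ hxy hc
  have h1 := hA.1 _ hxy
  have h2 := hA.2.1 _ hw _ hxy
  have h3 : x = p → ¬(m < y ∧ y < w) := by rintro rfl; exact hgap y hxy
  rcases hm with hm | hm
  · unfold Crosses at *; simp only at *; omega
  · have h4 := hA.2.1 _ hm _ hxy
    unfold Crosses at *; simp only at *; omega

lemma exists_previous (hA : IsMaximalArcs n A) {p w : ℕ} (hw : (p, w) ∈ A) :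
    ∃ m, p < m ∧ m < w ∧ Linked A p m ∧ Linked A m w ∧ degUpTo A p w = degUpTo A p m + 1 := by
  have hw' := hA.1 _ hw
  simp only at hw'
  classical
  let F := (Finset.Ioo p w).filter fun y => Linked A p y
  have hF : F.Nonempty :=
    ⟨p + 1, Finset.mem_filter.2 ⟨Finset.mem_Ioo.2 (by omega), Or.inl rfl⟩⟩
  obtain ⟨m, hm, hmax⟩ : ∃ m ∈ F, ∀ y ∈ F, y ≤ m := ⟨_, F.max'_mem hF, F.le_max'⟩
  simp only [F, Finset.mem_filter, Finset.mem_Ioo] at hm hmax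
  have hgap : ∀ y, (p, y) ∈ A → ¬(m < y ∧ y < w) := fun y hy h => by
    have := hmax y ⟨⟨by omega, h.2⟩, Or.inr hy⟩
    omega
  refine ⟨m, hm.1.1, hm.1.2, hm.2, hA.linked_consecutive hm.1.1 hm.1.2 hm.2 hw hgap, ?_⟩
  have : (A.filter fun c => c.1 = p ∧ c.2 ≤ w) =
      insert (p, w) (A.filter fun c => c.1 = p ∧ c.2 ≤ m) := by
    ext ⟨x, y⟩
    simp only [Finset.mem_filter, Finset.mem_insert, Prod.mk.injEq]
    constructor
    · rintro ⟨h1, rfl, h2⟩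
      have := hgap y h1
      by_cases y = w
      · tauto
      · exact Or.inr ⟨h1, rfl, by omega⟩
    · rintro (⟨rfl, rfl⟩ | ⟨h1, rfl, h2⟩)
      · exact ⟨hw, rfl, le_rfl⟩
      · exact ⟨h1, rfl, by omega⟩
  unfold degUpTo
  rw [this, Finset.card_insert_of_notMem]
  simp only [Finset.mem_filter]
  omega

end IsMaximalArcs

/-- The height `∑_{v ≤ m} (u v - 1)` of a sequence after `m` steps. -/
def height (u : ℕ → ℕ) (m : ℕ) : ℤ := (∑ v ∈ Finset.Icc 1 m, (u v : ℤ)) - m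

lemma height_zero (u : ℕ → ℕ) : height u 0 = 0 := by simp [height]

lemma height_succ (u : ℕ → ℕ) (m : ℕ) : height u (m + 1) = height u m + u (m + 1) - 1 := by
  unfold height
  rw [Finset.sum_Icc_succ_top (by omega)]
  push_cast; ring

lemma height_pred (u : ℕ → ℕ) {m : ℕ} (hm : 1 ≤ m) :
    height u (m - 1) = height u m - u m + 1 := by
  obtain ⟨k, rfl⟩ : ∃ k, m = k + 1 := ⟨m - 1, by omega⟩
  rw [height_succ, Nat.add_sub_cancel]; ring

namespace IsMaximalArcs

variable {n : ℕ} {A : Finset (ℕ × ℕ)}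

lemma height_of_linked (hA : IsMaximalArcs n A) {v w : ℕ} (hv : 1 ≤ v) (hvw : v < w)
    (h : Linked A v w) :
    height (outDeg A) (w - 1) = height (outDeg A) v - degUpTo A v w ∧
      ∀ x, v ≤ x → x + 1 < w → height (outDeg A) (w - 1) < height (outDeg A) x := by
  induction hk : w - v using Nat.strong_induction_on generalizing v w with
  | _ k ih =>
  by_cases hw : w = v + 1
  · subst hw
    refine ⟨?_, fun x _ _ => by omega⟩
    have : degUpTo A v (v + 1) = 0 := by
      unfold degUpTo
      rw [Finset.card_eq_zero, Finset.filter_eq_empty_iff]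
      intro c hc
      have := hA.1 c hc
      omega
    simp [this]
  · have hmem : (v, w) ∈ A := h.resolve_left hw
    obtain ⟨m, hvm, hmw, h1, h2, hdeg⟩ := hA.exists_previous hmem
    obtain ⟨e1, l1⟩ := ih (m - v) (by omega) hv hvm h1 rfl
    obtain ⟨e2, l2⟩ := ih (w - m) (by omega) (by omega) hmw h2 rfl
    rw [degUpTo_eq_outDeg fun y hy => hA.le_of_mem_between hmem hvm hmw hy] at e2
    have e3 := height_pred (outDeg A) (m := m) (by omega)
    refine ⟨by rw [hdeg]; push_cast; omega, fun x hx hxw => ?_⟩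
    rcases lt_trichotomy x (m - 1) with hlt | heq | hgt
    · have := l1 x hx (by omega)
      omega
    · subst heq; omega
    · exact l2 x (by omega) hxw

lemma outDeg_eq_zero (hA : IsMaximalArcs n A) {v : ℕ} (hv : v = 0 ∨ n ≤ v + 1) :
    outDeg A v = 0 := by
  unfold outDeg
  rw [Finset.card_eq_zero, Finset.filter_eq_empty_iff]
  intro c hc
  have := hA.1 c hc
  omega

lemma height_last (hA : IsMaximalArcs n A) (hn : 3 ≤ n) : height (outDeg A) (n - 1) = -1 := by
  have h := (hA.height_of_linked le_rfl (by omega) (Or.inr (hA.closing_mem hn))).1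
  rw [degUpTo_eq_outDeg fun y hy => (hA.1 _ hy).2.2] at h
  have := height_pred (outDeg A) (m := 1) le_rfl
  simp only [Nat.sub_self, height_zero] at this
  omega

lemma height_nonneg (hA : IsMaximalArcs n A) (hn : 3 ≤ n) {m : ℕ} (hm : m + 2 ≤ n) :
    0 ≤ height (outDeg A) m := by
  rcases Nat.eq_zero_or_pos m with rfl | h0
  · simp [height_zero]
  have := (hA.height_of_linked le_rfl (by omega) (Or.inr (hA.closing_mem hn))).2 m h0 (by omega)
  rw [hA.height_last hn] at this
  omega

lemma height_end (hA : IsMaximalArcs n A) (hn : 3 ≤ n) : height (outDeg A) (n - 2) = 0 := by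
  have h1 := hA.height_last hn
  have h2 := height_pred (outDeg A) (m := n - 1) (by omega)
  rw [hA.outDeg_eq_zero (by omega), h1] at h2
  simpa [Nat.sub_sub] using h2

end IsMaximalArcs

/-- The arcs determined by the heights of a sequence. -/
noncomputable def arcsOf (n : ℕ) (u : ℕ → ℕ) : Finset (ℕ × ℕ) := by
  classical
  exact (Finset.Icc 1 n ×ˢ Finset.Icc 1 n).filter fun c => c.1 + 1 < c.2 ∧
    height u (c.1 - 1) - 1 ≤ height u (c.2 - 1) ∧
    ∀ x, c.1 ≤ x → x + 1 < c.2 → height u (c.2 - 1) < height u x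

lemma mem_arcsOf {n : ℕ} {u : ℕ → ℕ} {v w : ℕ} : (v, w) ∈ arcsOf n u ↔
    1 ≤ v ∧ v + 1 < w ∧ w ≤ n ∧ height u (v - 1) - 1 ≤ height u (w - 1) ∧
      ∀ x, v ≤ x → x + 1 < w → height u (w - 1) < height u x := by
  simp only [arcsOf, Finset.mem_filter, Finset.mem_product, Finset.mem_Icc]
  constructor
  · rintro ⟨h1, h2, h3⟩
    exact ⟨h1.1.1, h2, h1.2.2, h3⟩
  · rintro ⟨h1, h2, h3, h4⟩
    exact ⟨⟨⟨h1, by omega⟩, by omega, h3⟩, h2, h4⟩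

lemma arcsOf_not_crosses {n : ℕ} {u : ℕ → ℕ} {p q r s : ℕ} (h1 : (p, q) ∈ arcsOf n u)
    (h2 : (r, s) ∈ arcsOf n u) (hpr : p < r) (hrq : r < q) (hqs : q < s) : False := by
  rw [mem_arcsOf] at h1 h2
  have e1 := h2.2.2.2.2 (q - 1) (by omega) (by omega)
  have e2 := h1.2.2.2.2 (r - 1) (by omega) (by omega)
  omega

/-- A sequence whose steps are at least `-1` attains every intermediate lower level, for the
first time. -/
lemma exists_first_level (u : ℕ → ℕ) {v e : ℕ} {k : ℤ} (hve : v ≤ e) (hv : k < height u v)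
    (he : height u e ≤ k) :
    ∃ w, v < w ∧ w ≤ e ∧ height u w = k ∧ ∀ x, v ≤ x → x < w → k < height u x := by
  classical
  have hex : ∃ w, v ≤ w ∧ height u w ≤ k := ⟨e, hve, he⟩
  obtain ⟨hw1, hw2⟩ := Nat.find_spec hex
  have hmin : ∀ x, v ≤ x → x < Nat.find hex → k < height u x := fun x hx hlt => by
    have := Nat.find_min hex hlt
    push Not at this
    exact this hx
  have hle : Nat.find hex ≤ e := Nat.find_min' hex ⟨hve, he⟩
  set w := Nat.find hex
  have hvw : v < w := lt_of_le_of_ne hw1 fun h => by rw [← h] at hw2; omega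
  refine ⟨w, hvw, hle, le_antisymm hw2 ?_, hmin⟩
  have e1 := hmin (w - 1) (by omega) (by omega)
  have e2 := height_pred u (m := w) (by omega)
  omega

section arcsOf

variable {n : ℕ} {u : ℕ → ℕ}

lemma outDeg_arcsOf (hend : height u (n - 1) = -1)
    (hnonneg : ∀ m, m + 2 ≤ n → 0 ≤ height u m) {v : ℕ} (hv : 1 ≤ v) (hvn : v + 2 ≤ n) :
    outDeg (arcsOf n u) v = u v := by
  have e0 := height_pred u hv
  have h0 := hnonneg (v - 1) (by omega)
  have : outDeg (arcsOf n u) v = (Finset.Ico (height u (v - 1) - 1) (height u v)).card := by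
    unfold outDeg
    refine Finset.card_bij (fun c _ => height u (c.2 - 1)) ?_ ?_ ?_
    · rintro ⟨x, w⟩ hc
      simp only [Finset.mem_filter] at hc
      obtain ⟨hc, rfl⟩ := hc
      rw [mem_arcsOf] at hc
      simp only [Finset.mem_Ico]
      exact ⟨hc.2.2.2.1, hc.2.2.2.2 x le_rfl hc.2.1⟩
    · rintro ⟨x, w⟩ hc ⟨x', w'⟩ hc' h
      simp only [Finset.mem_filter] at hc hc' h
      obtain ⟨hc, rfl⟩ := hc
      obtain ⟨hc', rfl⟩ := hc'
      rw [mem_arcsOf] at hc hc'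
      rcases lt_trichotomy w w' with hlt | rfl | hlt
      · have := hc'.2.2.2.2 (w - 1) (by omega) (by omega)
        omega
      · rfl
      · have := hc.2.2.2.2 (w' - 1) (by omega) (by omega)
        omega
    · intro k hk
      rw [Finset.mem_Ico] at hk
      obtain ⟨w, h1, h2, h3, h4⟩ := exists_first_level u (v := v) (e := n - 1) (k := k)
        (by omega) hk.2 (by omega)
      refine ⟨(v, w + 1), ?_, by simpa using h3⟩
      simp only [Finset.mem_filter, mem_arcsOf, and_true]
      simp only [Nat.add_sub_cancel, h3]
      exact ⟨hv, by omega, by omega, hk.1, fun x hx hxw => h4 x hx (by omega)⟩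
  rw [this, Int.card_Ico]
  omega

lemma arcsOf_maximal (hend : height u (n - 1) = -1)
    (hnonneg : ∀ m, m + 2 ≤ n → 0 ≤ height u m) : IsMaximalArcs n (arcsOf n u) := by
  refine ⟨?_, ?_, ?_⟩
  · rintro ⟨v, w⟩ h
    rw [mem_arcsOf] at h
    exact ⟨h.1, h.2.1, h.2.2.1⟩
  · rintro ⟨p, q⟩ h1 ⟨r, s⟩ h2 (h | h)
    · exact arcsOf_not_crosses h1 h2 h.1 h.2.1 h.2.2
    · exact arcsOf_not_crosses h2 h1 h.1 h.2.1 h.2.2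
  · rintro ⟨p, q⟩ hp hpq hq hcr
    simp only at hp hpq hq
    rw [mem_arcsOf]
    refine ⟨hp, hpq, hq, ?_, ?_⟩
    · by_contra! hlt
      obtain ⟨w, h1, h2, h3, h4⟩ := exists_first_level u (v := p - 1) (e := q - 1)
        (k := height u (p - 1) - 1) (by omega) (by omega) (by omega)
      have hwq : w ≠ q - 1 := fun h => by subst h; omega
      have hp1 : p ≠ 1 := by
        rintro rfl
        have := hnonneg w (by omega)
        simp [height_zero] at h3
        omega
      classical
      let F := (Finset.Icc 1 (p - 1)).filter fun r => height u (r - 1) ≤ height u (p - 1)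
      have hF : F.Nonempty := ⟨1, by
        simp only [F, Finset.mem_filter, Finset.mem_Icc, Nat.sub_self, height_zero]
        exact ⟨by omega, hnonneg _ (by omega)⟩⟩
      obtain ⟨r, hm, hmax⟩ : ∃ m ∈ F, ∀ y ∈ F, y ≤ m := ⟨_, F.max'_mem hF, F.le_max'⟩
      simp only [F, Finset.mem_filter, Finset.mem_Icc] at hm hmax
      refine hcr (r, w + 1) (mem_arcsOf.2 ?_) ?_
      · simp only [Nat.add_sub_cancel]
        refine ⟨hm.1.1, by omega, by omega, by omega, fun x hx hxw => ?_⟩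
        by_cases hxp : x < p - 1
        · by_contra! hle
          have := hmax (x + 1) ⟨by omega, by simp; omega⟩
          omega
        · have := h4 x (by omega) (by omega)
          omega
      · unfold Crosses; simp only; omega
    · by_contra! hex
      obtain ⟨x, hpx, hxq, hle⟩ := hex
      obtain ⟨z, hz, hzmin⟩ := Finset.exists_min_image (Finset.Ico p (q - 1)) (height u)
        ⟨x, Finset.mem_Ico.2 ⟨hpx, by omega⟩⟩
      have hzx := hzmin x (Finset.mem_Ico.2 ⟨hpx, by omega⟩)
      simp only [Finset.mem_Ico] at hz hzmin
      have hz0 := hnonneg z (by omega)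
      obtain ⟨w, h1, h2, h3, h4⟩ := exists_first_level u (v := z) (e := n - 1)
        (k := height u z - 1) (by omega) (by omega) (by omega)
      have hw : q - 1 < w := by
        by_contra! hwq
        rcases hwq.lt_or_eq with h | rfl
        · have := hzmin w ⟨by omega, h⟩
          omega
        · omega
      refine hcr (z + 1, w + 1) (mem_arcsOf.2 ?_) ?_
      · simp only [Nat.add_sub_cancel]
        exact ⟨by omega, by omega, by omega, by omega, fun y hy hyw => by
          have := h4 y (by omega) (by omega)
          omega⟩
      · unfold Crosses; simp only; omega

end arcsOf

lemma degUpTo_le_outDeg (A : Finset (ℕ × ℕ)) (p w : ℕ) : degUpTo A p w ≤ outDeg A p :=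
  Finset.card_le_card fun c hc => by
    simp only [Finset.mem_filter] at hc ⊢
    exact ⟨hc.1, hc.2.1⟩

namespace IsMaximalArcs

variable {n : ℕ} {A : Finset (ℕ × ℕ)}

lemma subset_arcsOf (hA : IsMaximalArcs n A) : A ⊆ arcsOf n (outDeg A) := by
  rintro ⟨v, w⟩ h
  obtain ⟨h1, h2, h3⟩ := hA.1 _ h
  simp only at h1 h2 h3
  obtain ⟨e1, l1⟩ := hA.height_of_linked h1 (by omega) (Or.inr h)
  have := degUpTo_le_outDeg A v w
  have := height_pred (outDeg A) h1
  exact mem_arcsOf.2 ⟨h1, h2, h3, by omega, l1⟩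

lemma eq_arcsOf (hA : IsMaximalArcs n A) (hn : 3 ≤ n) : A = arcsOf n (outDeg A) := by
  refine Finset.Subset.antisymm hA.subset_arcsOf ?_
  rintro ⟨v, w⟩ h
  have h' := mem_arcsOf.1 h
  have hd := outDeg_arcsOf (hA.height_last hn) (fun m hm => hA.height_nonneg hn hm) h'.1
    (show v + 2 ≤ n by omega)
  have := Finset.eq_of_subset_of_card_le
    (Finset.filter_subset_filter (fun c : ℕ × ℕ => c.1 = v) hA.subset_arcsOf) hd.le
  have hm : (v, w) ∈ (arcsOf n (outDeg A)).filter fun c => c.1 = v := by simp [h]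
  rw [← this] at hm
  exact (Finset.mem_filter.1 hm).1

end IsMaximalArcs

lemma mem_zip_tail_of_sortedLT : ∀ {l : List ℕ} {x y : ℕ}, l.Pairwise (· < ·) →
    (x, y) ∈ l.zip l.tail → x ∈ l ∧ y ∈ l.tail ∧ x < y ∧ ∀ z ∈ l, ¬(x < z ∧ z < y)
  | [], _, _, _, h => by simp at h
  | [_], _, _, _, h => by simp at h
  | a :: b :: l, x, y, hl, h => by
    simp only [List.tail_cons, List.zip_cons_cons, List.mem_cons, Prod.mk.injEq] at h
    have hl' := List.pairwise_cons.1 hl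
    have hl2 := List.pairwise_cons.1 hl'.2
    rcases h with ⟨rfl, rfl⟩ | h
    · refine ⟨by simp, by simp, hl'.1 _ (by simp), fun z hz => ?_⟩
      simp only [List.mem_cons] at hz
      rcases hz with rfl | rfl | hz
      · omega
      · omega
      · have := hl2.1 z hz
        omega
    · obtain ⟨h1, h2, h3, h4⟩ := mem_zip_tail_of_sortedLT hl'.2 h
      refine ⟨List.mem_cons_of_mem _ h1, by simp at h2 ⊢; tauto, h3, fun z hz => ?_⟩
      rcases List.mem_cons.1 hz with rfl | hz
      · have := hl'.1 x h1
        omega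
      · exact h4 z hz

lemma flatMap_range'_zip_tail : ∀ (l : List ℕ) (a r : ℕ), (a :: (l ++ [r])).Pairwise (· < ·) →
    ((a :: (l ++ [r])).zip (l ++ [r])).flatMap (fun q => List.range' q.1 (q.2 - q.1)) =
      List.range' a (r - a)
  | [], a, r, _ => by simp
  | b :: l, a, r, h => by
    have h' := List.pairwise_cons.1 h
    have ih := flatMap_range'_zip_tail l b r h'.2
    have hab := h'.1 b (by simp)
    have hbr : b < r := (List.pairwise_cons.1 h'.2).1 r (by simp)
    simp only [List.cons_append, List.zip_cons_cons, List.flatMap_cons, ih]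
    have := List.range'_append_1 (s := a) (m := b - a) (n := r - b)
    rw [show a + (b - a) = b by omega, show b - a + (r - b) = r - a by omega] at this
    exact this

lemma fanListAux_side (S : Finset (ℕ × ℕ)) (k p : ℕ) : fanListAux S k p (p + 1) = [] := by
  cases k <;> simp [fanListAux]

/-- The list of pairs `(v, d v)` with `d v ≠ 0`, for `v = p, …, r - 1`. -/
def supportList (d : ℕ → ℕ) (p r : ℕ) : List (ℕ × ℕ) :=
  ((List.range' p (r - p)).filter fun v => d v ≠ 0).map fun v => (v, d v)

lemma supportList_congr {d d' : ℕ → ℕ} {p r : ℕ} (h : ∀ v, p ≤ v → v < r → d v = d' v) :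
    supportList d p r = supportList d' p r := by
  unfold supportList
  have hmem : ∀ v ∈ List.range' p (r - p), d v = d' v := fun v hv => by
    rw [List.mem_range'_1] at hv
    exact h v hv.1 (by omega)
  rw [List.filter_congr (q := fun v => decide (d' v ≠ 0)) fun v hv => by rw [hmem v hv]]
  exact List.map_congr_left fun v hv => by rw [hmem v (List.mem_filter.1 hv).1]

lemma fanListAux_eq {n : ℕ} {S : Finset (ℕ × ℕ)} (hA : IsMaximalArcs n (insert (1, n) S)) :
    ∀ k p r, r ≤ p + k → 1 ≤ p → p < r → r ≤ n → Linked (insert (1, n) S) p r →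
      fanListAux S k p r = supportList (fun v => degUpTo (insert (1, n) S) v r) p r := by
  set A := insert (1, n) S with hAS
  intro k
  induction k with
  | zero => intro p r h1 _ h2; omega
  | succ k ih =>
    intro p r hk hp hpr hrn hlink
    by_cases hside : r = p + 1
    · subst hside
      have : degUpTo A p (p + 1) = 0 := by
        unfold degUpTo
        rw [Finset.card_eq_zero, Finset.filter_eq_empty_iff]
        intro c hc
        have := hA.1 c hc
        omega
      simp [fanListAux_side, supportList, this]
    have harc : (p, r) ∈ A := hlink.resolve_left hside
    rw [fanListAux, if_neg (by omega)]
    simp only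
    set W := (S.filter fun c => c.1 = p ∧ p + 1 < c.2 ∧ c.2 < r).image Prod.snd with hW
    have memW : ∀ y, y ∈ W ↔ (p, y) ∈ A ∧ y < r := by
      intro y
      simp only [hW, Finset.mem_image, Finset.mem_filter, Prod.exists, exists_eq_right, hAS,
        Finset.mem_insert, Prod.mk.injEq]
      constructor
      · rintro ⟨x, h1, rfl, h2, h3⟩
        exact ⟨Or.inr h1, h3⟩
      · rintro ⟨h1 | h1, h2⟩
        · omega
        · have := hA.1 (p, y) (Finset.mem_insert_of_mem h1)
          exact ⟨p, h1, rfl, this.2.1, h2⟩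
    have hlt : ∀ y ∈ W, p + 1 < y ∧ y < r := fun y hy =>
      ⟨(hA.1 _ ((memW y).1 hy).1).2.1, ((memW y).1 hy).2⟩
    have hdeg : degUpTo A p r = W.card + 1 := by
      have : (A.filter fun c => c.1 = p ∧ c.2 ≤ r) = (insert r W).image fun y => (p, y) := by
        ext ⟨x, y⟩
        simp only [Finset.mem_filter, Finset.mem_image, Finset.mem_insert, Prod.mk.injEq, memW]
        constructor
        · rintro ⟨h1, rfl, h2⟩
          refine ⟨y, ?_, rfl, rfl⟩
          by_cases y = r
          · tauto
          · exact Or.inr ⟨h1, by omega⟩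
        · rintro ⟨y', h | h, rfl, rfl⟩
          · exact ⟨h ▸ harc, rfl, h.le⟩
          · exact ⟨h.1, rfl, h.2.le⟩
      unfold degUpTo
      rw [this, Finset.card_image_of_injective _ (Prod.mk_right_injective p),
        Finset.card_insert_of_notMem fun h => (hlt r h).2.false]
    set ws := W.sort (· ≤ ·) with hws
    have memws : ∀ y, y ∈ ws ↔ y ∈ W := fun y => Finset.mem_sort _
    have hsorted : ((p + 1) :: (ws ++ [r])).Pairwise (· < ·) := by
      rw [List.pairwise_cons, List.pairwise_append]
      refine ⟨fun y hy => ?_, Finset.sortedLT_sort W |>.pairwise, by simp, fun x hx y hy => ?_⟩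
      · rcases List.mem_append.1 hy with h | h
        · exact (hlt y ((memws y).1 h)).1
        · simp at h; omega
      · simp at hy
        exact hy ▸ (hlt x ((memws x).1 hx)).2
    have hflat : (((p + 1) :: (ws ++ [r])).zip ((p + 1) :: (ws ++ [r])).tail).flatMap
        (fun q => fanListAux S k q.1 q.2) = supportList (fun v => degUpTo A v r) (p + 1) r := by
      have hstep : ∀ q ∈ ((p + 1) :: (ws ++ [r])).zip ((p + 1) :: (ws ++ [r])).tail,
          fanListAux S k q.1 q.2 = supportList (fun v => degUpTo A v r) q.1 q.2 := by
        rintro ⟨x, y⟩ hq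
        obtain ⟨h1, h2, h3, h4⟩ := mem_zip_tail_of_sortedLT hsorted hq
        simp only [List.tail_cons, List.mem_append, memws, List.mem_singleton] at h2
        simp only [List.mem_cons, List.mem_append, memws, List.not_mem_nil, or_false] at h1 h4
        have hy : (p, y) ∈ A ∧ y ≤ r := by
          rcases h2 with h | rfl
          · exact ⟨((memW y).1 h).1, ((memW y).1 h).2.le⟩
          · exact ⟨harc, le_rfl⟩
        have hx : Linked A p x ∧ p < x := by
          rcases h1 with rfl | h | rfl
          · exact ⟨Or.inl rfl, by omega⟩
          · exact ⟨Or.inr ((memW x).1 h).1, by have := hlt x h; omega⟩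
          · omega
        have hxy : Linked A x y := by
          refine hA.linked_consecutive hx.2 h3 hx.1 hy.1 fun z hz => ?_
          intro hxzy
          exact h4 z (Or.inr (Or.inl ((memW z).2 ⟨hz, by omega⟩))) hxzy
        simp only
        rw [ih x y (by omega) (by omega) h3 (by omega) hxy]
        refine supportList_congr fun v hv1 hv2 => degUpTo_congr fun z hz => ?_
        have := hA.le_of_mem_between hy.1 (by omega) hv2 hz
        exact ⟨fun _ => by omega, fun _ => this⟩
      have hfl := flatMap_range'_zip_tail ws (p + 1) r hsorted
      rw [List.flatMap_congr hstep]
      unfold supportList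
      rw [← hfl, List.filter_flatMap, List.map_flatMap]
      rfl
    rw [hflat, hws, Finset.length_sort, ← hdeg]
    conv_rhs => unfold supportList
    rw [show r - p = (r - (p + 1)) + 1 by omega, List.range'_succ, List.filter_cons_of_pos]
    · rfl
    · simp [hdeg]

lemma fanList_eq {n : ℕ} {S : Finset (ℕ × ℕ)} (hn : 3 ≤ n) (hS : IsTriangulation n S) :
    fanList S 1 n = supportList (outDeg (insert (1, n) S)) 1 n := by
  have hA := isMaximalArcs_insert hn hS
  unfold fanList
  rw [fanListAux_eq hA (n - 1) 1 n (by omega) le_rfl (by omega) le_rfl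
    (Or.inr (Finset.mem_insert_self _ _))]
  exact supportList_congr fun v _ _ => degUpTo_eq_outDeg fun y hy => (hA.1 _ hy).2.2

/-- Sequences supported on `1, …, N`, of total `N`, whose partial sums dominate the identity, with
`t` entries at least `2`, with `s` entries equal to `1`, and no `1` after the last entry at
least `2`. -/
def LukSet (N t s : ℕ) : Set (ℕ → ℕ) :=
  {u | (∀ v, v ∉ Finset.Icc 1 N → u v = 0) ∧ height u N = 0 ∧ (∀ m ≤ N, 0 ≤ height u m) ∧
    ((Finset.Icc 1 N).filter fun v => 2 ≤ u v).card = t ∧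
    ((Finset.Icc 1 N).filter fun v => u v = 1).card = s ∧
    ∀ v, u v = 1 → ∃ w, v < w ∧ 2 ≤ u w}

lemma supportList_length (d : ℕ → ℕ) (p r : ℕ) :
    (supportList d p r).length = ((Finset.Ico p r).filter fun v => d v ≠ 0).card := by
  unfold supportList
  rw [List.length_map]
  rw [← List.toFinset_card_of_nodup ((List.nodup_range').filter _)]
  congr 1
  ext v
  simp [List.mem_range'_1]
  omega

lemma supportList_length_filter (d : ℕ → ℕ) (p r : ℕ) :
    ((supportList d p r).filter fun fan => decide (fan.2 = 1)).length =
      ((Finset.Ico p r).filter fun v => d v = 1).card := by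
  unfold supportList
  rw [List.filter_map, List.length_map, List.filter_filter]
  rw [← List.toFinset_card_of_nodup ((List.nodup_range').filter _)]
  congr 1
  ext v
  simp [List.mem_range'_1]
  omega

lemma supportList_getLast_ne_one (d : ℕ → ℕ) (p r : ℕ) :
    ((supportList d p r).getLastD (0, 0)).2 ≠ 1 ↔
      ∀ v, p ≤ v → v < r → d v = 1 → ∃ w, v < w ∧ w < r ∧ 2 ≤ d w := by
  induction h : r - p generalizing r with
  | zero =>
    have : supportList d p r = [] := by simp [supportList, h]
    simp only [this]
    simp
    intro v _ _; omega
  | succ k ih =>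
    have hs : supportList d p r =
        supportList d p (r - 1) ++ if d (r - 1) ≠ 0 then [(r - 1, d (r - 1))] else [] := by
      unfold supportList
      rw [show r - p = (r - 1 - p) + 1 by omega, List.range'_1_concat, List.filter_append,
        List.map_append, show p + (r - 1 - p) = r - 1 by omega]
      congr 1
      by_cases h0 : d (r - 1) = 0 <;> simp [h0]
    rw [hs]
    by_cases h0 : d (r - 1) = 0
    · simp only [h0, ne_eq, not_true_eq_false, if_false, List.append_nil]
      rw [← ne_eq, ih (r - 1) (by omega)]
      constructor
      · intro H v hv1 hv2 hv
        have : v ≠ r - 1 := by rintro rfl; omega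
        obtain ⟨w, h1, h2, h3⟩ := H v hv1 (by omega) hv
        exact ⟨w, h1, by omega, h3⟩
      · intro H v hv1 hv2 hv
        obtain ⟨w, h1, h2, h3⟩ := H v hv1 (by omega) hv
        have : w ≠ r - 1 := by rintro rfl; omega
        exact ⟨w, h1, by omega, h3⟩
    · rw [if_pos h0, List.getLastD_concat]
      simp only
      constructor
      · intro H v hv1 hv2 hv
        have : v ≠ r - 1 := by rintro rfl; exact H hv
        exact ⟨r - 1, by omega, by omega, by omega⟩
      · intro H h1
        obtain ⟨w, h2, h3, _⟩ := H (r - 1) (by omega) (by omega) h1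
        omega

/-- The numeric conditions in `TriSet` read off from the out-degrees. -/
lemma fanList_conditions_iff {N t s : ℕ} {d : ℕ → ℕ} (hd : ∀ v, v ∉ Finset.Icc 1 N → d v = 0) :
    ((supportList d 1 (N + 2)).length = t + s ∧
      ((supportList d 1 (N + 2)).filter fun fan => decide (fan.2 = 1)).length = s ∧
      ((supportList d 1 (N + 2)).getLastD (0, 0)).2 ≠ 1) ↔
    ((Finset.Icc 1 N).filter fun v => 2 ≤ d v).card = t ∧
    ((Finset.Icc 1 N).filter fun v => d v = 1).card = s ∧
    ∀ v, d v = 1 → ∃ w, v < w ∧ 2 ≤ d w := by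
  rw [supportList_length, supportList_length_filter, supportList_getLast_ne_one]
  have hout : ∀ v, d v ≠ 0 → 1 ≤ v ∧ v ≤ N := fun v hv => by
    by_contra h
    exact hv (hd v (by simpa using h))
  have e1 : ((Finset.Ico 1 (N + 2)).filter fun v => d v = 1) =
      (Finset.Icc 1 N).filter fun v => d v = 1 := by
    ext v
    have := hout v
    simp only [Finset.mem_filter, Finset.mem_Ico, Finset.mem_Icc]
    omega
  have e2 : ((Finset.Ico 1 (N + 2)).filter fun v => d v ≠ 0) =
      ((Finset.Icc 1 N).filter fun v => 2 ≤ d v) ∪ (Finset.Icc 1 N).filter fun v => d v = 1 := by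
    ext v
    have := hout v
    simp only [Finset.mem_filter, Finset.mem_Ico, Finset.mem_Icc, Finset.mem_union]
    omega
  have hdisj : Disjoint ((Finset.Icc 1 N).filter fun v => 2 ≤ d v)
      ((Finset.Icc 1 N).filter fun v => d v = 1) :=
    Finset.disjoint_filter.2 fun v _ h1 h2 => by omega
  rw [e1, e2, Finset.card_union_of_disjoint hdisj]
  have e3 : (∀ v, 1 ≤ v → v < N + 2 → d v = 1 → ∃ w, v < w ∧ w < N + 2 ∧ 2 ≤ d w) ↔
      ∀ v, d v = 1 → ∃ w, v < w ∧ 2 ≤ d w := by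
    constructor
    · intro H v hv
      have := hout v (by omega)
      obtain ⟨w, h1, _, h2⟩ := H v this.1 (by omega) hv
      exact ⟨w, h1, h2⟩
    · intro H v _ _ hv
      obtain ⟨w, h1, h2⟩ := H v hv
      have := hout w (by omega)
      exact ⟨w, h1, by omega, h2⟩
  rw [e3]
  constructor <;>
  · rintro ⟨h1, h2, h3⟩
    exact ⟨by omega, h2, h3⟩

lemma outDeg_mem_lukSet {N t s : ℕ} (hN : 1 ≤ N) {S : Finset (ℕ × ℕ)}
    (hS : S ∈ TriSet (N + 2) t s) : outDeg (insert (1, N + 2) S) ∈ LukSet N t s := by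
  obtain ⟨hT, hc⟩ := hS
  have hA := isMaximalArcs_insert (by omega) hT
  have hz : ∀ v, v ∉ Finset.Icc 1 N → outDeg (insert (1, N + 2) S) v = 0 := fun v hv => by
    rw [Finset.mem_Icc] at hv
    exact hA.outDeg_eq_zero (by omega)
  rw [fanList_eq (by omega) hT] at hc
  exact ⟨hz, hA.height_end (by omega), fun m hm => hA.height_nonneg (by omega) (by omega),
    (fanList_conditions_iff hz).1 hc⟩

lemma erase_arcsOf_mem_triSet {N t s : ℕ} (hN : 1 ≤ N) {u : ℕ → ℕ} (hu : u ∈ LukSet N t s) :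
    (arcsOf (N + 2) u).erase (1, N + 2) ∈ TriSet (N + 2) t s ∧
      outDeg (insert (1, N + 2) ((arcsOf (N + 2) u).erase (1, N + 2))) = u := by
  obtain ⟨hz, hend, hnn, hc⟩ := hu
  have hlast : height u (N + 2 - 1) = -1 := by
    have := height_succ u N
    rw [hz (N + 1) (by simp), hend] at this
    simpa using this
  have hnn' : ∀ m, m + 2 ≤ N + 2 → 0 ≤ height u m := fun m hm => hnn m (by omega)
  have hA := arcsOf_maximal hlast hnn'
  have hins := Finset.insert_erase (hA.closing_mem (by omega))
  have hT := isTriangulation_erase hA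
  have hdeg : outDeg (arcsOf (N + 2) u) = u := by
    funext v
    by_cases hv : v ∈ Finset.Icc 1 N
    · rw [Finset.mem_Icc] at hv
      exact outDeg_arcsOf hlast hnn' hv.1 (by omega)
    · rw [hz v hv]
      rw [Finset.mem_Icc] at hv
      exact hA.outDeg_eq_zero (by omega)
  refine ⟨⟨hT, ?_⟩, by rw [hins, hdeg]⟩
  rw [fanList_eq (by omega) hT, hins, hdeg]
  exact (fanList_conditions_iff hz).2 hc

/-- Triangulations correspond to their sequences of out-degrees. -/
noncomputable def triEquivLuk {N : ℕ} (hN : 1 ≤ N) (t s : ℕ) :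
    ↥(TriSet (N + 2) t s) ≃ ↥(LukSet N t s) where
  toFun S := ⟨outDeg (insert (1, N + 2) S.1), outDeg_mem_lukSet hN S.2⟩
  invFun u := ⟨(arcsOf (N + 2) u.1).erase (1, N + 2), (erase_arcsOf_mem_triSet hN u.2).1⟩
  left_inv S := by
    have hA := isMaximalArcs_insert (n := N + 2) (by omega) S.2.1
    refine Subtype.ext ?_
    simp only
    rw [← hA.eq_arcsOf (by omega), Finset.erase_insert (closing_notMem S.2.1)]
  right_inv u := Subtype.ext (erase_arcsOf_mem_triSet hN u.2).2

/-- The number of elements of `A` that are at most `m`. -/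
def cnt (A : Finset ℕ) (m : ℕ) : ℕ := (A.filter (· ≤ m)).card

lemma cnt_mono (A : Finset ℕ) {m k : ℕ} (h : m ≤ k) : cnt A m ≤ cnt A k :=
  Finset.card_le_card fun x hx => by
    simp only [Finset.mem_filter] at hx ⊢
    exact ⟨hx.1, hx.2.trans h⟩

lemma cnt_le_card (A : Finset ℕ) (m : ℕ) : cnt A m ≤ A.card := Finset.card_filter_le _ _

lemma cnt_eq_card {A : Finset ℕ} {N : ℕ} (hA : A ⊆ Finset.Icc 1 N) : cnt A N = A.card := by
  unfold cnt
  rw [Finset.filter_true_of_mem]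
  exact fun x hx => (Finset.mem_Icc.1 (hA hx)).2

lemma cnt_succ_of_mem {A : Finset ℕ} {m : ℕ} (h : m + 1 ∈ A) : cnt A (m + 1) = cnt A m + 1 := by
  unfold cnt
  rw [← Finset.card_insert_of_notMem (a := m + 1) (by simp)]
  congr 1
  ext x
  simp only [Finset.mem_filter, Finset.mem_insert]
  constructor
  · rintro ⟨h1, h2⟩
    by_cases x = m + 1
    · tauto
    · exact Or.inr ⟨h1, by omega⟩
  · rintro (rfl | ⟨h1, h2⟩)
    · exact ⟨h, le_rfl⟩
    · exact ⟨h1, by omega⟩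

lemma cnt_succ_of_notMem {A : Finset ℕ} {m : ℕ} (h : m + 1 ∉ A) : cnt A (m + 1) = cnt A m := by
  unfold cnt
  congr 1
  ext x
  simp only [Finset.mem_filter, and_congr_right_iff]
  intro hx
  have : x ≠ m + 1 := by rintro rfl; exact h hx
  omega

lemma cnt_zero {A : Finset ℕ} (h : 0 ∉ A) : cnt A 0 = 0 := by
  unfold cnt
  rw [Finset.card_eq_zero, Finset.filter_eq_empty_iff]
  rintro x hx h0
  obtain rfl : x = 0 := by omega
  exact h hx

lemma cnt_lt {A : Finset ℕ} {x y : ℕ} (hy : y ∈ A) (h : x < y) : cnt A x < cnt A y := by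
  obtain ⟨k, rfl⟩ : ∃ k, y = k + 1 := ⟨y - 1, by omega⟩
  rw [cnt_succ_of_mem hy]
  exact Nat.lt_succ_of_le (cnt_mono A (by omega))

lemma cnt_le_iff {A : Finset ℕ} {x y : ℕ} (hx : x ∈ A) : cnt A x ≤ cnt A y ↔ x ≤ y := by
  refine ⟨fun h => ?_, cnt_mono A⟩
  by_contra hlt
  have := cnt_lt hx (not_le.1 hlt)
  omega

lemma cnt_inj {A : Finset ℕ} {x y : ℕ} (hx : x ∈ A) (hy : y ∈ A) (h : cnt A x = cnt A y) :
    x = y :=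
  le_antisymm ((cnt_le_iff hx).1 h.le) ((cnt_le_iff hy).1 h.ge)

lemma cnt_pos {A : Finset ℕ} {x y : ℕ} (hx : x ∈ A) (h : x ≤ y) : 1 ≤ cnt A y :=
  Finset.card_pos.2 ⟨x, Finset.mem_filter.2 ⟨hx, h⟩⟩

lemma exists_cnt_eq {A : Finset ℕ} {N c : ℕ} (hA : A ⊆ Finset.Icc 1 N) (hc : 1 ≤ c)
    (hcA : c ≤ A.card) : ∃ y ∈ A, cnt A y = c := by
  classical
  have hex : ∃ m, c ≤ cnt A m := ⟨N, by rwa [cnt_eq_card hA]⟩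
  have h0 : 0 ∉ A := fun h => by simpa using hA h
  have h1 := Nat.find_spec hex
  have h2 := fun m (hm : m < Nat.find hex) => Nat.find_min hex hm
  obtain ⟨k, hk⟩ : ∃ k, Nat.find hex = k + 1 := by
    refine ⟨Nat.find hex - 1, ?_⟩
    rcases Nat.eq_zero_or_pos (Nat.find hex) with h | h
    · rw [h, cnt_zero h0] at h1
      omega
    · omega
  have h3 := h2 k (by omega)
  rw [hk] at h1
  by_cases hm : k + 1 ∈ A
  · rw [cnt_succ_of_mem hm] at h1
    exact ⟨k + 1, hm, by rw [cnt_succ_of_mem hm]; omega⟩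
  · rw [cnt_succ_of_notMem hm] at h1
    omega

/-- Triples `(R, C, Y)` of disjoint subsets of `1, …, N`: for a tableau, `R` and `Y` are the
entries of the two long rows and `C` those of the cells above them. -/
def TripleSet (N t s : ℕ) : Set (Finset ℕ × Finset ℕ × Finset ℕ) :=
  {T | (T.1 ⊆ Finset.Icc 1 N ∧ T.2.1 ⊆ Finset.Icc 1 N ∧ T.2.2 ⊆ Finset.Icc 1 N) ∧
    (Disjoint T.1 T.2.1 ∧ Disjoint T.1 T.2.2 ∧ Disjoint T.2.1 T.2.2) ∧
    (T.1.card = t ∧ T.2.1.card = s ∧ T.2.2.card = t) ∧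
    (∀ v ∈ T.2.1, ∃ w ∈ T.1, v < w) ∧
    (∀ z ∈ Finset.Icc 1 N \ (T.1 ∪ T.2.1), ∃ y ∈ T.2.2, y ≤ z) ∧
    ∀ m, cnt T.2.2 m ≤ cnt T.1 m}

/-- The sum of the excesses over `1` of the first `m` terms. -/
def excess (u : ℕ → ℕ) (m : ℕ) : ℕ := ∑ x ∈ Finset.Icc 1 m, (u x - 1)

lemma excess_zero (u : ℕ → ℕ) : excess u 0 = 0 := by simp [excess]

lemma excess_succ (u : ℕ → ℕ) (m : ℕ) : excess u (m + 1) = excess u m + (u (m + 1) - 1) :=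
  Finset.sum_Icc_succ_top (by omega) _

lemma excess_pred (u : ℕ → ℕ) {m : ℕ} (hm : 1 ≤ m) :
    excess u m = excess u (m - 1) + (u m - 1) := by
  obtain ⟨k, rfl⟩ : ∃ k, m = k + 1 := ⟨m - 1, by omega⟩
  exact excess_succ u k

lemma excess_mono (u : ℕ → ℕ) {m k : ℕ} (h : m ≤ k) : excess u m ≤ excess u k :=
  Finset.sum_le_sum_of_subset (Finset.Icc_subset_Icc_right h)

/-- The positions of the zeros among `1, …, N`. -/
def zeros (N : ℕ) (u : ℕ → ℕ) : Finset ℕ := (Finset.Icc 1 N).filter fun v => u v = 0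

/-- The positions of the ones among `1, …, N`. -/
def ones (N : ℕ) (u : ℕ → ℕ) : Finset ℕ := (Finset.Icc 1 N).filter fun v => u v = 1

/-- The positions of the entries at least `2` among `1, …, N`. -/
def longs (N : ℕ) (u : ℕ → ℕ) : Finset ℕ := (Finset.Icc 1 N).filter fun v => 2 ≤ u v

/-- The zeros that start the blocks attached to the entries at least `2`. -/
def starts (N : ℕ) (u : ℕ → ℕ) : Finset ℕ :=
  (zeros N u).filter fun z => ∃ r ∈ longs N u, excess u (r - 1) + 1 = cnt (zeros N u) z

lemma height_eq_excess (u : ℕ → ℕ) {N m : ℕ} (hm : m ≤ N) :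
    height u m = excess u m - cnt (zeros N u) m := by
  induction m with
  | zero => simp [height_zero, excess_zero, cnt_zero, zeros]
  | succ m ih =>
    rw [height_succ, ih (by omega), excess_succ]
    by_cases h : u (m + 1) = 0
    · rw [cnt_succ_of_mem (by simp [zeros, h, hm]), h]
      push_cast; omega
    · rw [cnt_succ_of_notMem (by simp [zeros, h])]
      push_cast; omega

/-- The sequence attached to a triple: the entry at an element of `R` counts the non-minimal
elements lying in the corresponding block. -/
def seqOf (N : ℕ) (T : Finset ℕ × Finset ℕ × Finset ℕ) (v : ℕ) : ℕ :=
  if v ∈ T.2.1 then 1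
  else if v ∈ T.1 then
    1 + ((Finset.Icc 1 N \ (T.1 ∪ T.2.1)).filter fun z => cnt T.2.2 z = cnt T.1 v).card
  else 0

section triple

variable {N t s : ℕ} {R C Y : Finset ℕ}

lemma starts_subset_compl (hT : (R, C, Y) ∈ TripleSet N t s) :
    Y ⊆ Finset.Icc 1 N \ (R ∪ C) := fun y hy => by
  obtain ⟨⟨-, -, h⟩, ⟨-, h1, h2⟩, -⟩ := hT
  rw [Finset.mem_sdiff, Finset.mem_union]
  exact ⟨h hy, fun h' => h'.elim (fun h => Finset.disjoint_left.1 h1 h hy)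
    fun h => Finset.disjoint_left.1 h2 h hy⟩

lemma two_le_seqOf (hT : (R, C, Y) ∈ TripleSet N t s) {v : ℕ} (hv : v ∈ R) :
    2 ≤ seqOf N (R, C, Y) v := by
  have hYO := starts_subset_compl hT
  obtain ⟨⟨hR, -, hY⟩, ⟨hRC, -, -⟩, ⟨hRt, -, hYt⟩, -⟩ := hT
  simp only at hR hY hRC hRt hYt
  obtain ⟨y, hy, hyc⟩ := exists_cnt_eq (c := cnt R v) hY (cnt_pos hv le_rfl)
    (by have := cnt_le_card R v; omega)
  unfold seqOf
  rw [if_neg (Finset.disjoint_left.1 hRC hv), if_pos hv]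
  have : 0 < ((Finset.Icc 1 N \ (R ∪ C)).filter fun z => cnt Y z = cnt R v).card :=
    Finset.card_pos.2 ⟨y, Finset.mem_filter.2 ⟨hYO hy, hyc⟩⟩
  simp only
  omega

lemma seqOf_of_mem_ones {v : ℕ} (hv : v ∈ C) : seqOf N (R, C, Y) v = 1 := by
  simp [seqOf, hv]

lemma seqOf_of_notMem {v : ℕ} (hR : v ∉ R) (hC : v ∉ C) : seqOf N (R, C, Y) v = 0 := by
  simp [seqOf, hR, hC]

lemma longs_seqOf (hT : (R, C, Y) ∈ TripleSet N t s) : longs N (seqOf N (R, C, Y)) = R := by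
  ext v
  simp only [longs, Finset.mem_filter]
  constructor
  · rintro ⟨-, h⟩
    by_contra hR
    by_cases hC : v ∈ C
    · rw [seqOf_of_mem_ones hC] at h; omega
    · rw [seqOf_of_notMem hR hC] at h; omega
  · exact fun h => ⟨hT.1.1 h, two_le_seqOf hT h⟩

lemma ones_seqOf (hT : (R, C, Y) ∈ TripleSet N t s) : ones N (seqOf N (R, C, Y)) = C := by
  ext v
  simp only [ones, Finset.mem_filter]
  constructor
  · rintro ⟨-, h⟩
    by_contra hC
    by_cases hR : v ∈ R
    · have := two_le_seqOf hT hR; omega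
    · rw [seqOf_of_notMem hR hC] at h; omega
  · exact fun h => ⟨hT.1.2.1 h, seqOf_of_mem_ones h⟩

lemma zeros_seqOf (hT : (R, C, Y) ∈ TripleSet N t s) :
    zeros N (seqOf N (R, C, Y)) = Finset.Icc 1 N \ (R ∪ C) := by
  ext v
  simp only [zeros, Finset.mem_filter, Finset.mem_sdiff, Finset.mem_union, not_or]
  refine and_congr_right fun _ => ⟨fun h => ⟨fun hR => ?_, fun hC => ?_⟩, fun h =>
    seqOf_of_notMem h.1 h.2⟩
  · have := two_le_seqOf hT hR; omega
  · rw [seqOf_of_mem_ones hC] at h; omega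

lemma excess_seqOf (hT : (R, C, Y) ∈ TripleSet N t s) (m : ℕ) :
    excess (seqOf N (R, C, Y)) m =
      ((Finset.Icc 1 N \ (R ∪ C)).filter fun z => cnt Y z ≤ cnt R m).card := by
  obtain ⟨⟨hR, -, -⟩, ⟨hRC, -, -⟩, -, -, hfirst, -⟩ := hT
  simp only at hR hRC hfirst
  induction m with
  | zero =>
    rw [excess_zero, eq_comm, Finset.card_eq_zero, Finset.filter_eq_empty_iff]
    intro z hz
    obtain ⟨y, hy, hyz⟩ := hfirst z hz
    rw [cnt_zero fun h => by simpa using hR h]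
    have := cnt_pos hy hyz
    omega
  | succ m ih =>
    rw [excess_succ, ih]
    by_cases hm : m + 1 ∈ R
    · have hC := Finset.disjoint_left.1 hRC hm
      have hs : seqOf N (R, C, Y) (m + 1) - 1 =
          ((Finset.Icc 1 N \ (R ∪ C)).filter fun z => cnt Y z = cnt R m + 1).card := by
        simp [seqOf, hC, hm, cnt_succ_of_mem hm]
      rw [hs, cnt_succ_of_mem hm, ← Finset.card_union_of_disjoint
        (Finset.disjoint_filter.2 fun z _ h1 h2 => by omega), ← Finset.filter_or]
      congr 1
      ext z
      simp only [Finset.mem_filter, and_congr_right_iff]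
      omega
    · rw [cnt_succ_of_notMem hm]
      have : seqOf N (R, C, Y) (m + 1) - 1 = 0 := by
        by_cases hC : m + 1 ∈ C
        · rw [seqOf_of_mem_ones hC]
        · rw [seqOf_of_notMem hm hC]
      rw [this, add_zero]

lemma seqOf_mem_lukSet (hT : (R, C, Y) ∈ TripleSet N t s) :
    seqOf N (R, C, Y) ∈ LukSet N t s := by
  have hYO := starts_subset_compl hT
  have hl := longs_seqOf hT
  have ho := ones_seqOf hT
  have hz := zeros_seqOf hT
  have hex := excess_seqOf hT
  have hT' := hT
  obtain ⟨⟨hR, hC, hY⟩, ⟨hRC, -, -⟩, ⟨hRt, hCs, hYt⟩, hlast, hfirst, hballot⟩ := hT'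
  simp only at hR hC hY hRC hRt hCs hYt hlast hfirst hballot
  refine ⟨fun v hv => seqOf_of_notMem (fun h => hv (hR h)) fun h => hv (hC h), ?_, ?_, ?_, ?_, ?_⟩
  · rw [height_eq_excess _ le_rfl, hex, hz, cnt_eq_card Finset.sdiff_subset,
      Finset.filter_true_of_mem, sub_self]
    intro z _
    rw [cnt_eq_card hR, hRt, ← hYt]
    exact cnt_le_card _ _
  · intro m hm
    rw [height_eq_excess _ hm, hex, hz, sub_nonneg, Nat.cast_le]
    refine Finset.card_le_card fun z hz => ?_
    rw [Finset.mem_filter] at hz ⊢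
    exact ⟨hz.1, (cnt_mono Y hz.2).trans (hballot m)⟩
  · exact (congrArg Finset.card hl).trans hRt
  · exact (congrArg Finset.card ho).trans hCs
  · intro v hv
    have hvC : v ∈ C := by
      by_contra hC
      by_cases hR : v ∈ R
      · have := two_le_seqOf hT hR; omega
      · rw [seqOf_of_notMem hR hC] at hv; omega
    obtain ⟨w, hw, hvw⟩ := hlast v hvC
    exact ⟨w, hvw, two_le_seqOf hT hw⟩

lemma starts_seqOf (hT : (R, C, Y) ∈ TripleSet N t s) : starts N (seqOf N (R, C, Y)) = Y := by
  have hYO := starts_subset_compl hT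
  have hex := excess_seqOf hT
  unfold starts
  rw [zeros_seqOf hT, longs_seqOf hT]
  obtain ⟨⟨hR, hC, hY⟩, -, ⟨hRt, -, hYt⟩, -⟩ := hT
  simp only at hR hC hY hRt hYt
  set O := Finset.Icc 1 N \ (R ∪ C)
  have key : ∀ r ∈ R, ∀ y ∈ Y, cnt Y y = cnt R r →
      excess (seqOf N (R, C, Y)) (r - 1) + 1 = cnt O y := by
    intro r hr y hy hc
    have h1 : 1 ≤ r := (Finset.mem_Icc.1 (hR hr)).1
    have h2 : cnt R r = cnt R (r - 1) + 1 := by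
      obtain ⟨k, rfl⟩ : ∃ k, r = k + 1 := ⟨r - 1, by omega⟩
      exact cnt_succ_of_mem hr
    have h3 : (O.filter fun z => cnt Y z ≤ cnt R (r - 1)) = O.filter (· ≤ y - 1) := by
      ext z
      have hy1 := (Finset.mem_Icc.1 (hY hy)).1
      simp only [Finset.mem_filter, and_congr_right_iff]
      intro _
      constructor
      · intro h
        by_contra hlt
        have := cnt_mono Y (show y ≤ z by omega)
        omega
      · intro h
        have := cnt_lt hy (show z < y by omega)
        omega
    rw [hex, h3]
    have hy1 := (Finset.mem_Icc.1 (hY hy)).1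
    obtain ⟨k, rfl⟩ : ∃ k, y = k + 1 := ⟨y - 1, by omega⟩
    exact (cnt_succ_of_mem (hYO hy)).symm
  ext z
  rw [Finset.mem_filter]
  constructor
  · rintro ⟨hz, r, hr, h⟩
    obtain ⟨y, hy, hyc⟩ := exists_cnt_eq (c := cnt R r) hY (cnt_pos hr le_rfl)
      (by have := cnt_le_card R r; omega)
    rw [key r hr y hy hyc] at h
    exact cnt_inj (hYO hy) hz h ▸ hy
  · intro hz
    obtain ⟨r, hr, hrc⟩ := exists_cnt_eq (c := cnt Y z) hR (cnt_pos hz le_rfl)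
      (by have := cnt_le_card Y z; omega)
    exact ⟨hYO hz, r, hr, key r hr z hz hrc.symm⟩

end triple

section luk

variable {N t s : ℕ} {u : ℕ → ℕ}

lemma longs_subset : longs N u ⊆ Finset.Icc 1 N := Finset.filter_subset _ _

lemma zeros_subset : zeros N u ⊆ Finset.Icc 1 N := Finset.filter_subset _ _

lemma card_zeros (hu : u ∈ LukSet N t s) : (zeros N u).card = excess u N := by
  have := height_eq_excess u (le_refl N)
  rw [hu.2.1, cnt_eq_card zeros_subset] at this
  omega

lemma excess_lt_excess {r : ℕ} (hr : r ∈ longs N u) : excess u (r - 1) < excess u r := by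
  simp only [longs, Finset.mem_filter, Finset.mem_Icc] at hr
  rw [excess_pred u hr.1.1]
  omega

/-- Every entry at least `2` has a unique block start, which lies to its right. -/
lemma exists_start (hu : u ∈ LukSet N t s) {r : ℕ} (hr : r ∈ longs N u) :
    ∃ y ∈ zeros N u, cnt (zeros N u) y = excess u (r - 1) + 1 ∧ r < y := by
  have h1 := excess_lt_excess hr
  have hrN := Finset.mem_Icc.1 (longs_subset hr)
  have h2 := excess_mono u hrN.2
  obtain ⟨y, hy, hyc⟩ := exists_cnt_eq (c := excess u (r - 1) + 1) (zeros_subset (N := N) (u := u))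
    (by omega) (by rw [card_zeros hu]; omega)
  refine ⟨y, hy, hyc, ?_⟩
  have h3 := height_eq_excess u (N := N) (m := r - 1) (by omega)
  have h4 := hu.2.2.1 (r - 1) (by omega)
  have h5 : cnt (zeros N u) r = cnt (zeros N u) (r - 1) := by
    obtain ⟨k, rfl⟩ : ∃ k, r = k + 1 := ⟨r - 1, by omega⟩
    refine cnt_succ_of_notMem fun h => ?_
    simp only [longs, zeros, Finset.mem_filter] at hr h
    omega
  by_contra hle
  have := cnt_mono (zeros N u) (not_lt.1 hle)
  omega

lemma cnt_starts (hu : u ∈ LukSet N t s) (m : ℕ) : cnt (starts N u) m =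
    ((longs N u).filter fun r => excess u (r - 1) + 1 ≤ cnt (zeros N u) m).card := by
  unfold cnt
  symm
  choose! y hy using fun r (hr : r ∈ longs N u) => exists_start hu hr
  refine Finset.card_bij (fun r _ => y r) ?_ ?_ ?_
  · intro r hr
    rw [Finset.mem_filter] at hr
    obtain ⟨h1, h2, -⟩ := hy r hr.1
    rw [Finset.mem_filter, starts, Finset.mem_filter]
    refine ⟨⟨h1, r, hr.1, h2.symm⟩, (cnt_le_iff h1).1 ?_⟩
    rw [h2]
    exact hr.2
  · intro r hr r' hr' h
    rw [Finset.mem_filter] at hr hr'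
    have e1 := (hy r hr.1).2.1
    have e2 := (hy r' hr'.1).2.1
    rw [h, e2] at e1
    have l1 := excess_lt_excess hr.1
    have l2 := excess_lt_excess hr'.1
    rcases lt_trichotomy r r' with hlt | rfl | hlt
    · have := excess_mono u (show r ≤ r' - 1 by omega)
      omega
    · rfl
    · have := excess_mono u (show r' ≤ r - 1 by omega)
      omega
  · intro z hz
    rw [Finset.mem_filter, starts, Finset.mem_filter] at hz
    obtain ⟨⟨hz, r, hr, hrz⟩, hzm⟩ := hz
    obtain ⟨h1, h2, -⟩ := hy r hr
    refine ⟨r, Finset.mem_filter.2 ⟨hr, ?_⟩, cnt_inj h1 hz (h2.trans hrz)⟩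
    rw [hrz]
    exact cnt_mono _ hzm

lemma starts_subset : starts N u ⊆ zeros N u := Finset.filter_subset _ _

lemma compl_longs_ones : Finset.Icc 1 N \ (longs N u ∪ ones N u) = zeros N u := by
  ext v
  simp only [longs, ones, zeros, Finset.mem_sdiff, Finset.mem_union, Finset.mem_filter,
    ← and_or_left, not_and, and_congr_right_iff]
  intro hv
  simp only [hv, forall_const]
  omega

lemma exists_long_block (hu : u ∈ LukSet N t s) {z : ℕ} (hz : z ∈ zeros N u) :
    ∃ r ∈ longs N u, excess u (r - 1) < cnt (zeros N u) z ∧ cnt (zeros N u) z ≤ excess u r := by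
  classical
  have hex : ∃ m, cnt (zeros N u) z ≤ excess u m :=
    ⟨N, by rw [← card_zeros hu]; exact cnt_le_card _ _⟩
  have h1 := Nat.find_spec hex
  have h2 : Nat.find hex ≤ N := Nat.find_min' hex (by rw [← card_zeros hu]; exact cnt_le_card _ _)
  have h3 := fun m (hm : m < Nat.find hex) => Nat.find_min hex hm
  have hpos := cnt_pos hz le_rfl
  have h0 : Nat.find hex ≠ 0 := fun h => by
    rw [h, excess_zero] at h1
    omega
  set r := Nat.find hex
  have h4 := h3 (r - 1) (by omega)
  have h5 := excess_pred u (m := r) (by omega)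
  refine ⟨r, ?_, by omega, h1⟩
  simp only [longs, Finset.mem_filter, Finset.mem_Icc]
  omega

lemma cnt_starts_of_mem_block (hu : u ∈ LukSet N t s) {z r : ℕ}
    (h1 : excess u (r - 1) < cnt (zeros N u) z) (h2 : cnt (zeros N u) z ≤ excess u r) :
    cnt (starts N u) z = cnt (longs N u) r := by
  rw [cnt_starts hu]
  change _ = ((longs N u).filter (· ≤ r)).card
  congr 1
  ext x
  simp only [Finset.mem_filter, and_congr_right_iff]
  intro hx
  constructor
  · intro h
    by_contra hlt
    have := excess_mono u (show r ≤ x - 1 by omega)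
    omega
  · intro h
    have := excess_mono u (show x - 1 ≤ r - 1 by omega)
    omega

lemma triple_mem (hu : u ∈ LukSet N t s) :
    (longs N u, ones N u, starts N u) ∈ TripleSet N t s := by
  have hcard : (starts N u).card = t := by
    rw [← hu.2.2.2.1, ← cnt_eq_card (starts_subset.trans zeros_subset), cnt_starts hu,
      Finset.filter_true_of_mem]
    · rfl
    · intro r hr
      rw [cnt_eq_card zeros_subset, card_zeros hu]
      have := excess_lt_excess hr
      have := excess_mono u (Finset.mem_Icc.1 (longs_subset hr)).2
      omega
  refine ⟨⟨longs_subset, Finset.filter_subset _ _, starts_subset.trans zeros_subset⟩,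
    ⟨Finset.disjoint_filter.2 fun v _ h1 h2 => by omega, ?_, ?_⟩,
    ⟨hu.2.2.2.1, hu.2.2.2.2.1, hcard⟩, ?_, ?_, ?_⟩
  · exact Finset.disjoint_of_subset_right starts_subset
      (Finset.disjoint_filter.2 fun v _ h1 h2 => by omega)
  · exact Finset.disjoint_of_subset_right starts_subset
      (Finset.disjoint_filter.2 fun v _ h1 h2 => by omega)
  · intro v hv
    obtain ⟨w, h1, h2⟩ := hu.2.2.2.2.2 v (Finset.mem_filter.1 hv).2
    refine ⟨w, Finset.mem_filter.2 ⟨?_, h2⟩, h1⟩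
    by_contra hw
    have := hu.1 w hw
    omega
  · simp only [compl_longs_ones]
    intro z hz
    obtain ⟨r, hr, h1, h2⟩ := exists_long_block hu hz
    have h3 := cnt_starts_of_mem_block hu h1 h2
    have h4 : 0 < cnt (starts N u) z := h3 ▸ cnt_pos hr le_rfl
    obtain ⟨y, hy⟩ := Finset.card_pos.1 h4
    rw [Finset.mem_filter] at hy
    exact ⟨y, hy⟩
  · intro m
    simp only
    rw [cnt_starts hu]
    refine Finset.card_le_card fun r hr => ?_
    rw [Finset.mem_filter] at hr ⊢
    obtain ⟨y, hy, h1, h2⟩ := exists_start hu hr.1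
    rw [← h1, cnt_le_iff hy] at hr
    exact ⟨hr.1, by omega⟩

lemma card_filter_cnt (A : Finset ℕ) {N a b : ℕ} (hA : A ⊆ Finset.Icc 1 N) (hb : b ≤ A.card) :
    (A.filter fun z => a < cnt A z ∧ cnt A z ≤ b).card = b - a := by
  rw [← Nat.card_Ioc]
  refine Finset.card_bij (fun z _ => cnt A z) ?_ ?_ ?_
  · intro z hz
    exact Finset.mem_Ioc.2 (Finset.mem_filter.1 hz).2
  · intro x hx y hy h
    exact cnt_inj (Finset.mem_filter.1 hx).1 (Finset.mem_filter.1 hy).1 h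
  · intro c hc
    rw [Finset.mem_Ioc] at hc
    obtain ⟨y, hy, rfl⟩ := exists_cnt_eq (c := c) hA (by omega) (by omega)
    exact ⟨y, Finset.mem_filter.2 ⟨hy, hc⟩, rfl⟩

lemma seqOf_triple (hu : u ∈ LukSet N t s) :
    seqOf N (longs N u, ones N u, starts N u) = u := by
  funext v
  by_cases hR : v ∈ longs N u
  · have hR' := hR
    simp only [longs, Finset.mem_filter, Finset.mem_Icc] at hR'
    have hC : v ∉ ones N u := fun h => by
      have := (Finset.mem_filter.1 h).2
      omega
    have hset : ((zeros N u).filter fun z => cnt (starts N u) z = cnt (longs N u) v) =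
        (zeros N u).filter fun z => excess u (v - 1) < cnt (zeros N u) z ∧
          cnt (zeros N u) z ≤ excess u v := by
      refine Finset.filter_congr fun z hz => ⟨fun h => ?_, fun h =>
        cnt_starts_of_mem_block hu h.1 h.2⟩
      obtain ⟨r, hr, h1, h2⟩ := exists_long_block hu hz
      rw [cnt_starts_of_mem_block hu h1 h2] at h
      obtain rfl := cnt_inj hr hR h
      exact ⟨h1, h2⟩
    simp only [seqOf, if_neg hC, if_pos hR, compl_longs_ones, hset]
    rw [card_filter_cnt _ zeros_subset
      (by rw [card_zeros hu]; exact excess_mono u hR'.1.2), excess_pred u hR'.1.1]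
    omega
  · by_cases hC : v ∈ ones N u
    · rw [seqOf_of_mem_ones hC, (Finset.mem_filter.1 hC).2]
    · rw [seqOf_of_notMem hR hC]
      by_cases hv : v ∈ Finset.Icc 1 N
      · have h1 : ¬ 2 ≤ u v := fun h => hR (Finset.mem_filter.2 ⟨hv, h⟩)
        have h2 : ¬ u v = 1 := fun h => hC (Finset.mem_filter.2 ⟨hv, h⟩)
        omega
      · exact (hu.1 v hv).symm

end luk

/-- Triples correspond to sequences. -/
def tripleEquivLuk (N t s : ℕ) : ↥(TripleSet N t s) ≃ ↥(LukSet N t s) where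
  toFun T := ⟨seqOf N T.1, seqOf_mem_lukSet T.2⟩
  invFun u := ⟨(longs N u.1, ones N u.1, starts N u.1), triple_mem u.2⟩
  left_inv := by
    rintro ⟨⟨R, C, Y⟩, hT⟩
    refine Subtype.ext ?_
    simp only [longs_seqOf hT, ones_seqOf hT, starts_seqOf hT]
  right_inv u := Subtype.ext (seqOf_triple u.2)

lemma cnt_image_strictMono {g : ℕ → ℕ} {k c : ℕ} (hg : StrictMonoOn g (Set.Iio k)) (hc : c < k) :
    cnt ((Finset.range k).image g) (g c) = c + 1 := by
  have : ((Finset.range k).image g).filter (· ≤ g c) = (Finset.range (c + 1)).image g := by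
    ext x
    simp only [Finset.mem_filter, Finset.mem_image, Finset.mem_range]
    constructor
    · rintro ⟨⟨d, hd, rfl⟩, h⟩
      have := (hg.le_iff_le (Set.mem_Iio.2 hd) (Set.mem_Iio.2 hc)).1 h
      exact ⟨d, by omega, rfl⟩
    · rintro ⟨d, hd, rfl⟩
      exact ⟨⟨d, by omega, rfl⟩,
        (hg.le_iff_le (Set.mem_Iio.2 (by omega)) (Set.mem_Iio.2 hc)).2 (by omega)⟩
  rw [cnt, this, Finset.card_image_of_injOn, Finset.card_range]
  intro x hx y hy h
  simp only [Finset.coe_range, Set.mem_Iio] at hx hy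
  exact hg.injOn (Set.mem_Iio.2 (by omega)) (Set.mem_Iio.2 (by omega)) h

lemma strictMono_eq_of_image_eq {g g' : ℕ → ℕ} {k : ℕ} (hg : StrictMonoOn g (Set.Iio k))
    (hg' : StrictMonoOn g' (Set.Iio k))
    (h : (Finset.range k).image g = (Finset.range k).image g') {c : ℕ} (hc : c < k) :
    g c = g' c := by
  have h1 := cnt_image_strictMono hg hc
  have h2 := cnt_image_strictMono hg' hc
  rw [h] at h1
  refine cnt_inj (A := (Finset.range k).image g') ?_ ?_ (h1.trans h2.symm)
  · rw [← h]
    exact Finset.mem_image_of_mem _ (Finset.mem_range.2 hc)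
  · exact Finset.mem_image_of_mem _ (Finset.mem_range.2 hc)

lemma exists_enumeration {A : Finset ℕ} {N k : ℕ} (hA : A ⊆ Finset.Icc 1 N) (hk : A.card = k) :
    ∃ g : ℕ → ℕ, StrictMonoOn g (Set.Iio k) ∧ (Finset.range k).image g = A ∧
      ∀ c < k, g c ∈ A ∧ cnt A (g c) = c + 1 := by
  choose! g hg using fun c (hc : c < k) =>
    exists_cnt_eq (c := c + 1) hA (by omega) (by omega)
  refine ⟨g, fun c hc d hd hcd => ?_, ?_, hg⟩
  · obtain ⟨h1, h2⟩ := hg c hc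
    obtain ⟨h3, h4⟩ := hg d hd
    by_contra hle
    have := cnt_mono A (not_lt.1 hle)
    omega
  · ext y
    simp only [Finset.mem_image, Finset.mem_range]
    constructor
    · rintro ⟨c, hc, rfl⟩
      exact (hg c hc).1
    · intro hy
      have h1 := cnt_pos hy le_rfl
      have h2 := cnt_le_card A y
      have h3 := hg (cnt A y - 1) (by omega)
      exact ⟨cnt A y - 1, by omega, cnt_inj h3.1 hy (by omega)⟩

lemma mem_skytCells {α i β r c : ℕ} : (r, c) ∈ skytCells (α + 2) i (β + 2) ↔
    (r < β ∧ c = i) ∨ (r = β ∧ c ≤ i) ∨ (r = β + 1 ∧ c ≤ i) ∨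
      (β + 2 ≤ r ∧ r < α + β + 2 ∧ c = 0) := by
  simp only [skytCells, Finset.mem_filter, Finset.mem_product, Finset.mem_range]
  omega

/-- The entries of the upper long row, of the cells above it, and of the lower long row. -/
def tripleOf (i β : ℕ) (f : ℕ × ℕ → ℕ) : Finset ℕ × Finset ℕ × Finset ℕ :=
  ((Finset.range (i + 1)).image fun c => f (β, c), (Finset.range β).image fun r => f (r, i),
    (Finset.range (i + 1)).image fun c => f (β + 1, c))

section skyt

variable {α i β : ℕ} {f : ℕ × ℕ → ℕ}

lemma skyt_row_strictMono (hf : f ∈ SkytSet (α + 2) i (β + 2)) {r : ℕ} (hr : r = β ∨ r = β + 1) :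
    StrictMonoOn (fun c => f (r, c)) (Set.Iio (i + 1)) := by
  intro c hc d hd hcd
  rw [Set.mem_Iio] at hc hd
  exact hf.2.2.1 (r, c) (mem_skytCells.2 (by omega)) (r, d) (mem_skytCells.2 (by omega)) rfl hcd

lemma skyt_top_strictMono (hf : f ∈ SkytSet (α + 2) i (β + 2)) :
    StrictMonoOn (fun r => f (r, i)) (Set.Iio β) := by
  intro c hc d hd hcd
  rw [Set.mem_Iio] at hc hd
  exact hf.2.2.2 (c, i) (mem_skytCells.2 (by omega)) (d, i) (mem_skytCells.2 (by omega)) rfl hcd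

lemma skyt_bottom_strictMono (hf : f ∈ SkytSet (α + 2) i (β + 2)) :
    StrictMonoOn (fun k => f (β + 2 + k, 0)) (Set.Iio α) := by
  intro c hc d hd hcd
  rw [Set.mem_Iio] at hc hd
  exact hf.2.2.2 (β + 2 + c, 0) (mem_skytCells.2 (by omega)) (β + 2 + d, 0)
    (mem_skytCells.2 (by omega)) rfl (by simp only; omega)

lemma card_image_range {g : ℕ → ℕ} {k : ℕ} (hg : StrictMonoOn g (Set.Iio k)) :
    ((Finset.range k).image g).card = k := by
  rw [Finset.card_image_of_injOn, Finset.card_range]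
  simpa using hg.injOn

lemma skyt_image_subset {N : ℕ} (hN : N = α + 2 + (β + 2) + 2 * i - 2)
    (hf : f ∈ SkytSet (α + 2) i (β + 2)) {k : ℕ} {p : ℕ → ℕ × ℕ}
    (hp : ∀ x < k, p x ∈ skytCells (α + 2) i (β + 2)) :
    ((Finset.range k).image fun x => f (p x)) ⊆ Finset.Icc 1 N := by
  intro y hy
  obtain ⟨x, hx, rfl⟩ := Finset.mem_image.1 hy
  exact hN ▸ hf.2.1.mapsTo (hp x (Finset.mem_range.1 hx))

lemma skyt_image_disjoint (hf : f ∈ SkytSet (α + 2) i (β + 2)) {k l : ℕ} {p q : ℕ → ℕ × ℕ}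
    (hp : ∀ x < k, p x ∈ skytCells (α + 2) i (β + 2))
    (hq : ∀ x < l, q x ∈ skytCells (α + 2) i (β + 2)) (hpq : ∀ x < k, ∀ y < l, p x ≠ q y) :
    Disjoint ((Finset.range k).image fun x => f (p x))
      ((Finset.range l).image fun x => f (q x)) := by
  rw [Finset.disjoint_left]
  intro z h1 h2
  obtain ⟨x, hx, rfl⟩ := Finset.mem_image.1 h1
  obtain ⟨y, hy, h⟩ := Finset.mem_image.1 h2
  rw [Finset.mem_range] at hx hy
  exact hpq x hx y hy (hf.2.1.injOn (hp x hx) (hq y hy) h.symm)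

lemma tripleOf_mem {N : ℕ} (hN : N = α + 2 + (β + 2) + 2 * i - 2)
    (hf : f ∈ SkytSet (α + 2) i (β + 2)) : tripleOf i β f ∈ TripleSet N (i + 1) β := by
  have hR : ∀ x < i + 1, (β, x) ∈ skytCells (α + 2) i (β + 2) := fun x hx =>
    mem_skytCells.2 (by omega)
  have hC : ∀ x < β, (x, i) ∈ skytCells (α + 2) i (β + 2) := fun x hx =>
    mem_skytCells.2 (by omega)
  have hY : ∀ x < i + 1, (β + 1, x) ∈ skytCells (α + 2) i (β + 2) := fun x hx =>
    mem_skytCells.2 (by omega)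
  refine ⟨⟨skyt_image_subset hN hf hR, skyt_image_subset hN hf hC, skyt_image_subset hN hf hY⟩,
    ⟨skyt_image_disjoint hf hR hC fun x _ y _ h => ?_,
      skyt_image_disjoint hf hR hY fun x _ y _ h => ?_,
      skyt_image_disjoint hf hC hY fun x _ y _ h => ?_⟩,
    ⟨card_image_range (skyt_row_strictMono hf (Or.inl rfl)),
      card_image_range (skyt_top_strictMono hf),
      card_image_range (skyt_row_strictMono hf (Or.inr rfl))⟩, ?_, ?_, ?_⟩
  · simp only [Prod.mk.injEq] at h; omega
  · simp only [Prod.mk.injEq] at h; omega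
  · simp only [Prod.mk.injEq] at h; omega
  · intro v hv
    obtain ⟨x, hx, rfl⟩ := Finset.mem_image.1 hv
    rw [Finset.mem_range] at hx
    exact ⟨f (β, i), Finset.mem_image_of_mem _ (Finset.mem_range.2 (by omega)),
      hf.2.2.2 _ (hC x hx) _ (hR i (by omega)) rfl hx⟩
  · intro z hz
    simp only [tripleOf, Finset.mem_sdiff, Finset.mem_union, Finset.mem_image, Finset.mem_range,
      not_or, not_exists, not_and] at hz
    obtain ⟨hzN, hzR, hzC⟩ := hz
    rw [hN] at hzN
    obtain ⟨⟨r, c⟩, hrc, rfl⟩ := hf.2.1.surjOn hzN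
    have h0 := hY 0 (by omega)
    refine ⟨f (β + 1, 0), Finset.mem_image_of_mem _ (Finset.mem_range.2 (by omega)), ?_⟩
    rcases mem_skytCells.1 hrc with h | h | h | h
    · obtain ⟨h, rfl⟩ := h
      exact absurd rfl (hzC r h)
    · obtain ⟨rfl, h⟩ := h
      exact absurd rfl (hzR c (by omega))
    · obtain ⟨rfl, h⟩ := h
      rcases Nat.eq_zero_or_pos c with rfl | hc
      · exact le_rfl
      · exact (hf.2.2.1 _ h0 _ hrc rfl hc).le
    · obtain ⟨h1, h2, rfl⟩ := h
      exact (hf.2.2.2 _ h0 _ hrc rfl (by simp only; omega)).le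
  · intro m
    have h1 : ((tripleOf i β f).2.2.filter (· ≤ m)) ⊆
        ((Finset.range (i + 1)).filter fun c => f (β + 1, c) ≤ m).image fun c => f (β + 1, c) := by
      intro y hy
      obtain ⟨hy, hym⟩ := Finset.mem_filter.1 hy
      obtain ⟨c, hc, rfl⟩ := Finset.mem_image.1 hy
      exact Finset.mem_image_of_mem _ (Finset.mem_filter.2 ⟨hc, hym⟩)
    have h2 : (((Finset.range (i + 1)).filter fun c => f (β + 1, c) ≤ m).image
        fun c => f (β, c)) ⊆ (tripleOf i β f).1.filter (· ≤ m) := by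
      intro y hy
      obtain ⟨c, hc, rfl⟩ := Finset.mem_image.1 hy
      obtain ⟨hc, hcm⟩ := Finset.mem_filter.1 hc
      refine Finset.mem_filter.2 ⟨Finset.mem_image_of_mem _ hc, ?_⟩
      rw [Finset.mem_range] at hc
      exact (hf.2.2.2 _ (hR c hc) _ (hY c hc) rfl (Nat.lt_succ_self β)).le.trans hcm
    refine (Finset.card_le_card h1).trans (Finset.card_image_le.trans ?_)
    refine le_trans (le_of_eq ?_) (Finset.card_le_card h2)
    rw [Finset.card_image_of_injOn]
    refine (skyt_row_strictMono hf (Or.inl rfl)).injOn.mono fun c hc => ?_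
    simpa using (Finset.mem_filter.1 hc).1

lemma skyt_bottom_image {N : ℕ} (hN : N = α + 2 + (β + 2) + 2 * i - 2)
    (hf : f ∈ SkytSet (α + 2) i (β + 2)) : ((Finset.range α).image fun k => f (β + 2 + k, 0)) =
      Finset.Icc 1 N \ ((tripleOf i β f).1 ∪ (tripleOf i β f).2.1 ∪ (tripleOf i β f).2.2) := by
  subst hN
  ext z
  simp only [tripleOf, Finset.mem_sdiff, Finset.mem_union, Finset.mem_image, Finset.mem_range,
      not_or, not_exists, not_and]
  constructor
  · rintro ⟨k, hk, rfl⟩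
    have hk' : (β + 2 + k, 0) ∈ skytCells (α + 2) i (β + 2) := mem_skytCells.2 (by omega)
    refine ⟨hf.2.1.mapsTo hk', ⟨fun x hx h => ?_, fun x hx h => ?_⟩, fun x hx h => ?_⟩ <;>
    · have := hf.2.1.injOn (mem_skytCells.2 (by omega)) hk' h
      simp only [Prod.mk.injEq] at this
      omega
  · rintro ⟨hz, ⟨hR, hC⟩, hY⟩
    obtain ⟨⟨r, c⟩, hrc, rfl⟩ := hf.2.1.surjOn hz
    rcases mem_skytCells.1 hrc with ⟨h, rfl⟩ | ⟨rfl, h⟩ | ⟨rfl, h⟩ | ⟨h1, h2, rfl⟩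
    · exact absurd rfl (hC r h)
    · exact absurd rfl (hR c (by omega))
    · exact absurd rfl (hY c (by omega))
    · exact ⟨r - (β + 2), by omega, by rw [Nat.add_sub_cancel' h1]⟩

lemma tripleOf_injOn : Set.InjOn (tripleOf i β) (SkytSet (α + 2) i (β + 2)) := by
  intro f hf g hg h
  have hZ : ((Finset.range α).image fun k => f (β + 2 + k, 0)) =
      (Finset.range α).image fun k => g (β + 2 + k, 0) := by
    rw [skyt_bottom_image rfl hf, skyt_bottom_image rfl hg, h]
  funext ⟨r, c⟩
  by_cases hrc : (r, c) ∈ skytCells (α + 2) i (β + 2)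
  · rcases mem_skytCells.1 hrc with ⟨h1, rfl⟩ | ⟨rfl, h1⟩ | ⟨rfl, h1⟩ | ⟨h1, h2, rfl⟩
    · exact strictMono_eq_of_image_eq (skyt_top_strictMono hf) (skyt_top_strictMono hg)
        (congrArg (fun T => T.2.1) h) h1
    · exact strictMono_eq_of_image_eq (skyt_row_strictMono hf (Or.inl rfl))
        (skyt_row_strictMono hg (Or.inl rfl)) (congrArg (fun T => T.1) h) (by omega)
    · exact strictMono_eq_of_image_eq (skyt_row_strictMono hf (Or.inr rfl))
        (skyt_row_strictMono hg (Or.inr rfl)) (congrArg (fun T => T.2.2) h) (by omega)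
    · have := strictMono_eq_of_image_eq (skyt_bottom_strictMono hf) (skyt_bottom_strictMono hg)
        hZ (c := r - (β + 2)) (by omega)
      simpa only [Nat.add_sub_cancel' h1] using this
  · rw [hf.1 _ hrc, hg.1 _ hrc]

/-- The filling with prescribed top column, long rows and bottom column. -/
def filling (α i β : ℕ) (top upper lower bottom : ℕ → ℕ) (c : ℕ × ℕ) : ℕ :=
  if c ∈ skytCells (α + 2) i (β + 2) then
    if c.1 < β then top c.1 else if c.1 = β then upper c.2 else if c.1 = β + 1 then lower c.2
    else bottom (c.1 - (β + 2))
  else 0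

section filling

variable {p q x y : ℕ → ℕ}

lemma filling_top {r : ℕ} (hr : r < β) : filling α i β p q x y (r, i) = p r := by
  rw [filling, if_pos (mem_skytCells.2 (by omega)), if_pos hr]

lemma filling_upper {c : ℕ} (hc : c ≤ i) : filling α i β p q x y (β, c) = q c := by
  rw [filling, if_pos (mem_skytCells.2 (by omega))]
  simp

lemma filling_lower {c : ℕ} (hc : c ≤ i) : filling α i β p q x y (β + 1, c) = x c := by
  rw [filling, if_pos (mem_skytCells.2 (by omega))]
  simp

lemma filling_bottom {r : ℕ} (h1 : β + 2 ≤ r) (h2 : r < α + β + 2) :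
    filling α i β p q x y (r, 0) = y (r - (β + 2)) := by
  rw [filling, if_pos (mem_skytCells.2 (by omega)), if_neg (by simp only; omega),
    if_neg (by simp only; omega), if_neg (by simp only; omega)]

end filling

lemma tripleOf_surjOn {N : ℕ} (hi : 1 ≤ i) (hN : N = α + 2 + (β + 2) + 2 * i - 2) :
    Set.SurjOn (tripleOf i β) (SkytSet (α + 2) i (β + 2)) (TripleSet N (i + 1) β) := by
  rintro ⟨R, C, Y⟩ ⟨⟨hR, hC, hY⟩, ⟨hRC, hRY, hCY⟩, ⟨hRt, hCs, hYt⟩, hlast, hfirst, hballot⟩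
  simp only at hR hC hY hRC hRY hCY hRt hCs hYt hlast hfirst hballot
  set Z := Finset.Icc 1 N \ (R ∪ C ∪ Y) with hZdef
  have hZ : Z ⊆ Finset.Icc 1 N := Finset.sdiff_subset
  have hZc : Z.card = α := by
    rw [hZdef, Finset.card_sdiff_of_subset (Finset.union_subset (Finset.union_subset hR hC) hY),
      Finset.card_union_of_disjoint (Finset.disjoint_union_left.2 ⟨hRY, hCY⟩),
      Finset.card_union_of_disjoint hRC, Nat.card_Icc]
    omega
  have hZn : ∀ z ∈ Z, z ∉ R ∧ z ∉ C ∧ z ∉ Y := fun z hz => by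
    simp only [hZdef, Finset.mem_sdiff, Finset.mem_union, not_or] at hz
    tauto
  obtain ⟨eR, mR, iR, aR⟩ := exists_enumeration hR hRt
  obtain ⟨eC, mC, iC, aC⟩ := exists_enumeration hC hCs
  obtain ⟨eY, mY, iY, aY⟩ := exists_enumeration hY hYt
  obtain ⟨eZ, mZ, iZ, aZ⟩ := exists_enumeration hZ hZc
  have hne : ∀ {A B : Finset ℕ} {x y : ℕ}, Disjoint A B → x ∈ A → y ∈ B → x ≠ y :=
    fun hd hx hy h => Finset.disjoint_left.1 hd hx (h ▸ hy)
  have ltCR : ∀ k < β, eC k < eR i := fun k hk => by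
    obtain ⟨w, hw, hlt⟩ := hlast _ (aC k hk).1
    refine hlt.trans_le ((cnt_le_iff hw).1 ?_)
    have := cnt_le_card R w
    have := (aR i (by omega)).2
    omega
  have ltRY : ∀ c ≤ i, eR c < eY c := fun c hc => by
    have h1 := aR c (by omega)
    have h2 := aY c (by omega)
    have h3 := hballot (eY c)
    refine lt_of_le_of_ne ((cnt_le_iff h1.1).1 (by omega)) (hne hRY h1.1 h2.1)
  have ltYZ : ∀ k < α, eY 0 < eZ k := fun k hk => by
    have h1 := aY 0 (by omega)
    have h2 := aZ k hk
    have h3 := hZn _ h2.1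
    obtain ⟨y, hy, hyz⟩ := hfirst (eZ k) (by
      rw [Finset.mem_sdiff, Finset.mem_union]
      exact ⟨hZ h2.1, by tauto⟩)
    have h4 := cnt_pos hy hyz
    exact lt_of_le_of_ne ((cnt_le_iff h1.1).1 (by omega)) fun h => h3.2.2 (h ▸ h1.1)
  have eqOn : ∀ {e : ℕ → ℕ} {k : ℕ} {x y : ℕ}, StrictMonoOn e (Set.Iio k) → x < k → y < k →
      e x = e y → x = y := fun hm hx hy h => hm.injOn (Set.mem_Iio.2 hx) (Set.mem_Iio.2 hy) h
  set f := filling α i β eC eR eY eZ with hf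
  refine ⟨f, ⟨fun c hc => if_neg hc, ⟨?_, ?_, ?_⟩, ?_, ?_⟩, ?_⟩
  · rintro ⟨r, c⟩ hrc
    rw [← hN]
    rcases mem_skytCells.1 hrc with ⟨h1, rfl⟩ | ⟨rfl, h1⟩ | ⟨rfl, h1⟩ | ⟨h1, h2, rfl⟩
    · rw [hf, filling_top h1]
      exact hC (aC r h1).1
    · rw [hf, filling_upper h1]
      exact hR (aR c (by omega)).1
    · rw [hf, filling_lower h1]
      exact hY (aY c (by omega)).1
    · rw [hf, filling_bottom h1 h2]
      exact hZ (aZ _ (by omega)).1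
  · rintro ⟨r, c⟩ hrc ⟨r', c'⟩ hrc' h
    have hval : ∀ r c, (r, c) ∈ skytCells (α + 2) i (β + 2) →
        (r < β ↔ f (r, c) ∈ C) ∧ (r = β ↔ f (r, c) ∈ R) ∧ (r = β + 1 ↔ f (r, c) ∈ Y) := by
      intro r c hrc
      rcases mem_skytCells.1 hrc with ⟨h1, rfl⟩ | ⟨rfl, h1⟩ | ⟨rfl, h1⟩ | ⟨h1, h2, rfl⟩
      · rw [hf, filling_top h1]
        have h := (aC r h1).1
        have := Finset.disjoint_right.1 hRC h
        have := Finset.disjoint_left.1 hCY h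
        simp only [*, iff_false, true_and]
        omega
      · rw [hf, filling_upper h1]
        have h := (aR c (by omega)).1
        have := Finset.disjoint_left.1 hRC h
        have := Finset.disjoint_left.1 hRY h
        simp [*]
      · rw [hf, filling_lower h1]
        have h := (aY c (by omega)).1
        have := Finset.disjoint_right.1 hRY h
        have := Finset.disjoint_right.1 hCY h
        simp [*]
      · rw [hf, filling_bottom h1 h2]
        have h := hZn _ (aZ (r - (β + 2)) (by omega)).1
        simp only [h.1, h.2.1, h.2.2, iff_false]
        omega
    have v1 := hval r c hrc
    have v2 := hval r' c' hrc'
    rw [h] at v1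
    have e1 := v1.1.trans v2.1.symm
    have e2 := v1.2.1.trans v2.2.1.symm
    have e3 := v1.2.2.trans v2.2.2.symm
    rcases mem_skytCells.1 hrc with ⟨h1, rfl⟩ | ⟨rfl, h1⟩ | ⟨rfl, h1⟩ | ⟨h1, h2, rfl⟩
    · obtain ⟨h1', rfl⟩ : r' < β ∧ c' = c := by
        have := mem_skytCells.1 hrc'
        omega
      rw [hf, filling_top h1, filling_top h1'] at h
      rw [eqOn mC h1 h1' h]
    · obtain ⟨rfl, h1'⟩ : r' = r ∧ c' ≤ i := by
        have := mem_skytCells.1 hrc'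
        omega
      rw [hf, filling_upper h1, filling_upper h1'] at h
      rw [eqOn mR (by omega) (by omega) h]
    · obtain ⟨rfl, h1'⟩ : r' = β + 1 ∧ c' ≤ i := by
        have := mem_skytCells.1 hrc'
        omega
      rw [hf, filling_lower h1, filling_lower h1'] at h
      rw [eqOn mY (by omega) (by omega) h]
    · obtain ⟨h1', h2', rfl⟩ : β + 2 ≤ r' ∧ r' < α + β + 2 ∧ c' = 0 := by
        have := mem_skytCells.1 hrc'
        omega
      rw [hf, filling_bottom h1 h2, filling_bottom h1' h2'] at h
      have := eqOn mZ (by omega) (by omega) h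
      rw [show r = r' by omega]
  · intro z hz
    rw [← hN] at hz
    by_cases zR : z ∈ R
    · rw [← iR] at zR
      obtain ⟨c, hc, rfl⟩ := Finset.mem_image.1 zR
      rw [Finset.mem_range] at hc
      exact ⟨(β, c), mem_skytCells.2 (by omega), filling_upper (by omega)⟩
    by_cases zC : z ∈ C
    · rw [← iC] at zC
      obtain ⟨r, hr, rfl⟩ := Finset.mem_image.1 zC
      rw [Finset.mem_range] at hr
      exact ⟨(r, i), mem_skytCells.2 (by omega), filling_top hr⟩
    by_cases zY : z ∈ Y
    · rw [← iY] at zY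
      obtain ⟨c, hc, rfl⟩ := Finset.mem_image.1 zY
      rw [Finset.mem_range] at hc
      exact ⟨(β + 1, c), mem_skytCells.2 (by omega), filling_lower (by omega)⟩
    have zZ : z ∈ Z := by
      simp only [hZdef, Finset.mem_sdiff, Finset.mem_union, not_or]
      exact ⟨hz, ⟨zR, zC⟩, zY⟩
    rw [← iZ] at zZ
    obtain ⟨k, hk, rfl⟩ := Finset.mem_image.1 zZ
    rw [Finset.mem_range] at hk
    refine ⟨(β + 2 + k, 0), mem_skytCells.2 (by omega), ?_⟩
    rw [hf, filling_bottom (by omega) (by omega), Nat.add_sub_cancel_left]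
  · rintro ⟨r, c⟩ hrc ⟨r', c'⟩ hrc' h1 h2
    simp only at h1 h2
    subst h1
    have h3 := mem_skytCells.1 hrc
    have h4 := mem_skytCells.1 hrc'
    obtain rfl | rfl : r = β ∨ r = β + 1 := by omega
    · rw [hf, filling_upper (by omega), filling_upper (by omega)]
      exact mR (Set.mem_Iio.2 (by omega)) (Set.mem_Iio.2 (by omega)) h2
    · rw [hf, filling_lower (by omega), filling_lower (by omega)]
      exact mY (Set.mem_Iio.2 (by omega)) (Set.mem_Iio.2 (by omega)) h2
  · rintro ⟨r, c⟩ hrc ⟨r', c'⟩ hrc' h1 h2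
    simp only at h1 h2
    subst h1
    have h4 := mem_skytCells.1 hrc'
    rcases mem_skytCells.1 hrc with ⟨h1, rfl⟩ | ⟨rfl, h1⟩ | ⟨rfl, h1⟩ | ⟨h1, h3, rfl⟩
    · rw [hf, filling_top h1]
      obtain h5 | rfl | rfl : r' < β ∨ r' = β ∨ r' = β + 1 := by omega
      · rw [filling_top h5]
        exact mC (Set.mem_Iio.2 h1) (Set.mem_Iio.2 h5) h2
      · rw [filling_upper le_rfl]
        exact ltCR r h1
      · rw [filling_lower le_rfl]
        exact (ltCR r h1).trans (ltRY c le_rfl)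
    · rw [hf, filling_upper h1]
      obtain rfl | ⟨h5, h6, rfl⟩ : r' = r + 1 ∨ (r + 2 ≤ r' ∧ r' < α + r + 2 ∧ c = 0) := by omega
      · rw [filling_lower h1]
        exact ltRY c h1
      · rw [filling_bottom h5 h6]
        exact (ltRY 0 h1).trans (ltYZ _ (by omega))
    · obtain ⟨h5, h6, rfl⟩ : β + 2 ≤ r' ∧ r' < α + β + 2 ∧ c = 0 := by omega
      rw [hf, filling_lower h1, filling_bottom h5 h6]
      exact ltYZ _ (by omega)
    · obtain ⟨h5, h6⟩ : β + 2 ≤ r' ∧ r' < α + β + 2 := by omega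
      rw [hf, filling_bottom h1 h3, filling_bottom h5 h6]
      exact mZ (Set.mem_Iio.2 (by omega)) (Set.mem_Iio.2 (by omega)) (by omega)
  · simp only [tripleOf, Prod.mk.injEq]
    refine ⟨?_, ?_, ?_⟩
    · rw [← iR]
      exact Finset.image_congr fun c hc => filling_upper (by simp at hc; omega)
    · rw [← iC]
      exact Finset.image_congr fun c hc => filling_top (by simpa using hc)
    · rw [← iY]
      exact Finset.image_congr fun c hc => filling_lower (by simp at hc; omega)

end skyt

/-- Tableaux correspond to triples. -/
noncomputable def skytEquivTriple {α i β N : ℕ} (hi : 1 ≤ i)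
    (hN : N = α + 2 + (β + 2) + 2 * i - 2) :
    ↥(SkytSet (α + 2) i (β + 2)) ≃ ↥(TripleSet N (i + 1) β) :=
  Set.BijOn.equiv (tripleOf i β)
    ⟨fun _ hf => tripleOf_mem hN hf, tripleOf_injOn, tripleOf_surjOn hi hN⟩

end ArcTri

/-- For all integers `a, b ≥ 2` and `i ≥ 1`, `Skyt(a,i,b)` is in bijection with
`Tri(a+b+2i, i+1, b-2)`. -/
theorem skyt_equiv_tri (a b i : ℕ) (ha : 2 ≤ a) (hb : 2 ≤ b) (hi : 1 ≤ i) :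
    Nonempty (↥(SkytSet a i b) ≃ ↥(TriSet (a + b + 2 * i) (i + 1) (b - 2))) := by
  obtain ⟨α, rfl⟩ : ∃ α, a = α + 2 := ⟨a - 2, by omega⟩
  obtain ⟨β, rfl⟩ : ∃ β, b = β + 2 := ⟨b - 2, by omega⟩
  obtain ⟨N, hN⟩ : ∃ N, N = α + 2 + (β + 2) + 2 * i - 2 := ⟨_, rfl⟩
  rw [show α + 2 + (β + 2) + 2 * i = N + 2 by omega, Nat.add_sub_cancel]
  exact ⟨(ArcTri.skytEquivTriple hi hN).trans ((ArcTri.tripleEquivLuk N (i + 1) β).trans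
    (ArcTri.triEquivLuk (by omega) (i + 1) β).symm)⟩
end

section
/- For all nonnegative integers n, ℓ ≥ 1 and s with n ≥ s+2ℓ, the set Dyck(n,ℓ,s) of Dyck paths and the set Tri(n+2,ℓ,s) of triangulations have the same cardinality; that is, there is a bijection between Dyck(n,ℓ,s) and Tri(n+2,ℓ,s). -/
/-! ## Binary trees and their ascent sequences -/

/-- Add one to the head of a list, and turn the empty list into `[1]`. -/
def incrHead : List ℕ → List ℕ
  | [] => [1]
  | a :: L => (a + 1) :: L

/-- The ascent sequence of a binary tree: the lengths of its maximal left spines, in preorder. -/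
def treeAscents : BinaryTree Unit → List ℕ
  | .nil => []
  | .node _ x y => incrHead (treeAscents x) ++ treeAscents y

/-- The Dyck path of a binary tree, by first return decomposition. -/
def treeWord : BinaryTree Unit → List Bool
  | .nil => []
  | .node _ x y => true :: (treeWord x ++ false :: treeWord y)

/-- The chords, including the outer edge, of the triangulation of the polygon on the vertices
`p, …, p + t.numNodes + 1` encoded by the binary tree `t`. -/
def treeChords : ℕ → BinaryTree Unit → Finset (ℕ × ℕ)
  | _, .nil => ∅
  | p, .node _ x y => insert (p, p + (x.numNodes + y.numNodes + 1) + 1)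
      (treeChords p x ∪ treeChords (p + x.numNodes + 1) y)

theorem one_le_of_mem_incrHead {L : List ℕ} (h : ∀ a ∈ L, 1 ≤ a) : ∀ a ∈ incrHead L, 1 ≤ a := by
  cases L with
  | nil => simp [incrHead]
  | cons b L => simp only [incrHead, List.mem_cons] at *; grind

theorem one_le_of_mem_treeAscents (t : BinaryTree Unit) : ∀ a ∈ treeAscents t, 1 ≤ a := by
  induction t with
  | nil => simp [treeAscents]
  | node _ x y hx hy =>
    intro a ha
    rcases List.mem_append.1 ha with ha | ha
    · exact one_le_of_mem_incrHead hx a ha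
    · exact hy a ha

/-! ## Ascents of words -/

theorem splitBy_beq_cons_cons_self {α : Type*} [BEq α] [ReflBEq α] {a : α} {w g : List α}
    {gs : List (List α)} (h : (a :: w).splitBy (· == ·) = g :: gs) :
    (a :: a :: w).splitBy (· == ·) = (a :: g) :: gs := by
  rw [List.splitBy_eq_iff] at h ⊢
  obtain ⟨h1, h2, h3, h4⟩ := h
  have hg : g ≠ [] := by rintro rfl; simp at h2
  obtain ⟨b, g, rfl⟩ := List.exists_cons_of_ne_nil hg
  have hab : a = b := by simp at h1; exact h1.1
  subst hab
  refine ⟨by simp [h1], by simpa using h2, ?_, ?_⟩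
  · intro m hm
    rcases List.mem_cons.1 hm with rfl | hm
    · have := h3 (a :: g) (by simp)
      exact List.isChain_cons_cons.2 ⟨by simp, this⟩
    · exact h3 m (by simp [hm])
  · cases gs with
    | nil => simp
    | cons k gs =>
      rw [List.isChain_cons_cons] at h4 ⊢
      refine ⟨?_, h4.2⟩
      obtain ⟨ha, hb, h⟩ := h4.1
      exact ⟨by simp, hb, by simpa using h⟩

theorem splitBy_beq_cons_of_ne {a b : Bool} (w : List Bool) (h : a ≠ b) :
    (a :: b :: w).splitBy (· == ·) = [a] :: (b :: w).splitBy (· == ·) := by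
  have := List.splitBy_append_cons (r := (· == ·)) (l := [a]) (a := b) w (by simpa using h)
  simpa [List.splitBy, List.splitBy.loop] using this

theorem exists_splitBy_beq_cons {α : Type*} [BEq α] [ReflBEq α] (a : α) (w : List α) :
    ∃ g gs, (a :: w).splitBy (· == ·) = (a :: g) :: gs := by
  induction w with
  | nil => exact ⟨[], [], by simp [List.splitBy, List.splitBy.loop]⟩
  | cons b w _ =>
    have hne : (a :: b :: w).splitBy (· == ·) ≠ [] := by simp
    obtain ⟨g, gs, h⟩ := List.exists_cons_of_ne_nil hne
    have h' := h
    rw [List.splitBy_eq_iff] at h'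
    have hg : g ≠ [] := by rintro rfl; simp at h'
    obtain ⟨c, g, rfl⟩ := List.exists_cons_of_ne_nil hg
    have hac : a = c := by have := h'.1; simp at this; exact this.1
    exact ⟨g, gs, by rw [h, hac]⟩

@[simp]
theorem ascentLengths_nil : ascentLengths [] = [] := rfl

@[simp]
theorem ascentLengths_false_cons (w : List Bool) :
    ascentLengths (false :: w) = ascentLengths w := by
  match w with
  | [] => simp [ascentLengths, List.splitBy, List.splitBy.loop]
  | true :: w => simp [ascentLengths, splitBy_beq_cons_of_ne]
  | false :: w =>
    obtain ⟨g, gs, h⟩ := exists_splitBy_beq_cons false w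
    simp [ascentLengths, splitBy_beq_cons_cons_self h, h]

theorem ascentLengths_true_cons_true_cons (w : List Bool) :
    ascentLengths (true :: true :: w) = incrHead (ascentLengths (true :: w)) := by
  obtain ⟨g, gs, h⟩ := exists_splitBy_beq_cons true w
  simp [ascentLengths, splitBy_beq_cons_cons_self h, h, incrHead, List.filter_cons]

theorem ascentLengths_true_cons_false_cons (w : List Bool) :
    ascentLengths (true :: false :: w) = 1 :: ascentLengths w := by
  rw [← ascentLengths_false_cons w]
  simp only [ascentLengths, splitBy_beq_cons_of_ne w (show true ≠ false by simp)]
  simp [List.filter_cons]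

theorem ascentLengths_true_cons_ne_nil (w : List Bool) : ascentLengths (true :: w) ≠ [] := by
  obtain ⟨g, gs, h⟩ := exists_splitBy_beq_cons true w
  simp [ascentLengths, h]

theorem incrHead_append {L : List ℕ} (h : L ≠ []) (M : List ℕ) :
    incrHead (L ++ M) = incrHead L ++ M := by
  cases L with
  | nil => exact absurd rfl h
  | cons a L => rfl

theorem ascentLengths_append_false_cons (x y : List Bool) :
    ascentLengths (x ++ false :: y) = ascentLengths x ++ ascentLengths y := by
  induction x with
  | nil => simp
  | cons b x ih =>
    match b, x with
    | false, x => simpa using ih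
    | true, [] => exact ascentLengths_true_cons_false_cons y
    | true, true :: x =>
      simp only [List.cons_append] at ih ⊢
      rw [ascentLengths_true_cons_true_cons, ascentLengths_true_cons_true_cons, ih,
        incrHead_append (ascentLengths_true_cons_ne_nil x)]
    | true, false :: x =>
      simp only [List.cons_append, ascentLengths_false_cons] at ih ⊢
      rw [ascentLengths_true_cons_false_cons, ascentLengths_true_cons_false_cons, ih]
      rfl

theorem ascentLengths_treeWord (t : BinaryTree Unit) :
    ascentLengths (treeWord t) = treeAscents t := by
  induction t with
  | nil => rfl
  | node _ x y hx hy =>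
    cases x with
    | nil =>
      simp [treeWord, treeAscents, ascentLengths_true_cons_false_cons, hy, incrHead]
    | node _ u v =>
      rw [treeWord, treeAscents, ← hx, ← hy, treeWord, ← incrHead_append
        (ascentLengths_true_cons_ne_nil _), ← ascentLengths_append_false_cons]
      exact ascentLengths_true_cons_true_cons _

/-! ## Dyck paths and binary trees -/

theorem treeWord_eq_map_ofTree (t : BinaryTree Unit) :
    treeWord t = (DyckWord.ofTree t).toList.map fun d => decide (d = DyckStep.U) := by
  induction t with
  | nil => rfl
  | node _ x y hx hy =>
    have : (DyckWord.ofTree (.node () x y)).toList =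
        ([DyckStep.U] ++ (DyckWord.ofTree x).toList ++ [DyckStep.D]) ++
          (DyckWord.ofTree y).toList := rfl
    rw [this]
    simp [treeWord, hx, hy]

theorem dyckStep_decide_injective :
    Function.Injective fun d : DyckStep => decide (d = DyckStep.U) := by
  intro a b; cases a <;> cases b <;> simp

theorem treeWord_injective : Function.Injective treeWord := by
  intro a b h
  rw [treeWord_eq_map_ofTree, treeWord_eq_map_ofTree] at h
  exact DyckWord.equivTree.symm.injective
    (DyckWord.ext (List.map_injective_iff.2 dyckStep_decide_injective h))

theorem length_treeWord (t : BinaryTree Unit) : (treeWord t).length = 2 * t.numNodes := by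
  induction t with
  | nil => rfl
  | node _ x y hx hy => simp [treeWord, BinaryTree.numNodes, hx, hy]; ring

theorem count_true_map (L : List DyckStep) :
    (L.map fun d => decide (d = DyckStep.U)).count true = L.count DyckStep.U :=
  List.count_map_of_injective L _ dyckStep_decide_injective DyckStep.U

theorem count_false_map (L : List DyckStep) :
    (L.map fun d => decide (d = DyckStep.U)).count false = L.count DyckStep.D :=
  List.count_map_of_injective L _ dyckStep_decide_injective DyckStep.D

theorem exists_treeWord_eq_iff (w : List Bool) :
    (∃ t, treeWord t = w) ↔
      w.count true = w.count false ∧ ∀ p, p <+: w → p.count false ≤ p.count true := by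
  constructor
  · rintro ⟨t, rfl⟩
    rw [treeWord_eq_map_ofTree]
    refine ⟨?_, fun p hp => ?_⟩
    · rw [count_true_map, count_false_map, DyckWord.count_U_eq_count_D]
    · rw [List.prefix_iff_eq_take.1 hp, ← List.map_take, count_true_map, count_false_map]
      exact DyckWord.count_D_le_count_U _ _
  · rintro ⟨h1, h2⟩
    obtain ⟨L, rfl⟩ : ∃ L : List DyckStep, (L.map fun d => decide (d = DyckStep.U)) = w := by
      refine ⟨w.map fun b => if b then DyckStep.U else DyckStep.D, ?_⟩
      rw [List.map_map]
      convert List.map_id w using 2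
      funext b
      cases b <;> rfl
    rw [count_true_map, count_false_map] at h1
    refine ⟨DyckWord.toTree ⟨L, h1, fun i => ?_⟩, ?_⟩
    · have := h2 _ (List.take_prefix i _)
      rwa [← List.map_take, count_true_map, count_false_map] at this
    · rw [treeWord_eq_map_ofTree, DyckWord.ofTree_toTree]

/-! ## Triangulations of intervals and binary trees -/

/-- `A` consists of the diagonals and the outer edge (when it is not a side) of a triangulation
of the polygon on the vertices `p, …, r`. -/
structure IsIntervalTriangulation (p r : ℕ) (A : Finset (ℕ × ℕ)) : Prop where
  bounds : ∀ a b, (a, b) ∈ A → p ≤ a ∧ a + 1 < b ∧ b ≤ r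
  not_crosses : ∀ c ∈ A, ∀ d ∈ A, ¬Crosses c d
  mem_of_not_crosses : ∀ a b, p ≤ a → a + 1 < b → b ≤ r →
    (∀ d ∈ A, ¬Crosses (a, b) d) → (a, b) ∈ A

theorem mem_treeChords_bounds (t : BinaryTree Unit) : ∀ p a b, (a, b) ∈ treeChords p t →
    p ≤ a ∧ a + 1 < b ∧ b ≤ p + t.numNodes + 1 := by
  induction t with
  | nil => simp [treeChords]
  | node _ x y hx hy =>
    intro p a b h
    simp only [treeChords, Finset.mem_insert, Finset.mem_union, Prod.mk.injEq] at h
    simp only [BinaryTree.numNodes]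
    rcases h with h | h | h
    · omega
    · have := hx _ _ _ h; omega
    · have := hy _ _ _ h; omega

theorem outer_mem_treeChords {t : BinaryTree Unit} (ht : 1 ≤ t.numNodes) (p : ℕ) :
    (p, p + t.numNodes + 1) ∈ treeChords p t := by
  cases t with
  | nil => simp [BinaryTree.numNodes] at ht
  | node _ x y => simp [treeChords, BinaryTree.numNodes, add_assoc]

theorem isIntervalTriangulation_treeChords (t : BinaryTree Unit) (p : ℕ) :
    IsIntervalTriangulation p (p + t.numNodes + 1) (treeChords p t) := by
  induction t generalizing p with
  | nil =>
    refine ⟨by simp [treeChords], by simp [treeChords], fun a b h1 h2 h3 => ?_⟩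
    simp only [BinaryTree.numNodes] at h3
    omega
  | node _ x y hx hy =>
    have bx := mem_treeChords_bounds x p
    have b_y := mem_treeChords_bounds y (p + x.numNodes + 1)
    refine ⟨mem_treeChords_bounds _ _, ?_, ?_⟩
    · rintro ⟨a, b⟩ hc ⟨a', b'⟩ hd
      simp only [treeChords, Finset.mem_insert, Finset.mem_union, Prod.mk.injEq] at hc hd
      have cx := (hx p).not_crosses (a, b)
      have cy := (hy (p + x.numNodes + 1)).not_crosses (a, b)
      rcases hc with hc | hc | hc <;> rcases hd with hd | hd | hd
      · simp only [Crosses]; omega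
      · have := bx _ _ hd; simp only [Crosses]; omega
      · have := b_y _ _ hd; simp only [Crosses]; omega
      · have := bx _ _ hc; simp only [Crosses]; omega
      · exact cx hc _ hd
      · have := bx _ _ hc; have := b_y _ _ hd; simp only [Crosses]; omega
      · have := b_y _ _ hc; simp only [Crosses]; omega
      · have := b_y _ _ hc; have := bx _ _ hd; simp only [Crosses]; omega
      · exact cy hc _ hd
    · intro a b h1 h2 h3 h
      simp only [BinaryTree.numNodes] at h3
      simp only [treeChords, Finset.mem_insert, Finset.mem_union, Prod.mk.injEq] at h ⊢
      by_cases hbm : b ≤ p + x.numNodes + 1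
      · exact Or.inr (Or.inl ((hx p).mem_of_not_crosses a b h1 h2 hbm
          fun d hd => h d (Or.inr (Or.inl hd))))
      by_cases ham : p + x.numNodes + 1 ≤ a
      · exact Or.inr (Or.inr ((hy _).mem_of_not_crosses a b ham h2 (by omega)
          fun d hd => h d (Or.inr (Or.inr hd))))
      refine Or.inl ?_
      by_contra hne
      by_cases hb : b < p + (x.numNodes + y.numNodes + 1) + 1
      · refine h _ (Or.inr (Or.inr (outer_mem_treeChords (t := y) (by omega) _))) ?_
        simp only [Crosses]; omega
      · refine h _ (Or.inr (Or.inl (outer_mem_treeChords (t := x) (by omega) _))) ?_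
        simp only [Crosses]; omega

theorem numNodes_le_of_treeChords_eq {x y x' y' : BinaryTree Unit} {p : ℕ}
    (hn : x.numNodes + y.numNodes = x'.numNodes + y'.numNodes)
    (h : treeChords p (.node () x y) = treeChords p (.node () x' y')) :
    x'.numNodes ≤ x.numNodes := by
  by_contra! hlt
  have hm : (p, p + x'.numNodes + 1) ∈ treeChords p (.node () x y) := by
    rw [h]
    simp [treeChords, outer_mem_treeChords (t := x') (by omega) p]
  simp only [treeChords, Finset.mem_insert, Finset.mem_union, Prod.mk.injEq] at hm
  rcases hm with hm | hm | hm
  · omega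
  · have := mem_treeChords_bounds _ _ _ _ hm; omega
  · have := mem_treeChords_bounds _ _ _ _ hm; omega

theorem treeChords_injective (t : BinaryTree Unit) : ∀ (t' : BinaryTree Unit) (p : ℕ),
    t.numNodes = t'.numNodes → treeChords p t = treeChords p t' → t = t' := by
  induction t with
  | nil =>
    intro t' p hn _
    cases t' with
    | nil => rfl
    | node => simp [BinaryTree.numNodes] at hn
  | node _ x y hx hy =>
    intro t' p hn h
    cases t' with
    | nil => simp [BinaryTree.numNodes] at hn
    | node _ x' y' =>
      simp only [BinaryTree.numNodes] at hn
      have e : x.numNodes = x'.numNodes :=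
        le_antisymm (numNodes_le_of_treeChords_eq (by omega) h.symm)
          (numNodes_le_of_treeChords_eq (by omega) h)
      have key : ∀ a b, (a, b) ∈ treeChords p (.node () x y) ↔
          (a, b) ∈ treeChords p (.node () x' y') := fun a b => by rw [h]
      simp only [treeChords, Finset.mem_insert, Finset.mem_union, Prod.mk.injEq, ← e] at key
      have hxx : x = x' := by
        refine hx x' p e (Finset.ext fun ⟨a, b⟩ => ?_)
        have k := key a b
        have b1 := mem_treeChords_bounds x p a b
        have b2 := mem_treeChords_bounds x' p a b
        have b3 := mem_treeChords_bounds y (p + x.numNodes + 1) a b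
        have b4 := mem_treeChords_bounds y' (p + x.numNodes + 1) a b
        constructor
        · intro hh
          have := b1 hh
          rcases k.1 (Or.inr (Or.inl hh)) with h | h | h
          · omega
          · exact h
          · have := b4 h; omega
        · intro hh
          have := b2 hh
          rcases k.2 (Or.inr (Or.inl hh)) with h | h | h
          · omega
          · exact h
          · have := b3 h; omega
      have hyy : y = y' := by
        refine hy y' (p + x.numNodes + 1) (by omega) (Finset.ext fun ⟨a, b⟩ => ?_)
        have k := key a b
        have b1 := mem_treeChords_bounds x p a b
        have b2 := mem_treeChords_bounds x' p a b
        have b3 := mem_treeChords_bounds y (p + x.numNodes + 1) a b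
        have b4 := mem_treeChords_bounds y' (p + x.numNodes + 1) a b
        constructor
        · intro hh
          have := b3 hh
          rcases k.1 (Or.inr (Or.inr hh)) with h | h | h
          · omega
          · have := b2 h; omega
          · exact h
        · intro hh
          have := b4 hh
          rcases k.2 (Or.inr (Or.inr hh)) with h | h | h
          · omega
          · have := b1 h; omega
          · exact h
      rw [hxx, hyy]

/-- The apex `m` of the triangle of a triangulation of `p, …, r` on its outer edge. -/
theorem IsIntervalTriangulation.exists_apex {p r : ℕ} {A : Finset (ℕ × ℕ)}
    (hA : IsIntervalTriangulation p r A) (hpr : p + 1 < r) :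
    ∃ m, p < m ∧ m < r ∧ (p, r) ∈ A ∧
      ∀ a b, (a, b) ∈ A → (a = p ∧ b = r) ∨ b ≤ m ∨ m ≤ a := by
  obtain ⟨m, hm1, hm2, hm3, hmax⟩ : ∃ m, p < m ∧ m < r ∧ (m = p + 1 ∨ (p, m) ∈ A) ∧
      ∀ c, (p, c) ∈ A → c < r → c ≤ m := by
    obtain ⟨m, hm, hmax⟩ := ((Finset.Ioo p r).filter
      fun m => m = p + 1 ∨ (p, m) ∈ A).exists_max_image id ⟨p + 1, by simp; omega⟩
    simp only [Finset.mem_filter, Finset.mem_Ioo, id] at hm hmax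
    refine ⟨m, hm.1.1, hm.1.2, hm.2, fun c hc hcr => hmax c ⟨⟨?_, hcr⟩, Or.inr hc⟩⟩
    have := hA.bounds _ _ hc
    omega
  refine ⟨m, hm1, hm2, hA.mem_of_not_crosses p r le_rfl hpr le_rfl ?_, ?_⟩
  · rintro ⟨a, b⟩ hd
    have := hA.bounds _ _ hd
    simp only [Crosses]; omega
  · intro a b hab
    by_contra! hne
    have hb := hA.bounds _ _ hab
    by_cases hap : a = p
    · subst hap
      have := hmax b hab
      omega
    · rcases hm3 with hm3 | hm3
      · omega
      · refine hA.not_crosses _ hm3 _ hab ?_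
        simp only [Crosses]; omega

theorem IsIntervalTriangulation.exists_tree (k : ℕ) : ∀ (p : ℕ) (A : Finset (ℕ × ℕ)),
    IsIntervalTriangulation p (p + k + 1) A → ∃ t, t.numNodes = k ∧ treeChords p t = A := by
  induction k using Nat.strong_induction_on with
  | _ k ih =>
    intro p A hA
    rcases Nat.eq_zero_or_pos k with rfl | hk
    · refine ⟨.nil, rfl, (Finset.eq_empty_of_forall_notMem ?_).symm⟩
      rintro ⟨a, b⟩ h
      have := hA.bounds _ _ h
      omega
    obtain ⟨m, hpm, hmr, hr, hsplit⟩ := hA.exists_apex (by omega)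
    obtain ⟨i, rfl⟩ : ∃ i, m = p + i + 1 := ⟨m - p - 1, by omega⟩
    obtain ⟨j, rfl⟩ : ∃ j, k = i + j + 1 := ⟨k - i - 1, by omega⟩
    obtain ⟨x, hx, hxA⟩ := ih i (by omega) p (A.filter fun c => c.2 ≤ p + i + 1) <| by
      refine ⟨fun a b h => ?_, fun c hc d hd => ?_, fun a b h1 h2 h3 h => ?_⟩
      · rw [Finset.mem_filter] at h
        have := hA.bounds _ _ h.1
        omega
      · exact hA.not_crosses c (Finset.mem_filter.1 hc).1 d (Finset.mem_filter.1 hd).1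
      · refine Finset.mem_filter.2 ⟨hA.mem_of_not_crosses a b h1 h2 (by omega) ?_, h3⟩
        rintro ⟨a', b'⟩ hd
        have hbd := hA.bounds _ _ hd
        rcases hsplit _ _ hd with hs | hs | hs
        · simp only [Crosses]; omega
        · exact h _ (Finset.mem_filter.2 ⟨hd, hs⟩)
        · simp only [Crosses]; omega
    obtain ⟨y, hy, hyA⟩ := ih j (by omega) (p + i + 1) (A.filter fun c => p + i + 1 ≤ c.1) <| by
      refine ⟨fun a b h => ?_, fun c hc d hd => ?_, fun a b h1 h2 h3 h => ?_⟩
      · rw [Finset.mem_filter] at h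
        have := hA.bounds _ _ h.1
        omega
      · exact hA.not_crosses c (Finset.mem_filter.1 hc).1 d (Finset.mem_filter.1 hd).1
      · refine Finset.mem_filter.2 ⟨hA.mem_of_not_crosses a b (by omega) h2 (by omega) ?_, h1⟩
        rintro ⟨a', b'⟩ hd
        have hbd := hA.bounds _ _ hd
        rcases hsplit _ _ hd with hs | hs | hs
        · simp only [Crosses]; omega
        · simp only [Crosses]; omega
        · exact h _ (Finset.mem_filter.2 ⟨hd, hs⟩)
    refine ⟨.node () x y, by simp [BinaryTree.numNodes, hx, hy], ?_⟩
    ext ⟨a, b⟩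
    simp only [treeChords, hx, hy, hxA, hyA, Finset.mem_insert, Finset.mem_union,
      Finset.mem_filter, Prod.mk.injEq]
    constructor
    · rintro (⟨rfl, rfl⟩ | h | h)
      · exact hr
      · exact h.1
      · exact h.1
    · intro h
      rcases hsplit _ _ h with hs | hs | hs
      · exact Or.inl hs
      · exact Or.inr (Or.inl ⟨h, hs⟩)
      · exact Or.inr (Or.inr ⟨h, hs⟩)

theorem isTriangulation_iff {n : ℕ} (hn : 2 < n) (S : Finset (ℕ × ℕ)) :
    IsTriangulation n S ↔ (1, n) ∉ S ∧ IsIntervalTriangulation 1 n (insert (1, n) S) := by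
  constructor
  · rintro ⟨⟨h1, h2⟩, h3⟩
    have hnot : (1, n) ∉ S := fun h => (h1 _ h).2.2.2 ⟨rfl, rfl⟩
    refine ⟨hnot, ⟨fun a b h => ?_, ?_, fun a b ha hab hb h => ?_⟩⟩
    · rcases Finset.mem_insert.1 h with h | h
      · simp only [Prod.mk.injEq] at h
        omega
      · have := h1 _ h
        exact ⟨this.1, this.2.1, this.2.2.1⟩
    · rintro ⟨a, b⟩ hc ⟨a', b'⟩ hd
      rcases Finset.mem_insert.1 hc with hc | hc <;> rcases Finset.mem_insert.1 hd with hd | hd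
      · simp only [Prod.mk.injEq] at hc hd
        simp only [Crosses]; omega
      · have := h1 _ hd
        simp only [Prod.mk.injEq, IsChord] at hc this
        simp only [Crosses]; omega
      · have := h1 _ hc
        simp only [Prod.mk.injEq, IsChord] at hd this
        simp only [Crosses]; omega
      · by_cases he : (a, b) = (a', b')
        · simp only [Prod.mk.injEq] at he
          simp only [Crosses]; omega
        · exact h2 _ hc _ hd he
    · rw [Finset.mem_insert]
      by_cases he : (a, b) = (1, n)
      · exact Or.inl he
      · refine Or.inr (h3 _ ⟨ha, hab, hb, ?_⟩ fun d hd => h d (Finset.mem_insert_of_mem hd))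
        simpa using he
  · rintro ⟨hnot, h⟩
    refine ⟨⟨?_, fun c hc d hd _ => h.not_crosses _ (Finset.mem_insert_of_mem hc) _
      (Finset.mem_insert_of_mem hd)⟩, ?_⟩
    · rintro ⟨a, b⟩ hc
      have := h.bounds _ _ (Finset.mem_insert_of_mem hc)
      refine ⟨this.1, this.2.1, this.2.2, ?_⟩
      rintro ⟨ha, hb⟩
      simp only at ha hb
      exact hnot (ha ▸ hb ▸ hc)
    · rintro ⟨a, b⟩ ⟨h1, h2, h3, h4⟩ hcr
      have hmem := h.mem_of_not_crosses a b h1 h2 h3 <| by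
        intro d hd
        rcases Finset.mem_insert.1 hd with rfl | hd
        · simp only [Crosses] at *; omega
        · exact hcr d hd
      rcases Finset.mem_insert.1 hmem with he | he
      · simp only [Prod.mk.injEq] at he h4
        exact absurd he h4
      · exact he

/-! ## Fan decompositions and ascent sequences -/

/-- The inner endpoints, in increasing order, of the diagonals at `p` inside `p, …, r`. -/
def fanEnds (S : Finset (ℕ × ℕ)) (p r : ℕ) : List ℕ :=
  ((S.filter fun c => c.1 = p ∧ p + 1 < c.2 ∧ c.2 < r).image Prod.snd).sort (· ≤ ·)

theorem mem_fanEnds {S : Finset (ℕ × ℕ)} {p r c : ℕ} :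
    c ∈ fanEnds S p r ↔ (p, c) ∈ S ∧ p + 1 < c ∧ c < r := by
  simp only [fanEnds, Finset.mem_sort, Finset.mem_image, Finset.mem_filter, Prod.exists]
  constructor
  · rintro ⟨a, b, ⟨h1, rfl, h2, h3⟩, rfl⟩
    exact ⟨h1, h2, h3⟩
  · rintro ⟨h1, h2, h3⟩
    exact ⟨p, c, ⟨h1, rfl, h2, h3⟩, rfl⟩

theorem fanEnds_eq_append {S : Finset (ℕ × ℕ)} {p m r : ℕ} (hm : p + 1 < m) (hmr : m < r)
    (hmem : (p, m) ∈ S) (hmax : ∀ c, (p, c) ∈ S → c < r → c ≤ m) :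
    fanEnds S p r = fanEnds S p m ++ [m] := by
  have hs : ∀ q, (fanEnds S p q).Pairwise (· < ·) := fun q =>
    (Finset.sortedLT_sort _).pairwise
  refine List.Perm.eq_of_pairwise (le := (· < ·)) (fun a b _ _ h h' => absurd h (lt_asymm h'))
    (hs r) ?_ ?_
  · rw [List.pairwise_append]
    refine ⟨hs m, by simp, fun a ha b hb => ?_⟩
    rw [List.mem_singleton.1 hb]
    exact (mem_fanEnds.1 ha).2.2
  · rw [List.perm_ext_iff_of_nodup ((hs r).imp ne_of_lt)]
    · intro c
      simp only [List.mem_append, mem_fanEnds, List.mem_singleton]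
      constructor
      · rintro ⟨h1, h2, h3⟩
        rcases (hmax c h1 h3).lt_or_eq with h | h
        · exact Or.inl ⟨h1, h2, h⟩
        · exact Or.inr h
      · rintro (⟨h1, h2, h3⟩ | rfl)
        · exact ⟨h1, h2, h3.trans hmr⟩
        · exact ⟨hmem, hm, hmr⟩
    · rw [List.nodup_append]
      refine ⟨(hs m).imp ne_of_lt, by simp, fun a ha b hb => ?_⟩
      rw [List.mem_singleton.1 hb]
      exact (mem_fanEnds.1 ha).2.2.ne

theorem fanListAux_succ (S : Finset (ℕ × ℕ)) (f : ℕ) {p r : ℕ} (h : p + 1 < r) :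
    fanListAux S (f + 1) p r = (p, (fanEnds S p r).length + 1) ::
      (((p + 1) :: (fanEnds S p r ++ [r])).zip (fanEnds S p r ++ [r])).flatMap
        fun q => fanListAux S f q.1 q.2 := by
  rw [fanListAux, if_neg (by omega)]
  rfl

theorem cons_zip_append_singleton {α : Type*} (a m r : α) (L : List α) :
    ((a :: (L ++ [m] ++ [r])).zip (L ++ [m] ++ [r])) =
      (a :: (L ++ [m])).zip (L ++ [m]) ++ [(m, r)] := by
  induction L generalizing a with
  | nil => rfl
  | cons b L ih => simpa using ih b

theorem map_snd_fanListAux (S : Finset (ℕ × ℕ)) (t : BinaryTree Unit) : ∀ (f p : ℕ),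
    t.numNodes + 1 ≤ f →
    (∀ a b, p ≤ a → b ≤ p + t.numNodes + 1 → ¬(a = p ∧ b = p + t.numNodes + 1) →
      ((a, b) ∈ S ↔ (a, b) ∈ treeChords p t)) →
    (fanListAux S f p (p + t.numNodes + 1)).map Prod.snd = treeAscents t := by
  induction t with
  | nil =>
    intro f p hf _
    obtain ⟨f, rfl⟩ : ∃ g, f = g + 1 := ⟨f - 1, by omega⟩
    simp [fanListAux, BinaryTree.numNodes, treeAscents]
  | node _ x y hx hy =>
    intro f p hf h
    obtain ⟨f, rfl⟩ : ∃ g, f = g + 1 := ⟨f - 1, by omega⟩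
    simp only [BinaryTree.numNodes] at hf h ⊢
    have key : ∀ a b, p ≤ a → b ≤ p + (x.numNodes + y.numNodes + 1) + 1 →
        ¬(a = p ∧ b = p + (x.numNodes + y.numNodes + 1) + 1) →
        ((a, b) ∈ S ↔ (a, b) ∈ treeChords p x ∨ (a, b) ∈ treeChords (p + x.numNodes + 1) y) := by
      intro a b h1 h2 h3
      rw [h a b h1 h2 h3, treeChords, Finset.mem_insert, Finset.mem_union, Prod.mk.injEq]
      exact or_iff_right h3
    have bx := mem_treeChords_bounds x p
    have b_y := mem_treeChords_bounds y (p + x.numNodes + 1)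
    have hyl := hy f (p + x.numNodes + 1) (by omega) fun a b h1 h2 _ => by
      rw [key a b (by omega) (by omega) (by omega)]
      refine or_iff_right fun hh => ?_
      have := bx _ _ hh
      omega
    have er : p + x.numNodes + 1 + y.numNodes + 1 = p + (x.numNodes + y.numNodes + 1) + 1 := by
      omega
    rw [er] at hyl
    rw [fanListAux_succ S f (by omega), treeAscents]
    rcases Nat.eq_zero_or_pos x.numNodes with h0 | hpos
    · have hxn : x = .nil := by
        cases x with
        | nil => rfl
        | node => simp [BinaryTree.numNodes] at h0
      have hnil : fanEnds S p (p + (x.numNodes + y.numNodes + 1) + 1) = [] := by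
        refine List.eq_nil_iff_forall_not_mem.2 fun c hc => ?_
        rw [mem_fanEnds] at hc
        rcases (key p c le_rfl (by omega) (by omega)).1 hc.1 with hh | hh
        · have := bx _ _ hh; omega
        · have := b_y _ _ hh; omega
      rw [hnil]
      have e1 : p + x.numNodes + 1 = p + 1 := by omega
      rw [e1] at hyl
      simp [hxn, treeAscents, incrHead]
      simpa [hxn] using hyl
    · have hmem : (p, p + x.numNodes + 1) ∈ S :=
        (key _ _ le_rfl (by omega) (by omega)).2 (Or.inl (outer_mem_treeChords hpos p))
      have hmax : ∀ c, (p, c) ∈ S → c < p + (x.numNodes + y.numNodes + 1) + 1 →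
          c ≤ p + x.numNodes + 1 := by
        intro c hc hlt
        rcases (key p c le_rfl (by omega) (by omega)).1 hc with hh | hh
        · have := bx _ _ hh; omega
        · have := b_y _ _ hh; omega
      have hxl := hx (f + 1) p (by omega) fun a b h1 h2 h3 => by
        rw [key a b (by omega) (by omega) (by omega)]
        refine or_iff_left fun hh => ?_
        have := b_y _ _ hh
        omega
      rw [fanListAux_succ S f (by omega)] at hxl
      rw [fanEnds_eq_append (by omega) (by omega) hmem hmax, cons_zip_append_singleton, ← hxl, ← hyl]
      simp [incrHead]

theorem map_snd_fanList_erase (t : BinaryTree Unit) :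
    (fanList ((treeChords 1 t).erase (1, t.numNodes + 2)) 1 (t.numNodes + 2)).map Prod.snd =
      treeAscents t := by
  have := map_snd_fanListAux ((treeChords 1 t).erase (1, t.numNodes + 2)) t (t.numNodes + 1) 1
    le_rfl fun a b _ _ h => by
      rw [Finset.mem_erase]
      refine and_iff_right fun he => h ?_
      simp only [Prod.mk.injEq] at he
      omega
  rwa [show 1 + t.numNodes + 1 = t.numNodes + 2 by omega] at this

/-! ## The bijection -/

/-- Binary trees with `n` nodes whose ascent sequence has `l` entries at least `2`, `s` entries
equal to `1`, and last entry different from `1`. -/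
def treeSet (n l s : ℕ) : Set (BinaryTree Unit) :=
  {t | t.numNodes = n ∧ (treeAscents t).length = l + s ∧
    ((treeAscents t).filter fun x => decide (x = 1)).length = s ∧ (treeAscents t).getLastD 0 ≠ 1}

theorem length_filter_two_le_add {L : List ℕ} (hL : ∀ a ∈ L, 1 ≤ a) :
    (L.filter fun x => decide (2 ≤ x)).length + (L.filter fun x => decide (x = 1)).length =
      L.length := by
  induction L with
  | nil => rfl
  | cons a L ih =>
    have h1 := hL a (by simp)
    have := ih fun b hb => hL b (by simp [hb])
    rcases h1.lt_or_eq with h | h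
    · simp [show 2 ≤ a from h, show a ≠ 1 by omega]; omega
    · subst h; simp; omega

theorem getLastD_ne_one_iff {L : List ℕ} (hL : ∀ a ∈ L, 1 ≤ a) :
    L.getLastD 0 ≠ 1 ↔
      ∀ j, L.getD j 0 = 1 → ∃ k, j < k ∧ 2 ≤ L.getD k 0 := by
  rcases L.eq_nil_or_concat with rfl | ⟨M, a, rfl⟩
  · simp
  have ha : 1 ≤ a := hL a (by simp)
  have hlast : (M ++ [a]).getD M.length 0 = a := by simp
  have hout : ∀ k, M.length < k → (M ++ [a]).getD k 0 = 0 := fun k hk => by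
    rw [List.getD_eq_default]; simp; omega
  have : (M.concat a).getLastD 0 = a := by simp
  simp only [List.concat_eq_append] at this ⊢
  rw [this]
  constructor
  · intro h j hj
    refine ⟨M.length, ?_, by omega⟩
    by_contra! hle
    rcases hle.lt_or_eq with hlt | rfl
    · rw [hout j hlt] at hj; omega
    · omega
  · rintro h rfl
    obtain ⟨k, hk, h2⟩ := h M.length hlast
    rw [hout k hk] at h2
    omega

theorem treeWord_image_treeSet (n l s : ℕ) : treeWord '' treeSet n l s = DyckSet n l s := by
  have key : ∀ t, t ∈ treeSet n l s ↔ treeWord t ∈ DyckSet n l s := by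
    intro t
    have h1 := one_le_of_mem_treeAscents t
    have hw := (exists_treeWord_eq_iff (treeWord t)).1 ⟨t, rfl⟩
    have hlen := length_filter_two_le_add h1
    simp only [treeSet, DyckSet, Set.mem_ofPred_eq, ascentLengths_treeWord, length_treeWord,
      getLastD_ne_one_iff h1]
    constructor
    · rintro ⟨a, b, c, d⟩
      exact ⟨by omega, hw.1, hw.2, by omega, c, d⟩
    · rintro ⟨a, -, -, b, c, d⟩
      exact ⟨by omega, by omega, c, d⟩
  ext w
  constructor
  · rintro ⟨t, ht, rfl⟩
    exact (key t).1 ht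
  · intro hw
    obtain ⟨t, rfl⟩ := (exists_treeWord_eq_iff w).2 ⟨hw.2.1, hw.2.2.1⟩
    exact ⟨t, (key t).2 hw, rfl⟩

theorem treeChords_erase_image_treeSet {n : ℕ} (hn : 1 ≤ n) (l s : ℕ) :
    (fun t => (treeChords 1 t).erase (1, n + 2)) '' treeSet n l s = TriSet (n + 2) l s := by
  have key : ∀ t : BinaryTree Unit, t.numNodes = n → (t ∈ treeSet n l s ↔
      (treeChords 1 t).erase (1, n + 2) ∈ TriSet (n + 2) l s) := by
    rintro t rfl
    have hmem : (1, t.numNodes + 2) ∈ treeChords 1 t := by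
      have := outer_mem_treeChords hn 1
      rwa [show 1 + t.numNodes + 1 = t.numNodes + 2 by omega] at this
    have htri : IsTriangulation (t.numNodes + 2) ((treeChords 1 t).erase (1, t.numNodes + 2)) := by
      rw [isTriangulation_iff (by omega), Finset.insert_erase hmem]
      refine ⟨by simp, ?_⟩
      have := isIntervalTriangulation_treeChords t 1
      rwa [show 1 + t.numNodes + 1 = t.numNodes + 2 by omega] at this
    have hlast : ∀ L : List (ℕ × ℕ), (L.getLastD (0, 0)).2 = (L.map Prod.snd).getLastD 0 := by
      intro L
      rcases L.eq_nil_or_concat with rfl | ⟨M, a, rfl⟩ <;> simp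
    simp only [treeSet, TriSet, Set.mem_ofPred_eq, htri, true_and, hlast,
      ← map_snd_fanList_erase t, List.length_map, List.filter_map]
    rfl
  ext S
  constructor
  · rintro ⟨t, ht, rfl⟩
    exact (key t ht.1).1 ht
  · intro hS
    obtain ⟨hnot, htri⟩ := (isTriangulation_iff (by omega) S).1 hS.1
    rw [show n + 2 = 1 + n + 1 by omega] at htri
    obtain ⟨t, ht, hc⟩ := IsIntervalTriangulation.exists_tree n 1 _ htri
    have hSt : (treeChords 1 t).erase (1, n + 2) = S := by
      rw [hc, show n + 2 = 1 + n + 1 by omega]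
      exact Finset.erase_insert (by rwa [show 1 + n + 1 = n + 2 by omega])
    exact ⟨t, (key t ht).2 (hSt ▸ hS), hSt⟩

theorem injOn_treeChords_erase {n : ℕ} (hn : 1 ≤ n) (l s : ℕ) :
    Set.InjOn (fun t => (treeChords 1 t).erase (1, n + 2)) (treeSet n l s) := by
  intro t ht t' ht' h
  have hmem : ∀ u ∈ treeSet n l s, (1, n + 2) ∈ treeChords 1 u := by
    intro u hu
    have := outer_mem_treeChords (t := u) (hu.1 ▸ hn) 1
    rwa [hu.1, show 1 + n + 1 = n + 2 by omega] at this
  refine treeChords_injective t t' 1 (ht.1.trans ht'.1.symm) ?_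
  rw [← Finset.insert_erase (hmem t ht), ← Finset.insert_erase (hmem t' ht')]
  exact congrArg _ h

/-- For all `n`, `l ≥ 1` and `s` with `n ≥ s + 2l`, `Dyck(n,l,s)` is in bijection with
`Tri(n+2, l, s)`. -/
theorem dyck_equiv_tri (n l s : ℕ) (hl : 1 ≤ l) (hn : s + 2 * l ≤ n) :
    Nonempty (↥(DyckSet n l s) ≃ ↥(TriSet (n + 2) l s)) := by
  have h1 : 1 ≤ n := by omega
  rw [← treeWord_image_treeSet, ← treeChords_erase_image_treeSet h1]
  exact ⟨(Equiv.Set.imageOfInjOn _ _ treeWord_injective.injOn).symm.trans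
    (Equiv.Set.imageOfInjOn _ _ (injOn_treeChords_erase h1 l s))⟩
end
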